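/- There is a constant C > 0 such that for every T > 0 and every smooth decaying solution φ of the cubic defocusing NLS on [0,T] × ℝ³, one has the spacetime L⁴ bound ∫₀^T ∫_{ℝ³} |φ(t,x)|⁴ dx dt ≤ C ‖φ(0,·)‖²_{L²(ℝ³)} sup_{t ∈ [0,T]} ‖φ(t,·)‖²_{Ḣ^{1/2}(ℝ³)}. -/

import Mathlib

open MeasureTheory Real Complex Filter
open scoped FourierTransform ContDiff ENNReal

noncomputable section

abbrev E3 := EuclideanSpace ℝ (Fin 3)

/-- the `i`-th standard basis vector of `ℝ³`. -/
def e3 (i : Fin 3) : E3 := EuclideanSpace.single i (1 : ℝ)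

/-- the `i`-th spatial partial derivative. -/
def pd (g : E3 → ℂ) (i : Fin 3) (x : E3) : ℂ := fderiv ℝ g x (e3 i)

/-- the (spatial) Laplacian. -/
def lap (g : E3 → ℂ) (x : E3) : ℂ := ∑ i : Fin 3, fderiv ℝ (fun y => pd g i y) x (e3 i)

/-- the antiderivative `F(z) = ∫₀^z f(s) ds` of `f`. -/
def Fa (f : ℝ → ℝ) (z : ℝ) : ℝ := ∫ s in (0:ℝ)..z, f s

/-- `u` is a smooth decaying solution of the gNLS `i ∂ₜ u + α Δ u = μ f(|u|²) u`
on `[0,T] × ℝ³`: it is jointly smooth, every time derivative slice is a Schwartz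
function of `x`, and the equation holds pointwise on `[0,T] × ℝ³`. -/
structure IsSolution (α μ : ℝ) (f : ℝ → ℝ) (T : ℝ) (u : ℝ → E3 → ℂ) : Prop where
  smooth : ContDiff ℝ ∞ (fun p : ℝ × E3 => u p.1 p.2)
  schwartz : ∀ (k : ℕ) (t : ℝ), ∃ g : SchwartzMap E3 ℂ,
      ∀ x, iteratedDeriv k (fun s => u s x) t = g x
  eqn : ∀ t ∈ Set.Icc (0:ℝ) T, ∀ x : E3,
      Complex.I * deriv (fun s => u s x) t + (α : ℂ) * lap (u t) x
        = ((μ * f (Complex.normSq (u t x)) : ℝ) : ℂ) * u t x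

/-- the `i`-th component of the mass current `Im (conj u ∇u)`. -/
def massCur (g : E3 → ℂ) (i : Fin 3) (x : E3) : ℝ := ((starRingEnd ℂ) (g x) * pd g i x).im

/-- the Morawetz action centered at `y`. -/
def morAction (g : E3 → ℂ) (y : E3) : ℝ :=
  ∫ x : E3, ∑ i : Fin 3, massCur g i x * ((x i - y i) / ‖x - y‖)

/-- `|∇̸_y g(x)|²`, the squared norm of the angular part of the gradient. -/
def angGradSq (g : E3 → ℂ) (y x : E3) : ℝ :=
  ∑ i : Fin 3, Complex.normSq (pd g i x -
    (((x i - y i) / ‖x - y‖ : ℝ) : ℂ) *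
      ∑ j : Fin 3, (((x j - y j) / ‖x - y‖ : ℝ) : ℂ) * pd g j x)

/-- squared homogeneous Sobolev norm `‖g‖²_{Ḣ^σ}`. -/
def sobSq (σ : ℝ) (g : E3 → ℂ) : ℝ := ∫ ξ : E3, ‖ξ‖ ^ (2 * σ) * ‖𝓕 g ξ‖ ^ 2


section

/-! ### Schwartz functions as a predicate -/
section SchPred
variable {F G : Type*} [NormedAddCommGroup F] [NormedSpace ℝ F] [NormedAddCommGroup G] [NormedSpace ℝ G]

/-- `f` is a Schwartz function. -/
def Sch (f : E3 → F) : Prop := ∃ s : SchwartzMap E3 F, ∀ x, f x = s x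

/-- directional derivative along `e3 i`. -/
def dd (i : Fin 3) (f : E3 → F) (x : E3) : F := fderiv ℝ f x (e3 i)

theorem Sch.coe (s : SchwartzMap E3 F) : Sch (fun x => s x) := ⟨s, fun _ => rfl⟩
theorem Sch.coe' (s : SchwartzMap E3 F) : Sch (s : E3 → F) := ⟨s, fun _ => rfl⟩

theorem Sch.contDiff {f : E3 → F} (h : Sch f) : ContDiff ℝ ∞ f := by
  obtain ⟨s, hs⟩ := h
  rw [show f = s from funext hs]; exact s.smooth'

theorem Sch.continuous {f : E3 → F} (h : Sch f) : Continuous f := h.contDiff.continuous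
theorem Sch.differentiable {f : E3 → F} (h : Sch f) : Differentiable ℝ f :=
  h.contDiff.differentiable (by simp)
theorem Sch.da {f : E3 → F} (h : Sch f) (x : E3) : DifferentiableAt ℝ f x :=
  h.differentiable x

theorem Sch.integrable {f : E3 → F} (h : Sch f) : Integrable f := by
  obtain ⟨s, hs⟩ := h
  rw [show f = s from funext hs]; exact s.integrable

theorem Sch.congr {f g : E3 → F} (h : Sch f) (e : ∀ x, g x = f x) : Sch g := by
  obtain ⟨s, hs⟩ := h
  exact ⟨s, fun x => (e x).trans (hs x)⟩

theorem Sch.add {f g : E3 → F} (h : Sch f) (k : Sch g) : Sch (fun x => f x + g x) := by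
  obtain ⟨s, hs⟩ := h
  obtain ⟨t, ht⟩ := k
  exact ⟨s + t, fun x => by simp [hs, ht]⟩
theorem Sch.sub {f g : E3 → F} (h : Sch f) (k : Sch g) : Sch (fun x => f x - g x) := by
  obtain ⟨s, hs⟩ := h
  obtain ⟨t, ht⟩ := k
  exact ⟨s - t, fun x => by simp [hs, ht]⟩
theorem Sch.neg {f : E3 → F} (h : Sch f) : Sch (fun x => - f x) := by
  obtain ⟨s, hs⟩ := h
  exact ⟨- s, fun x => by simp [hs]⟩
theorem Sch.sum {ι : Type*} (a : Finset ι) {f : ι → E3 → F} (h : ∀ i ∈ a, Sch (f i)) :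
    Sch (fun x => ∑ i ∈ a, f i x) := by
  classical
  induction a using Finset.induction_on with
  | empty => exact ⟨0, fun x => by simp⟩
  | insert i a hi ih =>
    have := (h i (Finset.mem_insert_self _ _)).add (ih fun j hj => h j (Finset.mem_insert_of_mem hj))
    exact this.congr fun x => by rw [Finset.sum_insert hi]

theorem Sch.bil {H : Type*} [NormedAddCommGroup H] [NormedSpace ℝ H] (B : F →L[ℝ] G →L[ℝ] H)
    {f : E3 → F} {g : E3 → G} (h : Sch f) (hg : g.HasTemperateGrowth) :
    Sch (fun x => B (f x) (g x)) := by
  obtain ⟨s, hs⟩ := h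
  exact ⟨SchwartzMap.bilinLeftCLM B hg s, fun x => by
    simp only [SchwartzMap.bilinLeftCLM_apply, hs]⟩

theorem Sch.clm (B : F →L[ℝ] G) {f : E3 → F} (h : Sch f) : Sch (fun x => B (f x)) := by
  have := Sch.bil ((ContinuousLinearMap.lsmul ℝ ℝ (E := G)).flip ∘L B) h
    (Function.HasTemperateGrowth.const (1:ℝ) : (fun _ : E3 => (1:ℝ)).HasTemperateGrowth)
  exact this.congr fun x => by simp

theorem Sch.temp {f : E3 → F} (h : Sch f) : f.HasTemperateGrowth := by
  obtain ⟨s, hs⟩ := h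
  rw [show f = s from funext hs]; exact s.hasTemperateGrowth

theorem Sch.smulT {f : E3 → F} {a : E3 → ℝ} (ha : a.HasTemperateGrowth) (h : Sch f) :
    Sch (fun x => a x • f x) :=
  (Sch.bil (ContinuousLinearMap.lsmul ℝ ℝ (E := F)).flip h ha).congr fun x => by simp

theorem Sch.mulT {R : Type*} [NormedRing R] [NormedAlgebra ℝ R] {f : E3 → R} {a : E3 → R}
    (ha : a.HasTemperateGrowth) (h : Sch f) :
    Sch (fun x => a x * f x) :=
  (Sch.bil (ContinuousLinearMap.mul ℝ R).flip h ha).congr fun x => by simp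

theorem Sch.mul {R : Type*} [NormedRing R] [NormedAlgebra ℝ R] {f : E3 → R} {a : E3 → R}
    (ha : Sch a) (h : Sch f) : Sch (fun x => a x * f x) := Sch.mulT ha.temp h

theorem Sch.cmul {R : Type*} [NormedRing R] [NormedAlgebra ℝ R] {f : E3 → R} (c : R)
    (h : Sch f) : Sch (fun x => c * f x) := Sch.mulT (Function.HasTemperateGrowth.const c) h

theorem Sch.dd {f : E3 → F} (h : Sch f) (i : Fin 3) : Sch (dd i f) := by
  obtain ⟨s, hs⟩ := h
  refine ⟨LineDeriv.lineDerivOp (e3 i) s, fun x => ?_⟩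
  rw [SchwartzMap.lineDerivOp_apply_eq_fderiv, show f = s from funext hs]; rfl

theorem Sch.pd {f : E3 → ℂ} (h : Sch f) (i : Fin 3) : Sch (fun x => pd f i x) := h.dd i

theorem Sch.re {f : E3 → ℂ} (h : Sch f) : Sch (fun x => (f x).re) := h.clm Complex.reCLM
theorem Sch.im {f : E3 → ℂ} (h : Sch f) : Sch (fun x => (f x).im) := h.clm Complex.imCLM
theorem Sch.conj {f : E3 → ℂ} (h : Sch f) : Sch (fun x => (starRingEnd ℂ) (f x)) :=
  h.clm (Complex.conjCLE : ℂ →L[ℝ] ℂ)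
theorem Sch.ofReal {f : E3 → ℝ} (h : Sch f) : Sch (fun x => (f x : ℂ)) := h.clm Complex.ofRealCLM

theorem Sch.normSq {f : E3 → ℂ} (h : Sch f) : Sch (fun x => Complex.normSq (f x)) :=
  ((h.re.mul h.re).add (h.im.mul h.im)).congr fun x => by rw [Complex.normSq_apply]
theorem Sch.norm_sq {f : E3 → ℂ} (h : Sch f) : Sch (fun x => ‖f x‖ ^ 2) :=
  h.normSq.congr fun x => by rw [Complex.normSq_eq_norm_sq]
theorem Sch.norm_four {f : E3 → ℂ} (h : Sch f) : Sch (fun x => ‖f x‖ ^ 4) :=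
  (h.norm_sq.mul h.norm_sq).congr fun x => by ring
theorem Sch.mulNorm {f g : E3 → ℂ} (h : Sch f) (k : Sch g) :
    Integrable (fun x => ‖f x‖ * ‖g x‖) := by
  have := (h.mul k).integrable.norm
  simpa using this
theorem Sch.lap {f : E3 → ℂ} (h : Sch f) : Sch (lap f) :=
  Sch.sum _ fun i _ => (h.dd i).dd i

/-! ### rules for `dd` -/
theorem dd_add {f g : E3 → F} {x : E3} (i : Fin 3) (hf : DifferentiableAt ℝ f x)
    (hg : DifferentiableAt ℝ g x) : dd i (fun y => f y + g y) x = dd i f x + dd i g x := by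
  simp only [dd]; rw [fderiv_fun_add hf hg]; rfl
theorem dd_sub {f g : E3 → F} {x : E3} (i : Fin 3) (hf : DifferentiableAt ℝ f x)
    (hg : DifferentiableAt ℝ g x) : dd i (fun y => f y - g y) x = dd i f x - dd i g x := by
  simp only [dd]; rw [fderiv_fun_sub hf hg]; rfl
theorem dd_neg {f : E3 → F} {x : E3} (i : Fin 3) : dd i (fun y => - f y) x = - dd i f x := by
  simp only [dd]; rw [fderiv_fun_neg]; rfl
theorem dd_const (c : F) {x : E3} (i : Fin 3) : dd i (fun _ => c) x = 0 := by
  simp [dd]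
theorem dd_mul {R : Type*} [NormedCommRing R] [NormedAlgebra ℝ R] {f g : E3 → R} {x : E3} (i : Fin 3)
    (hf : DifferentiableAt ℝ f x)
    (hg : DifferentiableAt ℝ g x) : dd i (fun y => f y * g y) x = dd i f x * g x + f x * dd i g x := by
  simp only [dd]; rw [fderiv_fun_mul hf hg]; simp; ring
theorem dd_cmul {R : Type*} [NormedCommRing R] [NormedAlgebra ℝ R] {g : E3 → R} {x : E3} (i : Fin 3)
    (c : R) (hg : DifferentiableAt ℝ g x) : dd i (fun y => c * g y) x = c * dd i g x := by
  rw [dd_mul i (differentiableAt_const c) hg, dd_const]; simp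
theorem dd_clm (B : F →L[ℝ] G) {f : E3 → F} {x : E3} (i : Fin 3) (hf : DifferentiableAt ℝ f x) :
    dd i (fun y => B (f y)) x = B (dd i f x) := by
  simp only [dd]
  have := (B.hasFDerivAt.comp x hf.hasFDerivAt).fderiv
  rw [show (fun y => B (f y)) = B ∘ f from rfl, this]; rfl
theorem dd_conj {f : E3 → ℂ} {x : E3} (i : Fin 3) (hf : DifferentiableAt ℝ f x) :
    dd i (fun y => (starRingEnd ℂ) (f y)) x = (starRingEnd ℂ) (dd i f x) :=
  dd_clm (Complex.conjCLE : ℂ →L[ℝ] ℂ) i hf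
theorem dd_re {f : E3 → ℂ} {x : E3} (i : Fin 3) (hf : DifferentiableAt ℝ f x) :
    dd i (fun y => (f y).re) x = (dd i f x).re := dd_clm Complex.reCLM i hf
theorem dd_im {f : E3 → ℂ} {x : E3} (i : Fin 3) (hf : DifferentiableAt ℝ f x) :
    dd i (fun y => (f y).im) x = (dd i f x).im := dd_clm Complex.imCLM i hf
theorem dd_ofReal {f : E3 → ℝ} {x : E3} (i : Fin 3) (hf : DifferentiableAt ℝ f x) :
    dd i (fun y => ((f y : ℝ) : ℂ)) x = ((dd i f x : ℝ) : ℂ) := dd_clm Complex.ofRealCLM i hf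
theorem dd_coord {x : E3} (i j : Fin 3) : dd i (fun y : E3 => y j) x = if i = j then 1 else 0 := by
  have := dd_clm (EuclideanSpace.proj (𝕜 := ℝ) j : E3 →L[ℝ] ℝ) i (differentiableAt_id (x := x))
  refine this.trans ?_
  simp only [dd, fderiv_id, ContinuousLinearMap.id_apply, e3]
  simp [eq_comm]
theorem dd_comm {f : E3 → F} (hf : ContDiff ℝ 2 f) (i j : Fin 3) (x : E3) :
    dd i (dd j f) x = dd j (dd i f) x := by
  have h1 : ∀ a b : Fin 3, dd a (dd b f) x = fderiv ℝ (fderiv ℝ f) x (e3 a) (e3 b) := by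
    intro a b
    have hd : DifferentiableAt ℝ (fderiv ℝ f) x :=
      (hf.fderiv_right (m := 1) (by norm_num)).differentiable (by norm_num) x
    have : dd a (fun y => (ContinuousLinearMap.apply ℝ F (e3 b)) (fderiv ℝ f y)) x = _ :=
      dd_clm (ContinuousLinearMap.apply ℝ F (e3 b)) a hd
    exact this
  rw [h1, h1]
  exact (hf.contDiffAt.isSymmSndFDerivAt (by simp)) _ _
theorem dd_sub_const (f : E3 → F) (y x : E3) (i : Fin 3) :
    dd i (fun x => f (x - y)) x = dd i f (x - y) := by
  simp only [dd]; rw [fderiv_comp_sub]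
theorem dd_comp_sub_left (f : E3 → F) (y x : E3) (i : Fin 3) (hf : DifferentiableAt ℝ f (x - y)) :
    dd i (fun y => f (x - y)) y = - dd i f (x - y) := by
  simp only [dd]
  have h2 : HasFDerivAt (fun y : E3 => x - y) (-(ContinuousLinearMap.id ℝ E3)) y :=
    (hasFDerivAt_id y).const_sub x
  have := (hf.hasFDerivAt.comp y h2).fderiv
  rw [show (fun y => f (x - y)) = f ∘ (fun y => x - y) from rfl, this]; simp

theorem temp_dd {f : E3 → F} (hf : f.HasTemperateGrowth) (i : Fin 3) : (dd i f).HasTemperateGrowth := by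
  have h1 : (fderiv ℝ f).HasTemperateGrowth := by
    refine ⟨hf.1.fderiv_right (by simp), fun n => ?_⟩
    obtain ⟨k, C, h⟩ := hf.2 (n+1)
    exact ⟨k, C, fun x => by rw [norm_iteratedFDeriv_fderiv]; exact h x⟩
  have := (ContinuousLinearMap.apply ℝ F (e3 i)).hasTemperateGrowth.comp h1
  exact this

/-- Integration by parts: temperate weight against Schwartz function. -/
theorem ibpT {R : Type*} [NormedCommRing R] [NormedAlgebra ℝ R] {a f : E3 → R} 
    (ha : a.HasTemperateGrowth)
    (hf : Sch f) (i : Fin 3) : ∫ x, a x * dd i f x = - ∫ x, dd i a x * f x := by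
  refine integral_bilinear_fderiv_right_eq_neg_left_of_integrable (B := ContinuousLinearMap.mul ℝ R)
    ?_ ?_ ?_ ?_ ?_
  · exact (Sch.mulT (temp_dd ha i) hf).integrable
  · exact (Sch.mulT ha (hf.dd i)).integrable
  · exact (Sch.mulT ha hf).integrable
  · exact fun x _ => ha.1.differentiable (by simp) x
  · exact fun x _ => hf.da x

theorem temp_ofReal {a : E3 → ℝ} (ha : a.HasTemperateGrowth) :
    (fun x => (a x : ℂ)).HasTemperateGrowth :=
  Complex.ofRealCLM.hasTemperateGrowth.comp ha

theorem temp_sub {a : E3 → F} (ha : a.HasTemperateGrowth) (y : E3) :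
    (fun x => a (x - y)).HasTemperateGrowth := by
  refine ha.comp (f := fun x : E3 => x - y) ?_
  exact Function.HasTemperateGrowth.id'.sub (Function.HasTemperateGrowth.const y)
theorem temp_sub' {a : E3 → F} (ha : a.HasTemperateGrowth) (x : E3) :
    (fun y => a (x - y)).HasTemperateGrowth := by
  refine ha.comp (f := fun y : E3 => x - y) ?_
  exact (Function.HasTemperateGrowth.const x).sub Function.HasTemperateGrowth.id'
end SchPred

/-! ### Cauchy-Schwarz -/
theorem cs_int {α : Type*} [MeasurableSpace α] {μ : Measure α} {f g : α → ℝ}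
    (hf : AEStronglyMeasurable f μ) (hg : AEStronglyMeasurable g μ)
    (hf2 : Integrable (fun x => f x ^ 2) μ) (hg2 : Integrable (fun x => g x ^ 2) μ) :
    ∫ x, |f x| * |g x| ∂μ ≤ √(∫ x, f x ^ 2 ∂μ) * √(∫ x, g x ^ 2 ∂μ) := by
  have h := integral_mul_le_Lp_mul_Lq_of_nonneg (μ := μ) (p := 2) (q := 2)
    (by constructor <;> norm_num) (f := fun x => |f x|) (g := fun x => |g x|)
    (by filter_upwards with x using abs_nonneg _) (by filter_upwards with x using abs_nonneg _)
    (by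
      have := (memLp_two_iff_integrable_sq hf).2 hf2
      simpa using this.norm) (by
      have := (memLp_two_iff_integrable_sq hg).2 hg2
      simpa using this.norm)
  simpa [Real.sqrt_eq_rpow] using h

theorem cs_mul_integrable {α : Type*} [MeasurableSpace α] {μ : Measure α} {f g : α → ℝ}
    (hf : AEStronglyMeasurable f μ) (hg : AEStronglyMeasurable g μ)
    (hf2 : Integrable (fun x => f x ^ 2) μ) (hg2 : Integrable (fun x => g x ^ 2) μ) :
    Integrable (fun x => |f x| * |g x|) μ := by
  refine Integrable.mono' (hf2.add hg2) (hf.norm.mul hg.norm) ?_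
  filter_upwards with x
  simp only [norm_mul, Real.norm_eq_abs, abs_abs, Pi.add_apply]
  nlinarith [sq_nonneg (|f x| - |g x|), sq_abs (f x), sq_abs (g x), abs_nonneg (f x), abs_nonneg (g x)]

/-- L2 norm of a function. -/
def l2 (f : E3 → ℂ) : ℝ := √(∫ x, ‖f x‖ ^ 2)
theorem l2_nonneg (f : E3 → ℂ) : 0 ≤ l2 f := Real.sqrt_nonneg _
theorem l2_sq (f : E3 → ℂ) : l2 f ^ 2 = ∫ x, ‖f x‖ ^ 2 :=
  Real.sq_sqrt (integral_nonneg fun x => by positivity)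
theorem cs_sch {f g : E3 → ℂ} (hf : Sch f) (hg : Sch g) :
    ∫ x, ‖f x‖ * ‖g x‖ ≤ l2 f * l2 g := by
  have := cs_int (μ := volume) (f := fun x => ‖f x‖) (g := fun x => ‖g x‖)
    hf.continuous.norm.aestronglyMeasurable hg.continuous.norm.aestronglyMeasurable
    hf.norm_sq.integrable hg.norm_sq.integrable
  simpa [l2] using this
end

section

/-! ### The regularised kernel -/
/-- `1/√(|z|²+ε²)` -/
def kap (ε : ℝ) (z : E3) : ℝ := (√(‖z‖ ^ 2 + ε ^ 2))⁻¹
/-- component of the regularised unit vector field -/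
def bv (ε : ℝ) (j : Fin 3) (z : E3) : ℝ := z j * kap ε z
/-- divergence of `bv` -/
def dvb (ε : ℝ) (z : E3) : ℝ := 2 * kap ε z + ε ^ 2 * kap ε z ^ 3

theorem nsq3 (z : E3) : ‖z‖ ^ 2 = z 0 ^ 2 + z 1 ^ 2 + z 2 ^ 2 := by
  rw [EuclideanSpace.norm_sq_eq]; simp [Fin.sum_univ_three]

theorem coord_temp (j : Fin 3) : (fun z : E3 => z j).HasTemperateGrowth :=
  (EuclideanSpace.proj (𝕜 := ℝ) j : E3 →L[ℝ] ℝ).hasTemperateGrowth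
theorem coord_diff (j : Fin 3) (z : E3) : DifferentiableAt ℝ (fun z : E3 => z j) z :=
  (EuclideanSpace.proj (𝕜 := ℝ) j : E3 →L[ℝ] ℝ).differentiableAt

section kap
theorem kap_pos {ε : ℝ} (hε : 0 < ε) (z : E3) : 0 < kap ε z := by
  unfold kap; positivity
theorem kap_sq {ε : ℝ} (hε : 0 < ε) (z : E3) : kap ε z ^ 2 * (‖z‖ ^ 2 + ε ^ 2) = 1 := by
  unfold kap
  rw [inv_pow, Real.sq_sqrt (by positivity)]
  exact inv_mul_cancel₀ (by positivity)
theorem kap_le {ε : ℝ} (hε : 0 < ε) (z : E3) : kap ε z ≤ ε⁻¹ := by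
  unfold kap
  gcongr
  exact Real.le_sqrt_of_sq_le (by nlinarith [sq_nonneg ‖z‖])
theorem kap_temp {ε : ℝ} (hε : 0 < ε) : (kap ε).HasTemperateGrowth := by
  have h1 := Function.hasTemperateGrowth_one_add_norm_sq_rpow E3 (-(1/2:ℝ))
  have h2 := h1.comp (f := fun z : E3 => ε⁻¹ • z)
    ((Function.HasTemperateGrowth.const ε⁻¹).smul Function.HasTemperateGrowth.id')
  have h3 := (Function.HasTemperateGrowth.const ε⁻¹ : (fun _ : E3 => ε⁻¹).HasTemperateGrowth).mul h2
  refine (funext fun z => ?_ : kap ε = _) ▸ h3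
  simp only [kap, Pi.mul_apply, Function.comp, norm_smul, norm_inv, Real.norm_eq_abs, abs_of_pos hε]
  rw [Real.rpow_neg (by positivity), ← Real.sqrt_eq_rpow, ← mul_inv]
  congr 1
  rw [Real.sqrt_eq_iff_mul_self_eq (by positivity) (by positivity)]
  have := Real.mul_self_sqrt (show 0 ≤ 1 + (ε⁻¹ * ‖z‖) ^ 2 by positivity)
  symm
  calc ε * √(1 + (ε⁻¹ * ‖z‖) ^ 2) * (ε * √(1 + (ε⁻¹ * ‖z‖) ^ 2)) 
      = ε ^ 2 * (√(1 + (ε⁻¹ * ‖z‖) ^ 2) * √(1 + (ε⁻¹ * ‖z‖) ^ 2)) := by ring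
    _ = _ := by rw [this]; field_simp; ring
theorem kap_diff {ε : ℝ} (hε : 0 < ε) (z : E3) : DifferentiableAt ℝ (kap ε) z :=
  (kap_temp hε).1.differentiable (by simp) z
theorem dd_kap {ε : ℝ} (hε : 0 < ε) (i : Fin 3) (z : E3) : dd i (kap ε) z = - (z i * kap ε z ^ 3) := by
  -- differentiate kap^2 * (|z|^2+ε^2) = 1
  have hd := kap_diff hε z
  have h0 : dd i (fun z : E3 => (kap ε z * kap ε z) * (‖z‖ ^ 2 + ε ^ 2)) z = 0 := by
    have : (fun z : E3 => (kap ε z * kap ε z) * (‖z‖ ^ 2 + ε ^ 2)) = fun _ => (1:ℝ) := by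
      ext z; rw [← kap_sq hε z]; ring
    rw [this, dd_const]
  have hn : dd i (fun z : E3 => ‖z‖ ^ 2 + ε ^ 2) z = 2 * z i := by
    have : HasFDerivAt (fun z : E3 => ‖z‖ ^ 2 + ε ^ 2) (2 • (innerSL ℝ z)) z :=
      (hasStrictFDerivAt_norm_sq z).hasFDerivAt.add_const _
    simp only [dd, this.fderiv]
    simp [e3, EuclideanSpace.inner_single_right]
  have hnd : DifferentiableAt ℝ (fun z : E3 => ‖z‖ ^ 2 + ε ^ 2) z :=
    ((hasStrictFDerivAt_norm_sq z).hasFDerivAt.add_const _).differentiableAt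
  rw [dd_mul i (f := fun z => kap ε z * kap ε z) (hd.mul hd) hnd, hn, dd_mul i hd hd] at h0
  have hp := kap_pos hε z
  have hs := kap_sq hε z
  have h1 : (‖z‖ ^ 2 + ε ^ 2) ≠ 0 := by positivity
  have h2 : dd i (kap ε) z * (‖z‖ ^ 2 + ε ^ 2) = - (kap ε z * z i) := by
    have : (2 * kap ε z) * (dd i (kap ε) z * (‖z‖ ^ 2 + ε ^ 2) + (kap ε z * z i)) = 0 := by
      linarith
    rcases mul_eq_zero.1 this with h | h
    · linarith
    · linarith
  calc dd i (kap ε) z = dd i (kap ε) z * (‖z‖ ^ 2 + ε ^ 2) * kap ε z ^ 2 := by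
        rw [mul_assoc, mul_comm (‖z‖ ^ 2 + ε ^ 2), hs, mul_one]
    _ = _ := by rw [h2]; ring
theorem bv_temp {ε : ℝ} (hε : 0 < ε) (j : Fin 3) : (bv ε j).HasTemperateGrowth :=
  (coord_temp j).mul (kap_temp hε)
theorem bv_diff {ε : ℝ} (hε : 0 < ε) (j : Fin 3) (z : E3) : DifferentiableAt ℝ (bv ε j) z :=
  (bv_temp hε j).1.differentiable (by simp) z
theorem dd_bv {ε : ℝ} (hε : 0 < ε) (k j : Fin 3) (z : E3) :
    dd k (bv ε j) z = (if k = j then kap ε z else 0) - z j * z k * kap ε z ^ 3 := by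
  unfold bv
  rw [dd_mul k (coord_diff j z) (kap_diff hε z), dd_coord, dd_kap hε]
  split_ifs <;> ring
theorem div_bv {ε : ℝ} (hε : 0 < ε) (z : E3) : ∑ j, dd j (bv ε j) z = dvb ε z := by
  simp only [dd_bv hε, Fin.sum_univ_three, dvb, if_true]
  have := kap_sq hε z
  rw [nsq3] at this
  linear_combination (-kap ε z) * this
theorem bv_sq_le {ε : ℝ} (hε : 0 < ε) (z : E3) : ∑ j, bv ε j z ^ 2 ≤ 1 := by
  have := kap_sq hε z
  rw [nsq3] at this
  simp only [Fin.sum_univ_three, bv]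
  nlinarith [mul_nonneg (sq_nonneg ε) (sq_nonneg (kap ε z))]
theorem dvb_temp {ε : ℝ} (hε : 0 < ε) : (dvb ε).HasTemperateGrowth :=
  ((Function.HasTemperateGrowth.const (2:ℝ)).mul (kap_temp hε)).add
    ((Function.HasTemperateGrowth.const (ε^2)).mul ((kap_temp hε).pow 3))
theorem dvb_nonneg {ε : ℝ} (hε : 0 < ε) (z : E3) : 0 ≤ dvb ε z := by
  have := kap_pos hε z
  unfold dvb; positivity
theorem dvb_le {ε : ℝ} (hε : 0 < ε) (z : E3) : dvb ε z ≤ 3 * kap ε z := by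
  have h := kap_sq hε z
  have hp := kap_pos hε z
  unfold dvb
  have : ε ^ 2 * kap ε z ^ 2 ≤ 1 := by nlinarith [sq_nonneg (kap ε z * ‖z‖)]
  nlinarith
theorem dd_kap_pow {ε : ℝ} (hε : 0 < ε) (i : Fin 3) (n : ℕ) (z : E3) :
    dd i (fun z => kap ε z ^ n) z = - (n * z i * kap ε z ^ (n+2)) := by
  have h := ((kap_diff hε z).hasFDerivAt.pow n).fderiv
  have h2 := dd_kap hε i z
  simp only [dd] at h2 ⊢
  rw [h]
  simp only [_root_.smul_apply, h2, smul_eq_mul, nsmul_eq_mul]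
  rcases n with _ | n
  · simp
  · simp only [Nat.add_sub_cancel]; push_cast; ring
theorem dd_dvb {ε : ℝ} (hε : 0 < ε) (i : Fin 3) (z : E3) :
    dd i (dvb ε) z = - 2 * z i * kap ε z ^ 3 - 3 * ε ^ 2 * z i * kap ε z ^ 5 := by
  have hk : DifferentiableAt ℝ (fun z => kap ε z ^ 3) z := (kap_diff hε z).pow 3
  unfold dvb
  rw [dd_add i ((kap_diff hε z).const_mul 2) (hk.const_mul _), dd_cmul i _ (kap_diff hε z),
    dd_cmul i _ hk, dd_kap hε, dd_kap_pow hε]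
  push_cast; ring
theorem lap_dvb {ε : ℝ} (hε : 0 < ε) (z : E3) : ∑ i, dd i (dd i (dvb ε)) z = - (15 * ε ^ 4 * kap ε z ^ 7) := by
  have h : ∀ i, dd i (dd i (dvb ε)) z = - 2 * (kap ε z ^ 3 - 3 * z i ^ 2 * kap ε z ^ 5)
      - 3 * ε ^ 2 * (kap ε z ^ 5 - 5 * z i ^ 2 * kap ε z ^ 7) := by
    intro i
    rw [show dd i (dvb ε) = fun z => (-2) * (z i * kap ε z ^ 3) - (3 * ε ^ 2) * (z i * kap ε z ^ 5) from
      funext fun z => by rw [dd_dvb hε]; ring]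
    have hk : ∀ n, DifferentiableAt ℝ (fun z => kap ε z ^ n) z := fun n => (kap_diff hε z).pow n
    have hk2 : ∀ n, DifferentiableAt ℝ (fun z => z i * kap ε z ^ n) z :=
      fun n => (coord_diff i z).mul (hk n)
    rw [dd_sub i ((hk2 3).const_mul _) ((hk2 5).const_mul _), dd_cmul i _ (hk2 3),
      dd_cmul i _ (hk2 5), dd_mul i (coord_diff i z) (hk 3), dd_mul i (coord_diff i z) (hk 5),
      dd_coord, dd_kap_pow hε, dd_kap_pow hε]
    simp only [if_true]; push_cast; ring
  simp only [h, Fin.sum_univ_three]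
  have h := kap_sq hε z
  rw [nsq3] at h
  linear_combination (6 * kap ε z ^ 3 + 15 * ε^2 * kap ε z ^5) * h
end kap
end

section

/-! ### Fourier multipliers on Schwartz functions -/
/-- Fourier multiplier. -/
def mF (m : E3 → ℂ) (f : SchwartzMap E3 ℂ) : SchwartzMap E3 ℂ := SchwartzMap.fourierMultiplierCLM ℂ m f

theorem fourier_mF {m : E3 → ℂ} (hm : m.HasTemperateGrowth) (f : SchwartzMap E3 ℂ) (ξ : E3) :
    𝓕 (mF m f) ξ = m ξ * 𝓕 f ξ := by
  unfold mF
  rw [SchwartzMap.fourierMultiplierCLM_apply, FourierTransform.fourier_fourierInv_eq,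
    SchwartzMap.smulLeftCLM_apply_apply hm, smul_eq_mul]

/-- squared L2 norm of gradient -/
def gs (f : E3 → ℂ) : ℝ := ∫ x, ∑ j, ‖dd j f x‖ ^ 2
theorem gs_nonneg (f : E3 → ℂ) : 0 ≤ gs f := integral_nonneg fun x => by positivity

theorem Sch.gradsq {f : E3 → ℂ} (h : Sch f) : Sch (fun x => ∑ j, ‖_root_.dd j f x‖ ^ 2) :=
  Sch.sum _ fun j _ => (h.dd j).norm_sq

theorem plancherel (f : SchwartzMap E3 ℂ) : ∫ x, ‖f x‖ ^ 2 = ∫ ξ, ‖𝓕 f ξ‖ ^ 2 :=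
  (SchwartzMap.integral_norm_sq_fourier f).symm

theorem plancherel_gs (f : SchwartzMap E3 ℂ) :
    gs f = ∫ ξ, 4 * π ^ 2 * ‖ξ‖ ^ 2 * ‖𝓕 f ξ‖ ^ 2 := by
  have h1 : ∀ j, ∫ x, ‖dd j f x‖ ^ 2 = ∫ ξ : E3, 4 * π ^ 2 * (ξ j) ^ 2 * ‖𝓕 f ξ‖ ^ 2 := by
    intro j
    have e : ∀ x, dd j f x = (LineDeriv.lineDerivOp (e3 j) f : SchwartzMap E3 ℂ) x := fun x => by
      rw [SchwartzMap.lineDerivOp_apply_eq_fderiv]; rfl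
    simp only [e]
    rw [plancherel]
    congr 1; ext ξ
    rw [SchwartzMap.fourier_lineDerivOp_eq]
    have : (fun x : E3 => inner ℝ x (e3 j)).HasTemperateGrowth := by fun_prop
    rw [_root_.smul_apply, SchwartzMap.smulLeftCLM_apply_apply this]
    simp only [norm_smul, norm_mul, mul_pow]
    simp [e3, EuclideanSpace.inner_single_right, abs_of_pos Real.pi_pos]
    ring
  unfold gs
  have hF : Sch (fun ξ => 𝓕 f ξ) := Sch.coe _
  rw [integral_finsetSum _ fun j _ => ((Sch.coe' f).dd j).norm_sq.integrable]
  simp only [h1]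
  rw [← integral_finsetSum]
  · congr 1; ext ξ
    rw [nsq3]; simp only [Fin.sum_univ_three]; ring
  · intro j _
    have : Sch (fun ξ : E3 => (4 * π ^ 2 * (ξ j) ^ 2) * ‖𝓕 f ξ‖ ^ 2) :=
      Sch.mulT ((Function.HasTemperateGrowth.const _).mul ((coord_temp j).pow 2)) hF.norm_sq
    exact this.integrable

/-! ### Hardy -/
theorem hardy {ε : ℝ} (hε : 0 < ε) (y : E3) {f : E3 → ℂ} (hf : Sch f) :
    ∫ x, kap ε (x - y) ^ 2 * ‖f x‖ ^ 2 ≤ 4 * gs f := by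
  have hk : (fun x => kap ε (x - y)).HasTemperateGrowth := temp_sub (kap_temp hε) y
  have hb : ∀ j, (fun x => bv ε j (x - y)).HasTemperateGrowth := fun j => temp_sub (bv_temp hε j) y
  set a : Fin 3 → E3 → ℝ := fun j x => bv ε j (x - y) * kap ε (x - y) with ha
  have hat : ∀ j, (a j).HasTemperateGrowth := fun j => (hb j).mul hk
  have hn := hf.normSq
  have hI : Integrable (fun x => kap ε (x - y) ^ 2 * ‖f x‖ ^ 2) :=
    (Sch.mulT (hk.pow 2) hf.norm_sq).integrable
  have hdn : ∀ j x, dd j (fun x => Complex.normSq (f x)) x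
      = 2 * ((starRingEnd ℂ) (f x) * dd j f x).re := by
    intro j x
    have h1 : (fun x => Complex.normSq (f x)) = fun x => ((starRingEnd ℂ) (f x) * f x).re := by
      ext x; simp [Complex.normSq_apply]
    rw [h1, dd_re j (hf.conj.mul hf |>.da x), dd_mul j (hf.conj.da x) (hf.da x), dd_conj j (hf.da x)]
    simp; ring
  have hda : ∀ x, ∑ j, dd j (a j) x = kap ε (x - y) ^ 2 + 2 * ε ^ 2 * kap ε (x - y) ^ 4 := by
    intro x
    have : ∀ j, dd j (a j) x = kap ε (x - y) ^ 2 - 2 * (x - y) j ^ 2 * kap ε (x - y) ^ 4 := by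
      intro j
      have := dd_sub_const (fun z => bv ε j z * kap ε z) y x j
      rw [show a j = fun x => bv ε j (x - y) * kap ε (x - y) from rfl, this,
        dd_mul j (bv_diff hε j _) (kap_diff hε _), dd_bv hε, dd_kap hε, if_pos rfl]
      simp only [bv]; ring
    simp only [this, Fin.sum_univ_three]
    have h := kap_sq hε (x - y)
    rw [nsq3] at h
    linear_combination (-2 * kap ε (x-y)^2) * h
  have hibp : ∫ x, (∑ j, dd j (a j) x) * Complex.normSq (f x) 
      = ∫ x, - ∑ j, a j x * (2 * ((starRingEnd ℂ) (f x) * dd j f x).re) := by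
    simp only [Finset.sum_mul]
    have i1 : ∀ j, Integrable fun x => dd j (a j) x * Complex.normSq (f x) :=
      fun j => (Sch.mulT (temp_dd (hat j) j) hn).integrable
    have i2 : ∀ j, Integrable fun x => a j x * dd j (fun x => Complex.normSq (f x)) x :=
      fun j => (Sch.mulT (hat j) (hn.dd j)).integrable
    simp only [← hdn]
    rw [integral_finsetSum _ fun j _ => i1 j, integral_neg, integral_finsetSum _ fun j _ => i2 j,
      ← Finset.sum_neg_distrib]
    refine Finset.sum_congr rfl fun j _ => ?_
    rw [ibpT (hat j) hn j, neg_neg]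
  have hle1 : ∫ x, kap ε (x - y) ^ 2 * ‖f x‖ ^ 2 ≤ ∫ x, (∑ j, dd j (a j) x) * Complex.normSq (f x) := by
    refine integral_mono hI ?_ fun x => ?_
    · simp only [Finset.sum_mul]
      exact integrable_finsetSum _ fun j _ => (Sch.mulT (temp_dd (hat j) j) hn).integrable
    · simp only [hda, Complex.normSq_eq_norm_sq]
      have := kap_pos hε (x - y)
      gcongr
      have : 0 ≤ 2 * ε ^ 2 * kap ε (x - y) ^ 4 := by positivity
      linarith
  have hle2 : ∫ x, - ∑ j, a j x * (2 * ((starRingEnd ℂ) (f x) * dd j f x).re)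
      ≤ ∫ x, (1/2 * (kap ε (x - y) ^ 2 * ‖f x‖ ^ 2) + 2 * ∑ j, ‖dd j f x‖ ^ 2) := by
    refine integral_mono ?_ ?_ fun x => ?_
    · refine (integrable_finsetSum _ fun j _ => ?_).neg
      exact (Sch.mulT (hat j) (((hf.conj.mul (hf.dd j)).re).cmul 2)).integrable
    · exact (hI.const_mul _).add (hf.gradsq.integrable.const_mul _)
    · simp only [ha]
      have hp := kap_pos hε (x - y)
      have hb1 := bv_sq_le hε (x - y)
      have key : ∀ j, - (bv ε j (x - y) * kap ε (x - y) * (2 * ((starRingEnd ℂ) (f x) * dd j f x).re))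
          ≤ 1/2 * (bv ε j (x-y) ^ 2 * (kap ε (x - y) ^ 2 * ‖f x‖ ^ 2)) + 2 * ‖dd j f x‖ ^ 2 := by
        intro j
        have h1 : |((starRingEnd ℂ) (f x) * dd j f x).re| ≤ ‖f x‖ * ‖dd j f x‖ := by
          refine (Complex.abs_re_le_norm _).trans (by simp)
        set b := bv ε j (x - y)
        set k := kap ε (x - y)
        have h2 : - (b * k * (2 * ((starRingEnd ℂ) (f x) * dd j f x).re)) ≤ 2 * (|b| * k * (‖f x‖ * ‖dd j f x‖)) := by
          refine (neg_le_abs _).trans ?_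
          rw [abs_mul, abs_mul, abs_mul, abs_of_pos hp, abs_two]
          have : |b| * k * |((starRingEnd ℂ) (f x) * dd j f x).re| ≤ |b| * k * (‖f x‖ * ‖dd j f x‖) := by
            gcongr
          linarith
        refine h2.trans ?_
        rw [← sq_abs b]
        nlinarith [sq_nonneg (|b| * k * ‖f x‖ - 2 * ‖dd j f x‖)]
      rw [← Finset.sum_neg_distrib]
      refine (Finset.sum_le_sum fun j _ => key j).trans ?_
      rw [Finset.sum_add_distrib, ← Finset.mul_sum, ← Finset.sum_mul, ← Finset.mul_sum]
      have : (∑ j, bv ε j (x-y) ^ 2) * (kap ε (x - y) ^ 2 * ‖f x‖ ^ 2) ≤ kap ε (x - y) ^ 2 * ‖f x‖ ^ 2 :=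
        mul_le_of_le_one_left (by positivity) hb1
      linarith
  rw [integral_add (hI.const_mul _) (hf.gradsq.integrable.const_mul _), integral_const_mul,
    integral_const_mul] at hle2
  have := hle1.trans (hibp.le.trans hle2)
  change _ ≤ _ + 2 * gs f at this
  linarith

/-! ### The momentum form -/
/-- `∫ b(x-y)·Im(f̄∇g)` -/
def Bf (ε : ℝ) (y : E3) (f g : E3 → ℂ) : ℝ :=
  ∫ x, ∑ j, bv ε j (x - y) * ((starRingEnd ℂ) (f x) * dd j g x).im

section Bf
theorem Bf_int {ε : ℝ} (hε : 0 < ε) (y : E3) {f g : E3 → ℂ} (hf : Sch f) (hg : Sch g) : Integrable fun x => ∑ j, bv ε j (x - y) * ((starRingEnd ℂ) (f x) * dd j g x).im :=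
  (Sch.sum _ fun j _ => Sch.mulT (temp_sub (bv_temp hε j) y) (hf.conj.mul (hg.dd j)).im).integrable

theorem Bf_bd1 {ε : ℝ} (hε : 0 < ε) (y : E3) {f g : E3 → ℂ} (hf : Sch f) (hg : Sch g) {l : ℝ} (hl : 0 < l) :
    |Bf ε y f g| ≤ 1/2 * (l * (∫ x, ‖f x‖ ^ 2) + l⁻¹ * gs g) := by
  have h : ∫ x, 1/2 * (l * ‖f x‖ ^ 2 + l⁻¹ * ∑ j, ‖dd j g x‖ ^ 2) 
      = 1/2 * (l * (∫ x, ‖f x‖ ^ 2) + l⁻¹ * gs g) := by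
    rw [integral_const_mul, integral_add (hf.norm_sq.integrable.const_mul _)
      (hg.gradsq.integrable.const_mul _), integral_const_mul, integral_const_mul]; rfl
  rw [← h, ← Real.norm_eq_abs]
  refine norm_integral_le_of_norm_le (((hf.norm_sq.integrable.const_mul _).add
      (hg.gradsq.integrable.const_mul _)).const_mul _) (Eventually.of_forall fun x => ?_)
  have hb1 := bv_sq_le hε (x - y)
  refine (norm_sum_le _ _).trans ?_
  have key : ∀ j, ‖bv ε j (x - y) * ((starRingEnd ℂ) (f x) * dd j g x).im‖
      ≤ bv ε j (x-y) ^ 2 * (1/2 * l * ‖f x‖ ^ 2) + 1/2 * l⁻¹ * ‖dd j g x‖ ^ 2 := by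
    intro j
    have h1 : |((starRingEnd ℂ) (f x) * dd j g x).im| ≤ ‖f x‖ * ‖dd j g x‖ := by
      refine (Complex.abs_im_le_norm _).trans (by simp)
    rw [norm_mul, Real.norm_eq_abs, Real.norm_eq_abs]
    set b := bv ε j (x - y)
    refine (mul_le_mul_of_nonneg_left h1 (abs_nonneg b)).trans ?_
    have e : bv ε j (x-y) ^ 2 * (1/2 * l * ‖f x‖ ^ 2) + 1/2 * l⁻¹ * ‖dd j g x‖ ^ 2 -
       |b| * (‖f x‖ * ‖dd j g x‖) = 1/2 * l * (|b| * ‖f x‖ - l⁻¹ * ‖dd j g x‖) ^ 2 := by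
      rw [← sq_abs (bv ε j (x-y))]; field_simp; ring
    nlinarith [mul_nonneg hl.le (sq_nonneg (|b| * ‖f x‖ - l⁻¹ * ‖dd j g x‖))]
  refine (Finset.sum_le_sum fun j _ => key j).trans ?_
  rw [Finset.sum_add_distrib, ← Finset.sum_mul, ← Finset.mul_sum]
  have : (∑ j, bv ε j (x-y) ^ 2) * (1/2 * l * ‖f x‖ ^ 2) ≤ 1/2 * l * ‖f x‖ ^ 2 :=
    mul_le_of_le_one_left (by positivity) hb1
  linarith

theorem Bf_swap {ε : ℝ} (hε : 0 < ε) (y : E3) {f g : E3 → ℂ} (hf : Sch f) (hg : Sch g) : Bf ε y f g = Bf ε y g f - ∫ x, dvb ε (x - y) * ((starRingEnd ℂ) (f x) * g x).im := by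
  have hbt : ∀ j, (fun x => bv ε j (x - y)).HasTemperateGrowth := fun j => temp_sub (bv_temp hε j) y
  have hfg := (hf.conj.mul hg).im
  have e1 : ∫ x, dvb ε (x - y) * ((starRingEnd ℂ) (f x) * g x).im
      = - ∫ x, ∑ j, bv ε j (x - y) * dd j (fun x => ((starRingEnd ℂ) (f x) * g x).im) x := by
    rw [integral_finsetSum _ fun j _ => (Sch.mulT (hbt j) (hfg.dd j)).integrable]
    simp only [← div_bv hε, Finset.sum_mul]
    have i1 : ∀ j, Integrable fun x => dd j (bv ε j) (x - y) * ((starRingEnd ℂ) (f x) * g x).im :=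
      fun j => (Sch.mulT (temp_sub (temp_dd (bv_temp hε j) j) y) hfg).integrable
    rw [integral_finsetSum _ fun j _ => i1 j, ← Finset.sum_neg_distrib]
    refine Finset.sum_congr rfl fun j _ => ?_
    rw [ibpT (hbt j) hfg j, neg_neg]
    simp only [dd_sub_const]
  have i2 := Bf_int hε y hg hf
  rw [e1, sub_neg_eq_add, Bf, Bf, ← integral_add i2 ((Sch.sum _ fun j _ => Sch.mulT (hbt j) (hfg.dd j)).integrable)]
  congr 1; ext x
  rw [← Finset.sum_add_distrib]
  refine Finset.sum_congr rfl fun j _ => ?_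
  rw [dd_im j ((hf.conj.mul hg).da x), dd_mul j (hf.conj.da x) (hg.da x), dd_conj j (hf.da x)]
  simp; ring

theorem Bf_bd2 {ε : ℝ} (hε : 0 < ε) (y : E3) {f g : E3 → ℂ} (hf : Sch f) (hg : Sch g) {l : ℝ} (hl : 0 < l) :
    |Bf ε y f g| ≤ 2 * l * (∫ x, ‖g x‖ ^ 2) + 7 * l⁻¹ * gs f := by
  rw [Bf_swap hε y hf hg]
  have h1 := Bf_bd1 hε y hg hf hl
  have hk : (fun x => kap ε (x - y)).HasTemperateGrowth := temp_sub (kap_temp hε) y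
  have hI : Integrable (fun x => kap ε (x - y) ^ 2 * ‖f x‖ ^ 2) :=
    (Sch.mulT (hk.pow 2) hf.norm_sq).integrable
  have h2 : |∫ x, dvb ε (x - y) * ((starRingEnd ℂ) (f x) * g x).im| 
      ≤ 3/2 * (l * (∫ x, ‖g x‖ ^ 2) + l⁻¹ * ∫ x, kap ε (x - y) ^ 2 * ‖f x‖ ^ 2) := by
    have h : ∫ x, 3/2 * (l * ‖g x‖ ^ 2 + l⁻¹ * (kap ε (x - y) ^ 2 * ‖f x‖ ^ 2)) 
        = 3/2 * (l * (∫ x, ‖g x‖ ^ 2) + l⁻¹ * ∫ x, kap ε (x - y) ^ 2 * ‖f x‖ ^ 2) := by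
      rw [integral_const_mul, integral_add (hg.norm_sq.integrable.const_mul _)
        (hI.const_mul _), integral_const_mul, integral_const_mul]
    rw [← h, ← Real.norm_eq_abs]
    refine norm_integral_le_of_norm_le (((hg.norm_sq.integrable.const_mul _).add
      (hI.const_mul _)).const_mul _) (Eventually.of_forall fun x => ?_)
    have h1 : |((starRingEnd ℂ) (f x) * g x).im| ≤ ‖f x‖ * ‖g x‖ := by
      refine (Complex.abs_im_le_norm _).trans (by simp)
    rw [norm_mul, Real.norm_eq_abs, Real.norm_eq_abs, abs_of_nonneg (dvb_nonneg hε _)]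
    have hp := kap_pos hε (x - y)
    set k := kap ε (x - y)
    refine (mul_le_mul (dvb_le hε _) h1 (abs_nonneg _) (by positivity)).trans ?_
    have e : 3/2 * (l * ‖g x‖ ^ 2 + l⁻¹ * (k ^ 2 * ‖f x‖ ^ 2)) - 3 * k * (‖f x‖ * ‖g x‖)
       = 3/2 * l * (‖g x‖ - l⁻¹ * (k * ‖f x‖)) ^ 2 := by
      field_simp; ring
    have : 0 ≤ 3/2 * l * (‖g x‖ - l⁻¹ * (k * ‖f x‖)) ^ 2 := by positivity
    linarith
  have h3 := hardy hε y hf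
  have h4 : l⁻¹ * (∫ x, kap ε (x - y) ^ 2 * ‖f x‖ ^ 2) ≤ l⁻¹ * (4 * gs f) := by gcongr
  have h5 : 0 ≤ l⁻¹ * gs f := mul_nonneg (by positivity) (gs_nonneg f)
  refine (abs_sub _ _).trans ?_
  linarith

theorem Bf_diff {ε : ℝ} (hε : 0 < ε) (y : E3) {f g : E3 → ℂ} (hf : Sch f) (hg : Sch g) {l : ℝ} (hl : 0 < l) :
    |Bf ε y f f - Bf ε y g g| ≤ 5/2 * l * (∫ x, ‖f x - g x‖ ^ 2) + l⁻¹ * (1/2 * gs f + 7 * gs g) := by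
  have hD := hf.sub hg
  have e : Bf ε y f f - Bf ε y g g = Bf ε y (fun x => f x - g x) f + Bf ε y g (fun x => f x - g x) := by
    simp only [Bf]
    rw [← integral_sub (Bf_int hε y hf hf) (Bf_int hε y hg hg),
      ← integral_add (Bf_int hε y hD hf) (Bf_int hε y hg hD)]
    congr 1; ext x
    rw [← Finset.sum_sub_distrib, ← Finset.sum_add_distrib]
    refine Finset.sum_congr rfl fun j _ => ?_
    rw [dd_sub j (hf.da x) (hg.da x)]
    simp; ring
  rw [e]
  have h1 := Bf_bd1 hε y hD hf hl
  have h2 := Bf_bd2 hε y hg hD hl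
  refine (abs_add_le _ _).trans ?_
  linarith
end Bf
end

section

/-! ### The `H^{1/2}` bound of the momentum form -/
/-- low-pass symbol -/
def ms (s : ℝ) (ξ : E3) : ℝ := (1 + (s * ‖ξ‖) ^ 2)⁻¹
theorem ms_temp (s : ℝ) : (fun ξ => ((ms s ξ : ℝ) : ℂ)).HasTemperateGrowth := by
  apply temp_ofReal
  have h1 := Function.hasTemperateGrowth_one_add_norm_sq_rpow E3 (-1:ℝ)
  have h2 := h1.comp (f := fun z : E3 => s • z)
    ((Function.HasTemperateGrowth.const s).smul Function.HasTemperateGrowth.id')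
  refine (funext fun z => ?_ : ms s = _) ▸ h2
  simp only [ms, Function.comp, norm_smul, mul_pow, Real.norm_eq_abs, sq_abs]
  rw [Real.rpow_neg_one]
theorem ms_nonneg (s : ℝ) (ξ : E3) : 0 ≤ ms s ξ := by unfold ms; positivity
theorem ms_le_one (s : ℝ) (ξ : E3) : ms s ξ ≤ 1 := by
  unfold ms; exact inv_le_one_of_one_le₀ (by nlinarith [sq_nonneg (s * ‖ξ‖)])

/-- smoothed function -/
def Us (s : ℝ) (u : SchwartzMap E3 ℂ) : SchwartzMap E3 ℂ := mF (fun ξ => ((ms s ξ : ℝ) : ℂ)) u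

theorem fourier_Us (s : ℝ) (u : SchwartzMap E3 ℂ) (ξ : E3) : 𝓕 (Us s u) ξ = ms s ξ * 𝓕 u ξ :=
  fourier_mF (ms_temp s) u ξ

theorem norm_fourier_Us (s : ℝ) (u : SchwartzMap E3 ℂ) (ξ : E3) : 
    ‖𝓕 (Us s u) ξ‖ ^ 2 = ms s ξ ^ 2 * ‖𝓕 u ξ‖ ^ 2 := by
  rw [fourier_Us, norm_mul, mul_pow, Complex.norm_real, Real.norm_eq_abs, sq_abs]

theorem gs_Us (s : ℝ) (u : SchwartzMap E3 ℂ) :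
    gs (Us s u) = ∫ ξ, (4 * π ^ 2 * ‖ξ‖ ^ 2) * ms s ξ ^ 2 * ‖𝓕 u ξ‖ ^ 2 := by
  rw [plancherel_gs]; simp only [norm_fourier_Us]; congr 1; ext ξ; ring

theorem l2_Us_sub (s t : ℝ) (u : SchwartzMap E3 ℂ) :
    ∫ x, ‖Us s u x - Us t u x‖ ^ 2 = ∫ ξ, (ms s ξ - ms t ξ) ^ 2 * ‖𝓕 u ξ‖ ^ 2 := by
  have := plancherel (Us s u - Us t u)
  simp only [_root_.sub_apply] at this
  rw [this]
  congr 1; ext ξ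
  have e : 𝓕 (Us s u - Us t u) = 𝓕 (Us s u) - 𝓕 (Us t u) := 
    map_sub (FourierTransform.fourierCLM ℂ (SchwartzMap E3 ℂ)) _ _
  rw [e, _root_.sub_apply, fourier_Us, fourier_Us, ← sub_mul, norm_mul,
    mul_pow, ← Complex.ofReal_sub, Complex.norm_real, Real.norm_eq_abs, sq_abs]

theorem Us_zero (u : SchwartzMap E3 ℂ) : Us 0 u = u := by
  unfold Us mF
  simp [ms]

theorem msR_temp (s : ℝ) : (ms s).HasTemperateGrowth := by
  have h1 := Function.hasTemperateGrowth_one_add_norm_sq_rpow E3 (-1:ℝ)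
  have h2 := h1.comp (f := fun z : E3 => s • z)
    ((Function.HasTemperateGrowth.const s).smul Function.HasTemperateGrowth.id')
  refine (funext fun z => ?_ : ms s = _) ▸ h2
  simp only [ms, Function.comp, norm_smul, mul_pow, Real.norm_eq_abs, sq_abs]
  rw [Real.rpow_neg_one]

theorem nrm_temp : (fun ξ : E3 => ‖ξ‖ ^ 2).HasTemperateGrowth := Function.hasTemperateGrowth_norm_sq E3

theorem int_half (u : SchwartzMap E3 ℂ) : Integrable fun ξ => ‖ξ‖ * ‖𝓕 u ξ‖ ^ 2 := by
  have hF : Sch (fun ξ => 𝓕 u ξ) := Sch.coe _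
  have h : Integrable fun ξ => ‖ξ‖ ^ 2 * ‖𝓕 u ξ‖ ^ 2 + ‖𝓕 u ξ‖ ^ 2 :=
    (Sch.mulT nrm_temp hF.norm_sq).integrable.add hF.norm_sq.integrable
  refine h.mono' ((continuous_norm.mul (hF.continuous.norm.pow 2)).aestronglyMeasurable) ?_
  filter_upwards with ξ
  rw [Real.norm_eq_abs, abs_of_nonneg (by positivity)]
  nlinarith [sq_nonneg (‖ξ‖ - 1), sq_nonneg (‖𝓕 u ξ‖), mul_nonneg (sq_nonneg (‖ξ‖ - 1)) (sq_nonneg (‖𝓕 u ξ‖)),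
    mul_nonneg (norm_nonneg ξ) (sq_nonneg (‖𝓕 u ξ‖))]

/-- telescoping function -/
def ft (y : ℝ) : ℝ := y / (1 + y)

theorem dyad_pt {s r : ℝ} (hs : 0 < s) (hr : 0 ≤ r) :
    5/2 * s⁻¹ * (((1 + (s * r) ^ 2)⁻¹ - (1 + (2 * s * r) ^ 2)⁻¹) ^ 2)
      + s * (1/2 * ((4 * π ^ 2 * r ^ 2) * ((1 + (s * r) ^ 2)⁻¹) ^ 2)
          + 7 * ((4 * π ^ 2 * r ^ 2) * ((1 + (2 * s * r) ^ 2)⁻¹) ^ 2))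
      ≤ 1300 * r * (ft (2 * s * r) - ft (s * r)) := by
  obtain ⟨y, hy⟩ : ∃ y, y = s * r := ⟨_, rfl⟩
  have hy0 : 0 ≤ y := by rw [hy]; positivity
  have hrr : r = s⁻¹ * y := by rw [hy]; field_simp
  have e2 : 2 * s * r = 2 * y := by rw [hy]; ring
  rw [e2, ← hy, hrr]
  have hD : ft (2 * y) - ft y = y / ((1 + 2 * y) * (1 + y)) := by
    unfold ft; field_simp; ring
  have hDD : y * (1 + y^2)⁻¹ ≤ 7/2 * (ft (2 * y) - ft y) := by
    rw [hD, mul_div_assoc', ← div_eq_mul_inv, div_le_div_iff₀ (by positivity) (by positivity)]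
    nlinarith [mul_nonneg hy0 (sq_nonneg (y - 1)), mul_nonneg hy0 (mul_nonneg hy0 hy0)]
  have hpi : π ^ 2 ≤ 10 := by nlinarith [Real.pi_lt_d2, Real.pi_pos]
  set p := (1 + y^2)⁻¹ with hp
  have hp0 : 0 < p := by positivity
  have hp1 : p ≤ 1 := inv_le_one_of_one_le₀ (by nlinarith)
  set q := (1 + (2*y)^2)⁻¹ with hq
  have hq0 : 0 < q := by positivity
  have hqp : q ≤ p := by
    rw [hp, hq]; gcongr; linarith
  have hpq : p - q = 3 * y^2 * p * q := by
    rw [hp, hq]; field_simp; ring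
  have hyp : y ^ 2 * p ≤ 1 := by
    rw [hp, ← div_eq_mul_inv, div_le_one (by positivity)]; linarith
  have h1 : (p - q) ^ 2 ≤ 9 * (y ^ 2 * p) := by
    rw [hpq]
    have a1 : q * (y^2*p) ≤ 1 := by
      calc q * (y^2*p) ≤ 1 * 1 := by gcongr; exact hqp.trans hp1
        _ = 1 := by norm_num
    have a2 : 0 ≤ q * (y^2*p) := by positivity
    have a3 : q ≤ 1 := hqp.trans hp1
    calc (3 * y^2 * p * q)^2 = 9 * (y^2*p) * (q * (q * (y^2*p))) := by ring
      _ ≤ 9 * (y^2*p) * (1 * 1) := by gcongr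
      _ = _ := by ring
  have h2 : p ^ 2 ≤ p := by nlinarith
  have h3 : q ^ 2 ≤ p := by nlinarith
  have hs' : 0 < s⁻¹ := by positivity
  calc 5 / 2 * s⁻¹ * (p - q) ^ 2 + s * (1 / 2 * (4 * π ^ 2 * (s⁻¹ * y) ^ 2 * p ^ 2) + 7 * (4 * π ^ 2 * (s⁻¹ * y) ^ 2 * q ^ 2))
      = s⁻¹ * (5/2 * (p-q)^2 + 4 * π^2 * y^2 * (1/2 * p^2 + 7 * q^2)) := by
        field_simp
    _ ≤ s⁻¹ * (5/2 * (9 * (y ^ 2 * p)) + 4 * 10 * y^2 * (1/2 * p + 7 * p)) := by gcongr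
    _ = s⁻¹ * y * (322.5 * (y * p)) := by ring
    _ ≤ s⁻¹ * y * (322.5 * (7/2 * (ft (2 * y) - ft y))) := by gcongr
    _ ≤ 1300 * (s⁻¹ * y) * (ft (2 * y) - ft y) := by
      have : 0 ≤ ft (2*y) - ft y := by rw [hD]; positivity
      have : 0 ≤ (s⁻¹ * y) * (ft (2*y) - ft y) := by positivity
      nlinarith

theorem sobSq_half (u : SchwartzMap E3 ℂ) : sobSq (1/2) u = ∫ ξ, ‖ξ‖ * ‖𝓕 u ξ‖ ^ 2 := by
  unfold sobSq
  congr 1; ext ξ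
  rw [show (2 * (1/2) : ℝ) = 1 by norm_num, Real.rpow_one]
  rfl

theorem Bf_half {ε : ℝ} (hε : 0 < ε) (y : E3) (u : SchwartzMap E3 ℂ) :
    |Bf ε y u u| ≤ 1300 * sobSq (1/2) u := by
  have hF : Sch (fun ξ => 𝓕 u ξ) := Sch.coe _
  set P : ℝ → ℝ := fun s => Bf ε y (Us s u) (Us s u) with hP
  have iA : ∀ s, Integrable fun ξ => (4 * π ^ 2 * ‖ξ‖ ^ 2) * ms s ξ ^ 2 * ‖𝓕 u ξ‖ ^ 2 := fun s =>
    (Sch.mulT (((Function.HasTemperateGrowth.const _).mul nrm_temp).mul ((msR_temp s).pow 2)) hF.norm_sq).integrable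
  have iD : ∀ s t, Integrable fun ξ => (ms s ξ - ms t ξ) ^ 2 * ‖𝓕 u ξ‖ ^ 2 := fun s t =>
    (Sch.mulT (((msR_temp s).sub (msR_temp t)).pow 2) hF.norm_sq).integrable
  have iFt : ∀ s : ℝ, 0 ≤ s → Integrable fun ξ => ft (s * ‖ξ‖) * (‖ξ‖ * ‖𝓕 u ξ‖ ^ 2) := by
    intro s hs
    refine (int_half u).bdd_mul (c := 1) ?_ ?_
    · apply Continuous.aestronglyMeasurable
      unfold ft
      refine Continuous.div (by fun_prop) (by fun_prop) fun ξ => ?_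
      positivity
    · filter_upwards with ξ
      unfold ft
      rw [Real.norm_eq_abs, abs_of_nonneg (by positivity), div_le_one (by positivity)]
      linarith
  -- one dyadic step
  have step : ∀ s : ℝ, 0 < s → |P s - P (2 * s)| ≤
      ∫ ξ, 1300 * (ft (2 * s * ‖ξ‖) * (‖ξ‖ * ‖𝓕 u ξ‖ ^ 2) - ft (s * ‖ξ‖) * (‖ξ‖ * ‖𝓕 u ξ‖ ^ 2)) := by
    intro s hs
    have h := Bf_diff hε y (Sch.coe' (Us s u)) (Sch.coe' (Us (2*s) u)) (l := s⁻¹) (by positivity)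
    refine h.trans ?_
    have i3 : Integrable fun ξ => 1/2 * (4 * π ^ 2 * ‖ξ‖ ^ 2 * ms s ξ ^ 2 * ‖𝓕 u ξ‖ ^ 2)
        + 7 * (4 * π ^ 2 * ‖ξ‖ ^ 2 * ms (2*s) ξ ^ 2 * ‖𝓕 u ξ‖ ^ 2) := ((iA _).const_mul _).add ((iA _).const_mul _)
    rw [l2_Us_sub, gs_Us, gs_Us, inv_inv, ← integral_const_mul, ← integral_const_mul, ← integral_const_mul,
      ← integral_add ((iA _).const_mul _) ((iA _).const_mul _), ← integral_const_mul,
      ← integral_add ((iD _ _).const_mul _) (i3.const_mul _)]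
    refine integral_mono (((iD _ _).const_mul _).add (i3.const_mul _))
      (((iFt _ (by positivity)).sub (iFt _ hs.le)).const_mul _) fun ξ => ?_
    have := mul_le_mul_of_nonneg_right (dyad_pt hs (norm_nonneg ξ)) (sq_nonneg ‖𝓕 u ξ‖)
    simp only [ms]
    linarith
  have tele : ∀ (s : ℝ), 0 < s → ∀ n : ℕ, |P s - P (2 ^ n * s)| ≤
      ∫ ξ, 1300 * (ft (2 ^ n * s * ‖ξ‖) * (‖ξ‖ * ‖𝓕 u ξ‖ ^ 2) - ft (s * ‖ξ‖) * (‖ξ‖ * ‖𝓕 u ξ‖ ^ 2)) := by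
    intro s hs n
    induction n with
    | zero => simp
    | succ n ih =>
      have h2 := step (2 ^ n * s) (by positivity)
      have e : 2 * (2 ^ n * s) = 2 ^ (n+1) * s := by ring
      rw [e] at h2
      have i1 : ∀ m : ℕ, Integrable fun ξ => ft (2 ^ m * s * ‖ξ‖) * (‖ξ‖ * ‖𝓕 u ξ‖ ^ 2) :=
        fun m => iFt _ (by positivity)
      have i0 := iFt s hs.le
      calc |P s - P (2 ^ (n+1) * s)| ≤ |P s - P (2 ^ n * s)| + |P (2 ^ n * s) - P (2 ^ (n+1) * s)| :=
            abs_sub_le _ _ _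
        _ ≤ _ := add_le_add ih h2
        _ = _ := by
          have j1 : Integrable fun ξ => ft (2 ^ n * s * ‖ξ‖) * (‖ξ‖ * ‖𝓕 u ξ‖ ^ 2) - ft (s * ‖ξ‖) * (‖ξ‖ * ‖𝓕 u ξ‖ ^ 2) :=
            (i1 n).sub i0
          have j2 : Integrable fun ξ => ft (2 ^ (n+1) * s * ‖ξ‖) * (‖ξ‖ * ‖𝓕 u ξ‖ ^ 2) - ft (2 ^ n * s * ‖ξ‖) * (‖ξ‖ * ‖𝓕 u ξ‖ ^ 2) :=
            (i1 (n+1)).sub (i1 n)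
          rw [← integral_add (j1.const_mul _) (j2.const_mul _)]
          congr 1; ext ξ; ring
  have bdd : ∀ (s : ℝ), 0 < s → ∀ n : ℕ, |P s - P (2 ^ n * s)| ≤ 1300 * sobSq (1/2) u := by
    intro s hs n
    refine (tele s hs n).trans ?_
    rw [sobSq_half, ← integral_const_mul]
    refine integral_mono (((iFt _ (by positivity)).sub (iFt _ hs.le)).const_mul _) ((int_half u).const_mul _)
      fun ξ => ?_
    have h1 : ft (2 ^ n * s * ‖ξ‖) ≤ 1 := by
      unfold ft; rw [div_le_one (by positivity)]; linarith
    have h0 : 0 ≤ ft (s * ‖ξ‖) := by unfold ft; positivity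
    have h3 : 0 ≤ ‖ξ‖ * ‖𝓕 u ξ‖ ^ 2 := by positivity
    have := mul_le_mul_of_nonneg_right h1 h3
    have := mul_nonneg h0 h3
    show 1300 * (_ - _) ≤ _
    linarith
  set m0 := ∫ ξ, ‖𝓕 u ξ‖ ^ 2 with hm0
  -- high s
  have high : ∀ s : ℝ, 0 < s → |P s| ≤ s⁻¹ * (1/2 * (1 + 4 * π ^ 2) * m0) := by
    intro s hs
    have h := Bf_bd1 hε y (Sch.coe' (Us s u)) (Sch.coe' (Us s u)) (l := s⁻¹) (by positivity)
    refine h.trans ?_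
    have h1 : ∫ x, ‖Us s u x‖ ^ 2 ≤ m0 := by
      rw [plancherel]
      refine integral_mono ((Sch.coe' (𝓕 (Us s u))).norm_sq.integrable) hF.norm_sq.integrable fun ξ => ?_
      simp only [norm_fourier_Us]
      refine mul_le_of_le_one_left (by positivity) ?_
      have := ms_nonneg s ξ
      have := ms_le_one s ξ
      nlinarith
    have h2 : gs (Us s u) ≤ 4 * π ^ 2 * (s⁻¹) ^ 2 * m0 := by
      rw [gs_Us, hm0, ← integral_const_mul]
      refine integral_mono (iA s) (hF.norm_sq.integrable.const_mul _) fun ξ => ?_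
      have : ‖ξ‖ ^ 2 * ms s ξ ^ 2 ≤ (s⁻¹) ^ 2 := by
        rw [← mul_pow]
        refine pow_le_pow_left₀ (mul_nonneg (norm_nonneg _) (ms_nonneg _ _)) ?_ 2
        unfold ms
        rw [← div_eq_mul_inv, div_le_iff₀ (by positivity), inv_mul_eq_div, le_div_iff₀ hs]
        nlinarith [sq_nonneg (s * ‖ξ‖ - 1)]
      simp only
      calc 4 * π ^ 2 * ‖ξ‖ ^ 2 * ms s ξ ^ 2 * ‖𝓕 u ξ‖ ^ 2 
          = 4 * π ^ 2 * (‖ξ‖ ^ 2 * ms s ξ ^ 2) * ‖𝓕 u ξ‖ ^ 2 := by ring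
        _ ≤ _ := by gcongr
    rw [inv_inv]
    calc 1/2 * (s⁻¹ * (∫ x, ‖Us s u x‖ ^ 2) + s * gs (Us s u)) 
        ≤ 1/2 * (s⁻¹ * m0 + s * (4 * π ^ 2 * (s⁻¹) ^ 2 * m0)) := by gcongr
      _ = _ := by field_simp
  set g0 := gs u with hg0
  have low : ∀ s : ℝ, 0 < s → |P 0 - P s| ≤ s * (10 * g0) := by
    intro s hs
    have h := Bf_diff hε y (Sch.coe' (Us 0 u)) (Sch.coe' (Us s u)) (l := s⁻¹) (by positivity)
    refine h.trans ?_
    have h1 : gs (Us s u) ≤ g0 := by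
      rw [gs_Us, hg0, plancherel_gs]
      have := iA 0
      simp only [ms, zero_mul] at this
      norm_num at this
      refine integral_mono (iA s) this fun ξ => ?_
      simp only
      have a := ms_nonneg s ξ
      have b := ms_le_one s ξ
      have : ms s ξ ^ 2 ≤ 1 := by nlinarith
      calc 4 * π ^ 2 * ‖ξ‖ ^ 2 * ms s ξ ^ 2 * ‖𝓕 u ξ‖ ^ 2 ≤ 4 * π ^ 2 * ‖ξ‖ ^ 2 * 1 * ‖𝓕 u ξ‖ ^ 2 := by gcongr
        _ = _ := by ring
    have h2 : ∫ x, ‖Us 0 u x - Us s u x‖ ^ 2 ≤ s ^ 2 * g0 := by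
      rw [l2_Us_sub, hg0, plancherel_gs, ← integral_const_mul]
      have := iA 0
      simp only [ms, zero_mul] at this
      norm_num at this
      refine integral_mono (iD 0 s) (this.const_mul _) fun ξ => ?_
      have e : ms 0 ξ - ms s ξ = (s * ‖ξ‖) ^ 2 * ms s ξ := by
        unfold ms; simp; field_simp; ring
      have h3 : (ms 0 ξ - ms s ξ) ^ 2 ≤ (s * ‖ξ‖) ^ 2 := by
        rw [e]
        have h4 : 0 ≤ (s * ‖ξ‖) ^ 2 * ms s ξ := mul_nonneg (by positivity) (ms_nonneg _ _)
        refine pow_le_pow_left₀ h4 ?_ 2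
        unfold ms
        rw [← div_eq_mul_inv, div_le_iff₀ (by positivity)]
        have : 0 ≤ s * ‖ξ‖ := by positivity
        nlinarith [sq_nonneg (s * ‖ξ‖ - 1), mul_nonneg this (sq_nonneg (s * ‖ξ‖ - 1))]
      have h5 : (1:ℝ) ≤ 4 * π ^ 2 := by nlinarith [Real.pi_gt_three]
      calc (ms 0 ξ - ms s ξ) ^ 2 * ‖𝓕 u ξ‖ ^ 2 ≤ (s * ‖ξ‖) ^ 2 * ‖𝓕 u ξ‖ ^ 2 := by gcongr
        _ = s ^ 2 * (1 * ‖ξ‖ ^ 2 * ‖𝓕 u ξ‖ ^ 2) := by ring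
        _ ≤ _ := by gcongr
    rw [inv_inv, Us_zero]
    rw [Us_zero] at h2
    calc 5 / 2 * s⁻¹ * (∫ x, ‖u x - Us s u x‖ ^ 2) + s * (1 / 2 * gs u + 7 * gs (Us s u))
        ≤ 5 / 2 * s⁻¹ * (s ^ 2 * g0) + s * (1 / 2 * g0 + 7 * g0) := by gcongr
      _ = _ := by field_simp; ring
  have P0 : P 0 = Bf ε y u u := by simp only [hP, Us_zero]
  rw [← P0]
  have main : ∀ s : ℝ, 0 < s → |P 0| ≤ 1300 * sobSq (1/2) u + s * (10 * g0) := by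
    intro s hs
    have hlim : Tendsto (fun n : ℕ => 1300 * sobSq (1/2) u + s * (10 * g0) 
        + (1/2:ℝ) ^ n * (s⁻¹ * (1/2 * (1 + 4 * π ^ 2) * m0))) atTop 
        (nhds (1300 * sobSq (1/2) u + s * (10 * g0) + 0 * (s⁻¹ * (1/2 * (1 + 4 * π ^ 2) * m0)))) :=
      ((tendsto_pow_atTop_nhds_zero_of_lt_one (by norm_num) (by norm_num)).mul_const _).const_add _
    rw [zero_mul, add_zero] at hlim
    refine ge_of_tendsto' hlim fun n => ?_
    have a := low s hs
    have b := bdd s hs n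
    have c := high (2 ^ n * s) (by positivity)
    have e : (2 ^ n * s)⁻¹ = (1/2:ℝ) ^ n * s⁻¹ := by rw [mul_inv, one_div, inv_pow]
    rw [e, mul_assoc] at c
    have : |P 0| ≤ |P 0 - P s| + |P s - P (2 ^ n * s)| + |P (2 ^ n * s)| := by
      calc |P 0| = |(P 0 - P s) + (P s - P (2 ^ n * s)) + P (2 ^ n * s)| := by congr 1; ring
        _ ≤ _ := abs_add_three _ _ _
    linarith
  have hlim : Tendsto (fun s : ℝ => 1300 * sobSq (1/2) u + s * (10 * g0)) (nhdsWithin 0 (Set.Ioi 0)) 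
      (nhds (1300 * sobSq (1/2) u + 0 * (10 * g0))) :=
    ((tendsto_id.mono_left nhdsWithin_le_nhds).mul_const _).const_add _
  rw [zero_mul, add_zero] at hlim
  exact ge_of_tendsto hlim (eventually_nhdsWithin_of_forall fun s hs => main s hs)
end

section

/-! ### The free Schrödinger flow -/
theorem iteratedDeriv_cis (n : ℕ) : 
    iteratedDeriv n (fun r : ℝ => cexp (r * I)) = fun r : ℝ => I ^ n * cexp (r * I) := by
  induction n with
  | zero => simp
  | succ n ih =>
    rw [iteratedDeriv_succ, ih]
    ext r
    have h : HasDerivAt (fun r : ℝ => cexp (r * I)) (cexp (r * I) * (1 * I)) r := by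
      have h1 : HasDerivAt (fun r : ℝ => (r : ℂ) * I) (1 * I) r :=
        (Complex.ofRealCLM.hasDerivAt).mul_const I
      exact h1.cexp
    rw [(h.const_mul (I ^ n)).deriv]
    ring

theorem cis_contDiff : ContDiff ℝ ∞ (fun r : ℝ => cexp (r * I)) := by
  have : ContDiff ℝ ∞ (fun r : ℝ => (r : ℂ)) := Complex.ofRealCLM.contDiff
  exact (this.mul contDiff_const).cexp

theorem cis_temp : (fun r : ℝ => cexp (r * I)).HasTemperateGrowth := by
  refine ⟨cis_contDiff, fun n => ⟨0, 1, fun x => ?_⟩⟩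
  rw [norm_iteratedFDeriv_eq_norm_iteratedDeriv, iteratedDeriv_cis]
  simp [Complex.norm_exp]

/-- phase of the free flow -/
def ph (τ : ℝ) (ξ : E3) : ℂ := cexp (((-(4 * π ^ 2 * τ * ‖ξ‖ ^ 2) : ℝ) : ℂ) * I)

theorem ph_temp (τ : ℝ) : (ph τ).HasTemperateGrowth := by
  have h1 : (fun ξ : E3 => -(4 * π ^ 2 * τ * ‖ξ‖ ^ 2)).HasTemperateGrowth :=
    ((Function.HasTemperateGrowth.const (4 * π ^ 2 * τ)).mul nrm_temp).neg
  exact cis_temp.comp h1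

theorem ph_norm (τ : ℝ) (ξ : E3) : ‖ph τ ξ‖ = 1 := Complex.norm_exp_ofReal_mul_I _
theorem ph_zero (ξ : E3) : ph 0 ξ = 1 := by simp [ph]
theorem ph_add (σ τ : ℝ) (ξ : E3) : ph (σ + τ) ξ = ph σ ξ * ph τ ξ := by
  unfold ph; rw [← Complex.exp_add]; congr 1; push_cast; ring
theorem ph_deriv (τ : ℝ) (ξ : E3) : 
    HasDerivAt (fun s => ph s ξ) (-(4 * π ^ 2 * ‖ξ‖ ^ 2 : ℝ) * I * ph τ ξ) τ := by
  have h1 : HasDerivAt (fun s : ℝ => (-(4 * π ^ 2 * s * ‖ξ‖ ^ 2))) (-(4 * π ^ 2 * 1 * ‖ξ‖ ^ 2)) τ :=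
    (((hasDerivAt_id τ).const_mul (4 * π ^ 2)).mul_const _).neg
  have h2 := (h1.ofReal_comp.mul_const I).cexp
  refine h2.congr_deriv ?_
  unfold ph; push_cast; ring
theorem ph_conj (τ : ℝ) (ξ : E3) : (starRingEnd ℂ) (ph τ ξ) = ph (-τ) ξ := by
  unfold ph; rw [← Complex.exp_conj]; congr 1
  rw [map_mul, Complex.conj_ofReal, Complex.conj_I]; push_cast; ring

/-- free flow -/
def Sf (τ : ℝ) (h : SchwartzMap E3 ℂ) : SchwartzMap E3 ℂ := mF (ph τ) h

theorem fourier_Sf (τ : ℝ) (h : SchwartzMap E3 ℂ) (ξ : E3) : 𝓕 (Sf τ h) ξ = ph τ ξ * 𝓕 h ξ :=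
  fourier_mF (ph_temp τ) h ξ

theorem inv_formula (f : SchwartzMap E3 ℂ) (x : E3) : 
    f x = ∫ ξ, cexp ((2 * π * inner ℝ ξ x : ℝ) * I) * 𝓕 f ξ := by
  have h : 𝓕⁻ (𝓕 f) = f := FourierTransform.fourierInv_fourier_eq f
  conv_lhs => rw [← h, SchwartzMap.fourierInv_coe, Real.fourierInv_eq']
  simp only [smul_eq_mul]

theorem fourier_inj {f g : SchwartzMap E3 ℂ} (h : ∀ ξ, 𝓕 f ξ = 𝓕 g ξ) : f = g := by
  ext x; rw [inv_formula f, inv_formula g]; simp only [h]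

theorem Sf_zero (h : SchwartzMap E3 ℂ) : Sf 0 h = h := by
  refine fourier_inj fun ξ => ?_
  rw [fourier_Sf, ph_zero, one_mul]
theorem Sf_add (σ τ : ℝ) (h : SchwartzMap E3 ℂ) : Sf (σ + τ) h = Sf σ (Sf τ h) := by
  refine fourier_inj fun ξ => ?_
  rw [fourier_Sf, fourier_Sf, fourier_Sf, ph_add, mul_assoc]

theorem Sf_l2 (τ : ℝ) (h : SchwartzMap E3 ℂ) : ∫ x, ‖Sf τ h x‖ ^ 2 = ∫ x, ‖h x‖ ^ 2 := by
  rw [plancherel (Sf τ h), plancherel h]; congr 1; ext ξ; rw [fourier_Sf, norm_mul, ph_norm, one_mul]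
theorem Sf_gs (τ : ℝ) (h : SchwartzMap E3 ℂ) : gs (Sf τ h) = gs h := by
  rw [plancherel_gs, plancherel_gs]; congr 1; ext ξ; rw [fourier_Sf, norm_mul, ph_norm, one_mul]

theorem parseval (f g : SchwartzMap E3 ℂ) : 
    ∫ x, (starRingEnd ℂ) (g x) * f x = ∫ ξ, (starRingEnd ℂ) (𝓕 g ξ) * 𝓕 f ξ := by
  have := SchwartzMap.integral_inner_fourier_fourier g f
  simp only [RCLike.inner_apply] at this
  simp only [mul_comm ((starRingEnd ℂ) _)]
  exact this.symm

theorem Sf_adj (τ : ℝ) (f g : SchwartzMap E3 ℂ) :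
    ∫ x, (starRingEnd ℂ) (g x) * Sf τ f x = ∫ x, (starRingEnd ℂ) (Sf (-τ) g x) * f x := by
  rw [parseval (Sf τ f) g, parseval f (Sf (-τ) g)]; congr 1; ext ξ
  rw [fourier_Sf, fourier_Sf, map_mul, ph_conj, neg_neg]; ring

/-- the Laplacian as a Schwartz function -/
def lapS (f : SchwartzMap E3 ℂ) : SchwartzMap E3 ℂ := 
  ∑ j : Fin 3, (LineDeriv.lineDerivOp (e3 j) (LineDeriv.lineDerivOp (e3 j) f : SchwartzMap E3 ℂ) : SchwartzMap E3 ℂ)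

theorem lapS_apply (f : SchwartzMap E3 ℂ) (x : E3) : lapS f x = lap f x := by
  unfold lapS lap
  rw [_root_.sum_apply]
  refine Finset.sum_congr rfl fun j _ => ?_
  rw [SchwartzMap.lineDerivOp_apply_eq_fderiv]
  have e : (fun y => pd f j y) = (LineDeriv.lineDerivOp (e3 j) f : SchwartzMap E3 ℂ) := by
    ext y; rw [SchwartzMap.lineDerivOp_apply_eq_fderiv]; rfl
  rw [e]

theorem fourier_ld (j : Fin 3) (f : SchwartzMap E3 ℂ) (ξ : E3) : 
    𝓕 (LineDeriv.lineDerivOp (e3 j) f : SchwartzMap E3 ℂ) ξ = (2 * π * I) * ((ξ j : ℝ) : ℂ) * 𝓕 f ξ := by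
  rw [SchwartzMap.fourier_lineDerivOp_eq]
  have : (fun x : E3 => inner ℝ x (e3 j)).HasTemperateGrowth := by fun_prop
  rw [_root_.smul_apply, SchwartzMap.smulLeftCLM_apply_apply this]
  simp [e3, EuclideanSpace.inner_single_right]
  ring

theorem fourier_lapS (f : SchwartzMap E3 ℂ) (ξ : E3) : 
    𝓕 (lapS f) ξ = -((4 * π ^ 2 * ‖ξ‖ ^ 2 : ℝ) : ℂ) * 𝓕 f ξ := by
  have e : 𝓕 (lapS f) = ∑ j : Fin 3, 𝓕 (LineDeriv.lineDerivOp (e3 j) (LineDeriv.lineDerivOp (e3 j) f : SchwartzMap E3 ℂ) : SchwartzMap E3 ℂ) := 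
    map_sum (FourierTransform.fourierCLM ℂ (SchwartzMap E3 ℂ)) _ _
  rw [e, _root_.sum_apply]
  simp only [fourier_ld, Fin.sum_univ_three, nsq3]
  push_cast
  ring_nf
  simp only [I_sq]; ring

theorem fourier_integrable (f : SchwartzMap E3 ℂ) : Integrable fun ξ => 𝓕 f ξ := (Sch.coe (𝓕 f)).integrable

theorem sup_le_fourier (f : SchwartzMap E3 ℂ) (x : E3) : ‖f x‖ ≤ ∫ ξ, ‖𝓕 f ξ‖ := by
  rw [inv_formula f x]
  refine (norm_integral_le_integral_norm _).trans (le_of_eq ?_)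
  congr 1; ext ξ; rw [norm_mul, Complex.norm_exp_ofReal_mul_I, one_mul]

theorem Sf_sup (τ : ℝ) (h : SchwartzMap E3 ℂ) (x : E3) : ‖Sf τ h x‖ ≤ ∫ ξ, ‖𝓕 h ξ‖ := by
  refine (sup_le_fourier _ x).trans (le_of_eq ?_)
  congr 1; ext ξ; rw [fourier_Sf, norm_mul, ph_norm, one_mul]

theorem Sf_lap_sup (τ : ℝ) (h : SchwartzMap E3 ℂ) (x : E3) : ‖lap (Sf τ h) x‖ ≤ ∫ ξ, ‖𝓕 (lapS h) ξ‖ := by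
  rw [← lapS_apply]
  refine (sup_le_fourier _ x).trans (le_of_eq ?_)
  congr 1; ext ξ; rw [fourier_lapS, fourier_lapS, fourier_Sf, norm_mul, norm_mul, norm_mul, ph_norm, one_mul]

theorem Sf_deriv (τ : ℝ) (h : SchwartzMap E3 ℂ) (x : E3) : 
    HasDerivAt (fun s => Sf s h x) (I * lap (Sf τ h) x) τ := by
  have e : (fun s => Sf s h x) = fun s => ∫ ξ, (cexp ((2 * π * inner ℝ ξ x : ℝ) * I) * 𝓕 h ξ) * ph s ξ := by
    ext s; rw [inv_formula]; congr 1; ext ξ; rw [fourier_Sf]; ring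
  have e2 : I * lap (Sf τ h) x = ∫ ξ, (cexp ((2 * π * inner ℝ ξ x : ℝ) * I) * 𝓕 h ξ) * (-(4 * π ^ 2 * ‖ξ‖ ^ 2 : ℝ) * I * ph τ ξ) := by
    rw [← lapS_apply, inv_formula, ← integral_const_mul]; congr 1; ext ξ; rw [fourier_lapS, fourier_Sf]; ring
  rw [e, e2]
  have hc : ∀ s, Continuous (ph s) := fun s => (ph_temp s).1.continuous
  have hF : Continuous (fun ξ => 𝓕 h ξ) := (Sch.coe (𝓕 h)).continuous
  have hin : Continuous fun ξ : E3 => cexp ((2 * π * inner ℝ ξ x : ℝ) * I) := by fun_prop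
  refine (hasDerivAt_integral_of_dominated_loc_of_deriv_le (μ := (volume : Measure E3)) (F := fun (s : ℝ) ξ => (cexp ((2 * π * inner ℝ ξ x : ℝ) * I) * 𝓕 h ξ) * ph s ξ)
    (F' := fun (s : ℝ) ξ => (cexp ((2 * π * inner ℝ ξ x : ℝ) * I) * 𝓕 h ξ) * (-(4 * π ^ 2 * ‖ξ‖ ^ 2 : ℝ) * I * ph s ξ)) (s := Set.univ) (bound := fun ξ => ‖𝓕 (lapS h) ξ‖) 
    univ_mem (Eventually.of_forall fun s => ?_) ?_ ?_ ?_ ?_ ?_).2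
  · exact ((hin.mul hF).mul (hc s)).aestronglyMeasurable
  · refine (fourier_integrable h).norm.mono' ((hin.mul hF).mul (hc τ)).aestronglyMeasurable ?_
    filter_upwards with ξ
    rw [norm_mul, norm_mul, Complex.norm_exp_ofReal_mul_I, ph_norm, one_mul, mul_one]
  · refine Continuous.aestronglyMeasurable ?_
    have := hc τ
    fun_prop
  · filter_upwards with ξ s _
    rw [fourier_lapS, norm_mul, norm_mul, Complex.norm_exp_ofReal_mul_I, norm_mul, norm_mul, ph_norm, norm_mul, norm_I]
    rw [one_mul, mul_one, mul_one, mul_comm]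
  · exact (fourier_integrable _).norm
  · filter_upwards with ξ s _
    exact (ph_deriv s ξ).const_mul _

end

section

/-! ### Hausdorff–Young `4/3 → 4` -/
theorem csE {α : Type*} [MeasurableSpace α] {μ : Measure α} {f g : α → ℝ≥0∞} (hf : AEMeasurable f μ)
    (hg : AEMeasurable g μ) : (∫⁻ x, f x * g x ∂μ) ^ 2 ≤ (∫⁻ x, f x ^ 2 ∂μ) * ∫⁻ x, g x ^ 2 ∂μ := by
  have h := ENNReal.lintegral_mul_le_Lp_mul_Lq μ (p := 2) (q := 2) ⟨by norm_num, by norm_num, by norm_num⟩ hf hg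
  have h2 := pow_le_pow_left₀ zero_le h 2
  refine h2.trans (le_of_eq ?_)
  have e : ∀ a : ℝ≥0∞, (a ^ (1/2:ℝ)) ^ 2 = a := fun a => by
    rw [← ENNReal.rpow_natCast, ← ENNReal.rpow_mul]; norm_num
  rw [mul_pow, e, e]
  simp only [ENNReal.rpow_ofNat]

theorem youngE {G : E3 → ℝ≥0∞} (hG : Measurable G) :
    ∫⁻ x, (∫⁻ y, G y * G (x - y)) ^ 2 ≤ (∫⁻ x, G x ^ (4/3:ℝ)) ^ 3 := by
  set q := ∫⁻ x, G x ^ (4/3:ℝ) with hq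
  have hs : ∀ x, Measurable fun y => G (x - y) := fun x => hG.comp (measurable_const.sub measurable_id)
  have h1 : ∀ x, (∫⁻ y, G y * G (x - y)) ^ 2 ≤ (∫⁻ y, G y ^ (4/3:ℝ) * G (x - y) ^ (4/3:ℝ)) * q := by
    intro x
    have e : ∀ y, G y * G (x - y) = (G y ^ (2/3:ℝ) * G (x-y) ^ (2/3:ℝ)) * (G y ^ (1/3:ℝ) * G (x-y) ^ (1/3:ℝ)) := by
      intro y
      rw [mul_mul_mul_comm, ← ENNReal.rpow_add_of_nonneg _ _ (by norm_num) (by norm_num),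
        ← ENNReal.rpow_add_of_nonneg _ _ (by norm_num) (by norm_num)]
      norm_num
    have p2 : ∀ (a : ℝ≥0∞) (r : ℝ), (a ^ r) ^ 2 = a ^ (r * 2) := fun a r => by
      rw [← ENNReal.rpow_natCast, ← ENNReal.rpow_mul]; norm_num
    simp only [e]
    refine (csE ?_ ?_).trans ?_
    · exact ((hG.pow_const _).mul ((hs x).pow_const _)).aemeasurable
    · exact ((hG.pow_const _).mul ((hs x).pow_const _)).aemeasurable
    · simp only [mul_pow, p2]
      norm_num
      refine mul_le_mul' le_rfl ?_
      have h3 := csE (μ := volume) (f := fun y => G y ^ (2/3:ℝ)) (g := fun y => G (x-y) ^ (2/3:ℝ)) 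
        (hG.pow_const _).aemeasurable ((hs x).pow_const _).aemeasurable
      simp only [p2] at h3
      norm_num at h3
      rw [lintegral_sub_left_eq_self (fun y => G y ^ (4/3:ℝ)) x, ← hq, ← sq] at h3
      exact (ENNReal.pow_le_pow_left_iff two_ne_zero).1 h3
  calc ∫⁻ x, (∫⁻ y, G y * G (x - y)) ^ 2 ≤ ∫⁻ x, (∫⁻ y, G y ^ (4/3:ℝ) * G (x - y) ^ (4/3:ℝ)) * q := lintegral_mono h1
    _ ≤ (∫⁻ x, (∫⁻ y, G y ^ (4/3:ℝ) * G (x - y) ^ (4/3:ℝ))) * q := by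
      rw [lintegral_mul_const]
      have : Measurable (fun p : E3 × E3 => G p.2 ^ (4/3:ℝ) * G (p.1 - p.2) ^ (4/3:ℝ)) :=
        ((hG.comp measurable_snd).pow_const _).mul ((hG.comp (measurable_fst.sub measurable_snd)).pow_const _)
      exact this.lintegral_prod_right'
    _ = q * q * q := by
      congr 1
      rw [lintegral_lintegral_swap]
      · have : ∀ y, ∫⁻ x, G y ^ (4/3:ℝ) * G (x - y) ^ (4/3:ℝ) = G y ^ (4/3:ℝ) * q := by
          intro y
          rw [lintegral_const_mul _ (show Measurable fun x => G (x - y) ^ (4/3:ℝ) from (hG.comp (measurable_id.sub measurable_const)).pow_const _)]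
          congr 1
          exact lintegral_sub_right_eq_self (fun y => G y ^ (4/3:ℝ)) y
        simp only [this]
        rw [lintegral_mul_const _ (hG.pow_const _)]
      · have : Measurable (fun p : E3 × E3 => G p.2 ^ (4/3:ℝ) * G (p.1 - p.2) ^ (4/3:ℝ)) :=
          ((hG.comp measurable_snd).pow_const _).mul ((hG.comp (measurable_fst.sub measurable_snd)).pow_const _)
        exact this.aemeasurable
    _ = q ^ 3 := by ring

theorem int43 (g : SchwartzMap E3 ℂ) : Integrable fun x => ‖g x‖ ^ (4/3:ℝ) := by
  have h := (g.memLp (ENNReal.ofReal (4/3)) volume).integrable_norm_rpow (by simp) (by simp)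
  rw [ENNReal.toReal_ofReal (by norm_num)] at h
  exact h

theorem hausdorffYoung (g : SchwartzMap E3 ℂ) :
    ∫ ξ, ‖𝓕 g ξ‖ ^ 4 ≤ (∫ x, ‖g x‖ ^ (4/3:ℝ)) ^ 3 := by
  set B : ℂ →L[ℂ] ℂ →L[ℂ] ℂ := ContinuousLinearMap.mul ℂ ℂ
  set c := SchwartzMap.convolution B g g with hc
  have h1 : ∀ ξ, ‖𝓕 c ξ‖ ^ 2 = ‖𝓕 g ξ‖ ^ 4 := by
    intro ξ
    rw [hc, SchwartzMap.fourier_convolution, SchwartzMap.pairing_apply_apply]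
    simp only [B, ContinuousLinearMap.mul_apply', norm_mul]
    ring
  have h2 : ∀ x, ‖c x‖ₑ ≤ ∫⁻ y, ‖g y‖ₑ * ‖g (x - y)‖ₑ := by
    intro x
    rw [hc, SchwartzMap.convolution_apply, MeasureTheory.convolution_def]
    refine (enorm_integral_le_lintegral_enorm _).trans (le_of_eq ?_)
    simp only [B, ContinuousLinearMap.mul_apply', enorm_mul]
  have hm : Measurable fun x => ‖g x‖ₑ := g.continuous.measurable.enorm
  have h3 : ∫⁻ x, ‖c x‖ₑ ^ 2 ≤ (∫⁻ x, ‖g x‖ₑ ^ (4/3:ℝ)) ^ 3 :=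
    (lintegral_mono fun x => pow_le_pow_left₀ zero_le (h2 x) 2).trans (youngE hm)
  have e1 : ENNReal.ofReal (∫ ξ, ‖𝓕 g ξ‖ ^ 4) = ∫⁻ x, ‖c x‖ₑ ^ 2 := by
    simp only [← h1]
    rw [← plancherel, ofReal_integral_eq_lintegral_ofReal (Sch.coe' c).norm_sq.integrable (Eventually.of_forall fun x => by positivity)]
    congr 1; ext x; rw [ENNReal.ofReal_pow (norm_nonneg _), ofReal_norm]
  have e2 : ENNReal.ofReal (∫ x, ‖g x‖ ^ (4/3:ℝ)) = ∫⁻ x, ‖g x‖ₑ ^ (4/3:ℝ) := by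
    rw [ofReal_integral_eq_lintegral_ofReal (int43 g) (Eventually.of_forall fun x => by positivity)]
    congr 1; ext x; rw [← ENNReal.ofReal_rpow_of_nonneg (norm_nonneg _) (by norm_num), ofReal_norm]
  rw [← e1, ← e2, ← ENNReal.ofReal_pow (integral_nonneg fun x => by positivity)] at h3
  exact (ENNReal.ofReal_le_ofReal_iff (by positivity)).1 h3

/-! ### Dispersive estimate -/
theorem gauss_int {b : ℂ} (hb : 0 < b.re) : Integrable (fun ξ : E3 => cexp (-b * ‖ξ‖ ^ 2)) := by
  have := GaussianFourier.integrable_cexp_neg_mul_sq_norm_add (V := E3) hb 0 0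
  simpa using this

theorem Sf_reg (b : ℂ) (hb : 0 < b.re) (h : SchwartzMap E3 ℂ) (x : E3) :
    ∫ ξ, cexp ((2 * π * inner ℝ ξ x : ℝ) * I) * (cexp (-b * ‖ξ‖ ^ 2) * 𝓕 h ξ) =
      (π / b) ^ (3 / 2 : ℂ) * ∫ y, cexp (-π ^ 2 * ‖x - y‖ ^ 2 / b) * h y := by
  have hi : Integrable (fun v : E3 ↦ cexp (-b * ‖v‖ ^ 2 + 2 * π * Complex.I * inner ℝ x v)) := by
    have := GaussianFourier.integrable_cexp_neg_mul_sq_norm_add (V := E3) hb (2 * π * Complex.I) x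
    simpa using this
  have := VectorFourier.integral_bilin_fourierIntegral_eq_flip (ContinuousLinearMap.mul ℂ ℂ) (L := innerₗ E3) (μ := volume) (ν := volume)
    continuous_fourierChar continuous_inner h.integrable hi
  simp only [ContinuousLinearMap.mul_apply'] at this
  have e1 : ∀ ξ, VectorFourier.fourierIntegral 𝐞 volume (innerₗ E3) h ξ = 𝓕 h ξ := fun ξ => rfl
  have e2 : ∀ w, VectorFourier.fourierIntegral 𝐞 volume (innerₗ E3).flip (fun v : E3 ↦ cexp (-b * ‖v‖ ^ 2 + 2 * π * Complex.I * inner ℝ x v)) w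
      = (π / b) ^ (3 / 2 : ℂ) * cexp (-π ^ 2 * ‖x - w‖ ^ 2 / b) := fun w => by
    have := fourier_gaussian_innerProductSpace' hb x w
    rw [flip_innerₗ]
    refine Eq.trans ?_ (this.trans ?_)
    · rfl
    · congr 2; simp
  simp only [e1, e2] at this
  calc _ = ∫ ξ, 𝓕 h ξ * cexp (-b * ‖ξ‖ ^ 2 + 2 * π * I * inner ℝ x ξ) := by
        congr 1; ext ξ; rw [Complex.exp_add, real_inner_comm]; push_cast
        rw [show 2 * (π:ℂ) * (inner ℝ x ξ : ℝ) * I = 2 * π * I * (inner ℝ x ξ : ℝ) by ring]; ring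
    _ = _ := by
        rw [this, ← integral_const_mul]; congr 1; ext y; ring

theorem Sf_kernel {τ : ℝ} (hτ : τ ≠ 0) (h : SchwartzMap E3 ℂ) (x : E3) :
    Sf τ h x = (π / (((4 * π ^ 2 * τ : ℝ) : ℂ) * I)) ^ (3 / 2 : ℂ) *
      ∫ y, cexp ((‖x - y‖ ^ 2 / (4 * τ) : ℝ) * I) * h y := by
  set b0 : ℂ := ((4 * π ^ 2 * τ : ℝ) : ℂ) * I with hb0
  set b : ℕ → ℂ := fun n => ((1 / ((n:ℝ) + 1) : ℝ) : ℂ) + b0 with hb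
  have hbre : ∀ n, (b n).re = 1 / ((n:ℝ) + 1) := fun n => by
    simp only [hb, hb0, Complex.add_re, Complex.re_ofReal_mul, Complex.I_re, Complex.ofReal_re]; ring
  have hbpos : ∀ n, 0 < (b n).re := fun n => by rw [hbre]; positivity
  have hlim : Tendsto b atTop (nhds b0) := by
    have h1 : Tendsto (fun n : ℕ => ((1 / ((n:ℝ) + 1) : ℝ) : ℂ)) atTop (nhds ((0:ℝ):ℂ)) :=
      (Complex.continuous_ofReal.tendsto _).comp tendsto_one_div_add_atTop_nhds_zero_nat
    have h2 := h1.add_const b0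
    rw [Complex.ofReal_zero, zero_add] at h2
    exact h2
  have hbne : b0 ≠ 0 := by
    rw [hb0]; simp [hτ, Real.pi_ne_zero]
  have hF : Continuous (fun ξ => 𝓕 h ξ) := (Sch.coe (𝓕 h)).continuous
  have hin : Continuous fun ξ : E3 => cexp ((2 * π * inner ℝ ξ x : ℝ) * I) := by fun_prop
  have l1 : Tendsto (fun n => ∫ ξ, cexp ((2 * π * inner ℝ ξ x : ℝ) * I) * (cexp (-(b n) * ‖ξ‖ ^ 2) * 𝓕 h ξ)) atTop
      (nhds (∫ ξ, cexp ((2 * π * inner ℝ ξ x : ℝ) * I) * (cexp (-b0 * ‖ξ‖ ^ 2) * 𝓕 h ξ))) := by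
    refine tendsto_integral_of_dominated_convergence (fun ξ => ‖𝓕 h ξ‖) (fun n => ?_) (fourier_integrable h).norm (fun n => ?_) ?_
    · refine Continuous.aestronglyMeasurable ?_
      fun_prop
    · filter_upwards with ξ
      rw [norm_mul, Complex.norm_exp_ofReal_mul_I, one_mul, norm_mul]
      refine mul_le_of_le_one_left (norm_nonneg _) ?_
      rw [Complex.norm_exp, Real.exp_le_one_iff]
      have : (-b n * (‖ξ‖:ℂ) ^ 2).re = -((b n).re * ‖ξ‖ ^ 2) := by
        rw [← Complex.ofReal_pow, Complex.re_mul_ofReal, Complex.neg_re, neg_mul]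
      rw [this]
      have := mul_nonneg (hbpos n).le (sq_nonneg ‖ξ‖)
      linarith
    · filter_upwards with ξ
      refine Tendsto.const_mul _ (Tendsto.mul_const _ ?_)
      exact (Complex.continuous_exp.tendsto _).comp (hlim.neg.mul_const _)
  have l2 : Tendsto (fun n => ∫ y, cexp (-π ^ 2 * ‖x - y‖ ^ 2 / b n) * h y) atTop
      (nhds (∫ y, cexp (-π ^ 2 * ‖x - y‖ ^ 2 / b0) * h y)) := by
    refine tendsto_integral_of_dominated_convergence (fun ξ => ‖h ξ‖) (fun n => ?_) h.integrable.norm (fun n => ?_) ?_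
    · refine Continuous.aestronglyMeasurable ?_
      have := h.continuous
      fun_prop
    · filter_upwards with y
      rw [norm_mul]
      refine mul_le_of_le_one_left (norm_nonneg _) ?_
      rw [Complex.norm_exp, Real.exp_le_one_iff]
      have : (-(π:ℂ) ^ 2 * (‖x - y‖:ℂ) ^ 2 / b n).re = -(π ^ 2 * ‖x - y‖ ^ 2 * ((b n)⁻¹).re) := by
        rw [div_eq_mul_inv, show -(π:ℂ) ^ 2 * (‖x - y‖:ℂ) ^ 2 = ((-(π ^ 2 * ‖x - y‖ ^ 2) : ℝ) : ℂ) by push_cast; ring, Complex.re_ofReal_mul]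
        ring
      rw [this, Complex.inv_re]
      have := mul_nonneg (by positivity : 0 ≤ π ^ 2 * ‖x - y‖ ^ 2) (div_nonneg (hbpos n).le (Complex.normSq_nonneg (b n)))
      linarith
    · filter_upwards with ξ
      refine Tendsto.mul_const _ ?_
      exact (Complex.continuous_exp.tendsto _).comp (tendsto_const_nhds.div hlim hbne)
  have l3 : Tendsto (fun n => ((π:ℂ) / b n) ^ (3 / 2 : ℂ)) atTop (nhds ((π / b0) ^ (3/2:ℂ))) := by
    refine Tendsto.cpow (tendsto_const_nhds.div hlim hbne) tendsto_const_nhds ?_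
    right
    have : ((π:ℂ) / b0) = ((-(π / (4 * π ^ 2 * τ)) : ℝ) : ℂ) * I := by
      rw [hb0]; push_cast
      have : (τ:ℂ) ≠ 0 := by exact_mod_cast hτ
      have : (π:ℂ) ≠ 0 := by exact_mod_cast Real.pi_ne_zero
      field_simp
      rw [I_sq, neg_neg]
    rw [this, Complex.im_ofReal_mul, I_im, mul_one]
    have := Real.pi_pos
    simp only [ne_eq, neg_eq_zero, div_eq_zero_iff]
    push Not
    exact ⟨this.ne', by positivity⟩
  have := tendsto_nhds_unique l1 ((l3.mul l2).congr fun n => (Sf_reg (b n) (hbpos n) h x).symm)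
  have e0 : Sf τ h x = ∫ ξ, cexp ((2 * π * inner ℝ ξ x : ℝ) * I) * (cexp (-b0 * ‖ξ‖ ^ 2) * 𝓕 h ξ) := by
    rw [inv_formula]; congr 1; ext ξ; rw [fourier_Sf]; congr 2
    unfold ph; congr 1; rw [hb0]; push_cast; ring
  rw [e0, this]
  congr 2; ext y; congr 2
  rw [hb0]; push_cast
  have : (τ:ℂ) ≠ 0 := by exact_mod_cast hτ
  have : (π:ℂ) ≠ 0 := by exact_mod_cast Real.pi_ne_zero
  field_simp
  rw [I_sq]; ring

theorem chirp_temp (a : ℝ) : (fun y : E3 => cexp ((‖y‖ ^ 2 / a : ℝ) * I)).HasTemperateGrowth := by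
  have h1 : (fun ξ : E3 => ‖ξ‖ ^ 2 / a).HasTemperateGrowth := by
    simp only [div_eq_mul_inv]
    exact nrm_temp.mul (Function.HasTemperateGrowth.const _)
  exact cis_temp.comp h1

theorem dispersive {τ : ℝ} (hτ : τ ≠ 0) (h : SchwartzMap E3 ℂ) :
    ∫ x, ‖Sf τ h x‖ ^ 4 ≤ (|τ| ^ 3)⁻¹ * (∫ x, ‖h x‖ ^ (4/3:ℝ)) ^ 3 := by
  obtain ⟨g, hg⟩ : Sch (fun y => cexp ((‖y‖ ^ 2 / (4 * τ) : ℝ) * I) * h y) := Sch.mulT (chirp_temp _) (Sch.coe h)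
  have hpi := Real.pi_pos
  have hab : 0 < |τ| := abs_pos.2 hτ
  have hn : ∀ y, ‖g y‖ = ‖h y‖ := fun y => by
    rw [← hg, norm_mul, Complex.norm_exp_ofReal_mul_I, one_mul]
  have key : ∀ x, ‖Sf τ h x‖ ^ 4 = ((4 * π * |τ|) ^ 6)⁻¹ * ‖𝓕 g ((4 * π * τ)⁻¹ • x)‖ ^ 4 := by
    intro x
    rw [Sf_kernel hτ, norm_mul, mul_pow]
    congr 1
    · rw [show (3/2:ℂ) = ((3/2:ℝ):ℂ) by push_cast; ring, Complex.norm_cpow_real, norm_div, norm_mul, norm_I,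
        Complex.norm_real, Complex.norm_real, ← Real.rpow_natCast, ← Real.rpow_mul (by positivity)]
      rw [show (3/2 * ((4:ℕ):ℝ)) = ((6:ℕ):ℝ) by norm_num, Real.rpow_natCast, ← inv_pow]
      congr 1
      simp only [Real.norm_eq_abs, abs_mul, abs_pow, abs_of_pos hpi, mul_one]
      norm_num
      field_simp
    · congr 1
      rw [SchwartzMap.fourier_coe, Real.fourier_eq']
      have e : ∀ y, cexp ((‖x - y‖ ^ 2 / (4 * τ) : ℝ) * I) * h y = cexp ((‖x‖ ^ 2 / (4 * τ) : ℝ) * I) * 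
          (cexp (((-2 * π * inner ℝ y ((4 * π * τ)⁻¹ • x) : ℝ) : ℂ) * I) • g y) := by
        intro y
        rw [smul_eq_mul, ← hg, ← mul_assoc, ← mul_assoc, ← Complex.exp_add, ← Complex.exp_add]
        congr 2
        rw [← add_mul, ← add_mul, ← Complex.ofReal_add, ← Complex.ofReal_add]
        congr 2
        rw [norm_sub_sq_real, inner_smul_right, real_inner_comm]
        field_simp
        ring
      simp only [e]
      rw [integral_const_mul, norm_mul, Complex.norm_exp_ofReal_mul_I, one_mul]
  simp only [key]
  rw [integral_const_mul, Measure.integral_comp_smul volume (fun x => ‖𝓕 g x‖ ^ 4)]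
  have hy := hausdorffYoung g
  simp only [hn] at hy
  have hfr : Module.finrank ℝ E3 = 3 := by simp
  rw [hfr, smul_eq_mul]
  have e1 : |(((4 * π * τ)⁻¹) ^ 3)⁻¹| = (4 * π * |τ|) ^ 3 := by
    rw [abs_inv, abs_pow, abs_inv, abs_mul, abs_of_pos (by positivity : 0 < 4 * π), inv_pow, inv_inv]
  rw [e1]
  have hq : 0 ≤ (∫ x, ‖h x‖ ^ (4/3:ℝ)) ^ 3 := pow_nonneg (integral_nonneg fun x => by positivity) 3
  calc ((4 * π * |τ|) ^ 6)⁻¹ * ((4 * π * |τ|) ^ 3 * ∫ x, ‖𝓕 g x‖ ^ 4) 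
      = ((4 * π * |τ|) ^ 3)⁻¹ * ∫ x, ‖𝓕 g x‖ ^ 4 := by field_simp
    _ ≤ (|τ| ^ 3)⁻¹ * (∫ x, ‖h x‖ ^ (4/3:ℝ)) ^ 3 := by
      gcongr
      have : 1 ≤ 4 * π := by linarith [Real.pi_gt_three]
      nlinarith
end

section

/-! ### Jointly smooth functions -/
section smt
variable {F : Type*} [NormedAddCommGroup F] [NormedSpace ℝ F]
/-- joint smoothness -/
def SmT (f : ℝ → E3 → F) : Prop := ContDiff ℝ ∞ (fun p : ℝ × E3 => f p.1 p.2)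
/-- time derivative -/
def dt (f : ℝ → E3 → F) (t : ℝ) (x : E3) : F := deriv (fun s => f s x) t

theorem SmT.dd_eq {f : ℝ → E3 → F} (h : SmT f) (j : Fin 3) (t : ℝ) (x : E3) :
    dd j (f t) x = fderiv ℝ (fun p : ℝ × E3 => f p.1 p.2) (t, x) (0, e3 j) := by
  have hd := (h.differentiable (by simp) (t, x)).hasFDerivAt
  have h2 : HasFDerivAt (fun y : E3 => ((t, y) : ℝ × E3)) (ContinuousLinearMap.inr ℝ ℝ E3) x := 
    hasFDerivAt_prodMk_right t x
  have h3 := hd.comp x h2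
  unfold dd
  rw [show f t = (fun p : ℝ × E3 => f p.1 p.2) ∘ (fun y : E3 => ((t, y) : ℝ × E3)) from rfl, h3.fderiv]
  simp

theorem SmT.hasDerivAt' {f : ℝ → E3 → F} (h : SmT f) (t : ℝ) (x : E3) :
    HasDerivAt (fun s => f s x) (fderiv ℝ (fun p : ℝ × E3 => f p.1 p.2) (t, x) (1, 0)) t := by
  have hd := (h.differentiable (by simp) (t, x)).hasFDerivAt
  have h2 : HasDerivAt (fun s : ℝ => ((s, x) : ℝ × E3)) (1, 0) t := 
    (hasDerivAt_id t).prodMk (hasDerivAt_const t x)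
  exact hd.comp_hasDerivAt t h2

theorem SmT.dt_eq {f : ℝ → E3 → F} (h : SmT f) (t : ℝ) (x : E3) :
    dt f t x = fderiv ℝ (fun p : ℝ × E3 => f p.1 p.2) (t, x) (1, 0) := (h.hasDerivAt' t x).deriv

theorem SmT.hasDerivAt {f : ℝ → E3 → F} (h : SmT f) (t : ℝ) (x : E3) :
    HasDerivAt (fun s => f s x) (dt f t x) t := by
  rw [h.dt_eq]; exact h.hasDerivAt' t x

theorem SmT.fd {f : ℝ → E3 → F} (h : SmT f) (v : ℝ × E3) :
    ContDiff ℝ ∞ (fun p => fderiv ℝ (fun p : ℝ × E3 => f p.1 p.2) p v) :=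
  (h.fderiv_right (m := ∞) (by simp)).clm_apply contDiff_const

theorem SmT.dd {f : ℝ → E3 → F} (h : SmT f) (j : Fin 3) : SmT (fun t => dd j (f t)) := by
  unfold SmT; simp only [h.dd_eq]; exact h.fd _
theorem SmT.dt {f : ℝ → E3 → F} (h : SmT f) : SmT (dt f) := by
  unfold SmT; simp only [h.dt_eq]; exact h.fd _

theorem SmT.continuous {f : ℝ → E3 → F} (h : SmT f) : Continuous (fun p : ℝ × E3 => f p.1 p.2) :=
  ContDiff.continuous h

theorem SmT.dt_dd {f : ℝ → E3 → F} (h : SmT f) (j : Fin 3) (t : ℝ) (x : E3) :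
    _root_.dt (fun s => _root_.dd j (f s)) t x = _root_.dd j (_root_.dt f t) x := by
  have h2 := h.dt
  rw [(h.dd j).dt_eq, h.dt.dd_eq]
  simp only [h.dd_eq, h.dt_eq]
  set U : ℝ × E3 → F := fun p => f p.1 p.2 with hU
  have hU' : ContDiff ℝ ∞ U := h
  have hd : DifferentiableAt ℝ (fderiv ℝ U) (t, x) :=
    (hU'.fderiv_right (m := ∞) (by simp)).differentiable (by simp) _
  have key : ∀ v w : ℝ × E3, fderiv ℝ (fun p => fderiv ℝ U p v) (t, x) w = fderiv ℝ (fderiv ℝ U) (t, x) w v := by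
    intro v w
    have h3 := ((ContinuousLinearMap.apply ℝ F v).hasFDerivAt.comp (t, x) hd.hasFDerivAt).fderiv
    have e : (fun p => fderiv ℝ U p v) = (ContinuousLinearMap.apply ℝ F v) ∘ fderiv ℝ U := rfl
    rw [e, h3]; simp
  show fderiv ℝ (fun p => fderiv ℝ U p (0, e3 j)) (t, x) (1, 0) = fderiv ℝ (fun p => fderiv ℝ U p (1, 0)) (t, x) (0, e3 j)
  rw [key, key]
  have hU2 : ContDiff ℝ 2 U := contDiff_infty.1 hU' 2
  exact (hU2.contDiffAt.isSymmSndFDerivAt (by simp)) _ _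

theorem SmT.hasDerivAt_dd {f : ℝ → E3 → F} (h : SmT f) (j : Fin 3) (t : ℝ) (x : E3) :
    HasDerivAt (fun s => _root_.dd j (f s) x) (_root_.dd j (_root_.dt f t) x) t := by
  rw [← h.dt_dd]; exact (h.dd j).hasDerivAt t x
end smt

theorem lap_eq (g : E3 → ℂ) (x : E3) : lap g x = ∑ j, dd j (dd j g) x := rfl

theorem SmT.lap {f : ℝ → E3 → ℂ} (h : SmT f) : SmT (fun t => lap (f t)) := by
  unfold SmT; simp only [lap_eq]
  exact ContDiff.sum fun j _ => (h.dd j).dd j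

theorem SmT.hasDerivAt_lap {f : ℝ → E3 → ℂ} (h : SmT f) (t : ℝ) (x : E3) :
    HasDerivAt (fun s => _root_.lap (f s) x) (_root_.lap (_root_.dt f t) x) t := by
  simp only [lap_eq]
  refine HasDerivAt.fun_sum fun j _ => ?_
  have h1 := (h.dd j).hasDerivAt_dd j t x
  have e : _root_.dt (fun s => _root_.dd j (f s)) t = _root_.dd j (_root_.dt f t) := by
    ext y; exact h.dt_dd j t y
  rw [e] at h1
  exact h1

/-! ### differentiation under a compactly supported integral -/
theorem hasDerivAt_cpt {X E : Type*} [TopologicalSpace X] [MeasurableSpace X] [OpensMeasurableSpace X] 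
    [SecondCountableTopology X] [T2Space X]
    [NormedAddCommGroup E] [NormedSpace ℝ E] {μ : Measure X} [IsFiniteMeasureOnCompacts μ]
    {F F' : ℝ → X → E} (hF : Continuous fun p : ℝ × X => F p.1 p.2)
    (hF' : Continuous fun p : ℝ × X => F' p.1 p.2) (hd : ∀ t x, HasDerivAt (fun s => F s x) (F' t x) t)
    {K : Set X} (hK : IsCompact K) (h0 : ∀ t, ∀ x ∉ K, F t x = 0) (t : ℝ) :
    HasDerivAt (fun s => ∫ x, F s x ∂μ) (∫ x, F' t x ∂μ) t := by
  have h0' : ∀ s, ∀ x ∉ K, F' s x = 0 := by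
    intro s x hx
    have : (fun s => F s x) = fun _ => 0 := by ext s; exact h0 s x hx
    have h := hd s x
    rw [this] at h
    exact h.unique (hasDerivAt_const s (0:E))
  obtain ⟨C, hC⟩ := ((isCompact_Icc (a := t-1) (b := t+1)).prod hK).exists_bound_of_continuousOn hF'.continuousOn
  have cF : ∀ s, Continuous (F s) := fun s => hF.comp (by fun_prop : Continuous fun x => ((s, x) : ℝ × X))
  have cF' : ∀ s, Continuous (F' s) := fun s => hF'.comp (by fun_prop : Continuous fun x => ((s, x) : ℝ × X))
  have hcs : ∀ s, HasCompactSupport (F s) := fun s => HasCompactSupport.intro hK (h0 s)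
  refine (hasDerivAt_integral_of_dominated_loc_of_deriv_le (s := Set.Icc (t-1) (t+1)) (bound := K.indicator fun _ => |C|)
    (Icc_mem_nhds (by linarith) (by linarith)) (Eventually.of_forall fun s => ?_) ?_ ?_ ?_ ?_ ?_).2
  · exact ((cF s).stronglyMeasurable_of_hasCompactSupport (hcs s)).aestronglyMeasurable
  · exact (cF t).integrable_of_hasCompactSupport (hcs t)
  · exact ((cF' t).stronglyMeasurable_of_hasCompactSupport (HasCompactSupport.intro hK (h0' t))).aestronglyMeasurable
  · filter_upwards with x s hs
    by_cases hx : x ∈ K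
    · rw [Set.indicator_of_mem hx]; exact (hC (s, x) ⟨hs, hx⟩).trans (le_abs_self C)
    · rw [h0' s x hx, Set.indicator_of_notMem hx, norm_zero]
  · rw [integrable_indicator_iff hK.isClosed.measurableSet]
    exact integrableOn_const hK.measure_ne_top
  · filter_upwards with x s _
    exact hd s x

/-! ### integrated derivative bounds with one mild singularity -/
/-- antiderivative of `|s-θ|^(-3/4)` -/
def hs4 (θ s : ℝ) : ℝ := if θ ≤ s then 4 * (s - θ) ^ (1/4:ℝ) else -(4 * (θ - s) ^ (1/4:ℝ))

theorem hs4_cont (θ : ℝ) : Continuous (hs4 θ) := by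
  unfold hs4
  refine Continuous.if_le ?_ ?_ continuous_const continuous_id ?_
  · exact continuous_const.mul ((continuous_id.sub continuous_const).rpow_const fun _ => Or.inr (by norm_num))
  · exact (continuous_const.mul ((continuous_const.sub continuous_id).rpow_const fun _ => Or.inr (by norm_num))).neg
  · rintro x rfl; simp

theorem hs4_deriv {θ s : ℝ} (h : s ≠ θ) : HasDerivAt (hs4 θ) (|s - θ| ^ (-3/4:ℝ)) s := by
  rcases lt_or_gt_of_ne h with h | h
  · have h1 : HasDerivAt (fun s => θ - s) (-1) s := by simpa using (hasDerivAt_id s).const_sub θ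
    have h2 := ((h1.rpow_const (p := 1/4) (Or.inl (by linarith))).const_mul 4).neg
    refine (h2.congr_of_eventuallyEq ?_).congr_deriv ?_
    · filter_upwards [Iio_mem_nhds h] with r hr
      simp only [hs4, if_neg (not_le.2 (Set.mem_Iio.1 hr))]; rfl
    · rw [abs_of_neg (by linarith), neg_sub]; norm_num; ring
  · have h1 : HasDerivAt (fun s => s - θ) 1 s := (hasDerivAt_id s).sub_const θ
    have h2 := ((h1.rpow_const (p := 1/4) (Or.inl (by linarith))).const_mul 4)
    refine (h2.congr_of_eventuallyEq ?_).congr_deriv ?_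
    · filter_upwards [Ioi_mem_nhds h] with r hr
      simp only [hs4, if_pos (le_of_lt (Set.mem_Ioi.1 hr))]
    · rw [abs_of_pos (by linarith)]; norm_num; ring

theorem hs4_diff {θ a b : ℝ} (h : a ≤ b) : hs4 θ b - hs4 θ a ≤ 8 * (b - a) ^ (1/4:ℝ) := by
  have sub : ∀ x y : ℝ, 0 ≤ x → 0 ≤ y → (x + y) ^ (1/4:ℝ) ≤ x ^ (1/4:ℝ) + y ^ (1/4:ℝ) := fun x y hx hy =>
    Real.rpow_add_le_add_rpow hx hy (by norm_num) (by norm_num)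
  have hn : 0 ≤ (b - a) ^ (1/4:ℝ) := Real.rpow_nonneg (by linarith) _
  unfold hs4
  split_ifs with h1 h2 h2
  · have := sub (a - θ) (b - a) (by linarith) (by linarith)
    rw [show a - θ + (b - a) = b - θ by ring] at this
    linarith
  · have i1 : (b - θ) ^ (1/4:ℝ) ≤ (b - a) ^ (1/4:ℝ) := by
      apply Real.rpow_le_rpow <;> linarith
    have i2 : (θ - a) ^ (1/4:ℝ) ≤ (b - a) ^ (1/4:ℝ) := by
      apply Real.rpow_le_rpow <;> linarith
    linarith
  · linarith
  · have := sub (θ - b) (b - a) (by linarith) (by linarith)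
    rw [show θ - b + (b - a) = θ - a by ring] at this
    linarith

theorem anti_except {ψ ψ' : ℝ → ℝ} {a b θ : ℝ} (hab : a ≤ b) (hc : ContinuousOn ψ (Set.Icc a b))
    (hd : ∀ s ∈ Set.Ioo a b, s ≠ θ → HasDerivAt ψ (ψ' s) s) (hn : ∀ s ∈ Set.Ioo a b, s ≠ θ → ψ' s ≤ 0) :
    ψ b ≤ ψ a := by
  have basic : ∀ a' b', a ≤ a' → a' ≤ b' → b' ≤ b → θ ∉ Set.Ioo a' b' → ψ b' ≤ ψ a' := by
    intro a' b' h1 h2 h3 h4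
    have hsub : Set.Ioo a' b' ⊆ Set.Ioo a b := Set.Ioo_subset_Ioo h1 h3
    have hne : ∀ s ∈ Set.Ioo a' b', s ≠ θ := fun s hs e => h4 (e ▸ hs)
    have : AntitoneOn ψ (Set.Icc a' b') := by
      refine antitoneOn_of_deriv_nonpos (convex_Icc a' b') (hc.mono (Set.Icc_subset_Icc h1 h3)) ?_ ?_
      · rw [interior_Icc]
        exact fun s hs => (hd s (hsub hs) (hne s hs)).differentiableAt.differentiableWithinAt
      · rw [interior_Icc]
        intro s hs
        rw [(hd s (hsub hs) (hne s hs)).deriv]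
        exact hn s (hsub hs) (hne s hs)
    exact this ⟨le_rfl, h2⟩ ⟨h2, le_rfl⟩ h2
  by_cases hθ : θ ∈ Set.Ioo a b
  · exact (basic θ b hθ.1.le hθ.2.le le_rfl (by simp)).trans (basic a θ le_rfl hθ.1.le hθ.2.le (by simp))
  · exact basic a b le_rfl hab le_rfl hθ

theorem ftc_bound {Φ Φ' : ℝ → ℂ} {a b θ κ e : ℝ} (hab : a ≤ b) (hκ : 0 ≤ κ)
    (hc : ContinuousOn Φ (Set.Icc a b))
    (hd : ∀ s ∈ Set.Ioo a b, HasDerivAt Φ (Φ' s) s) 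
    (hb : ∀ s ∈ Set.Ioo a b, s ≠ θ → ‖Φ' s‖ ≤ κ * |s - θ| ^ (-3/4:ℝ) + e) :
    ‖Φ b - Φ a‖ ≤ κ * (8 * (b - a) ^ (1/4:ℝ)) + e * (b - a) := by
  obtain ⟨c, hc1, hc2⟩ : ∃ c : ℂ, ‖c‖ = 1 ∧ (c * (Φ b - Φ a)).re = ‖Φ b - Φ a‖ := by
    by_cases h : Φ b - Φ a = 0
    · exact ⟨1, by simp, by simp [h]⟩
    · refine ⟨(starRingEnd ℂ) (Φ b - Φ a) / ‖Φ b - Φ a‖, ?_, ?_⟩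
      · rw [norm_div, RCLike.norm_conj, Complex.norm_real, norm_norm, div_self (norm_ne_zero_iff.2 h)]
      · rw [div_mul_eq_mul_div, mul_comm, Complex.mul_conj, Complex.normSq_eq_norm_sq, ← Complex.ofReal_div,
          Complex.ofReal_re, sq, mul_div_assoc, div_self (norm_ne_zero_iff.2 h), mul_one]
  have h := anti_except (ψ := fun s => (c * Φ s).re - κ * hs4 θ s - e * s) 
    (ψ' := fun s => (c * Φ' s).re - κ * (|s - θ| ^ (-3/4:ℝ)) - e * 1) (θ := θ) hab ?_ ?_ ?_
  · have h2 := hs4_diff (θ := θ) hab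
    have h3 := mul_le_mul_of_nonneg_left h2 hκ
    rw [← hc2, mul_sub, Complex.sub_re]
    linarith
  · refine ContinuousOn.sub (ContinuousOn.sub ?_ ?_) ?_
    · exact Complex.continuous_re.comp_continuousOn (continuousOn_const.mul hc)
    · exact (continuous_const.mul (hs4_cont θ)).continuousOn
    · exact (continuous_const.mul continuous_id).continuousOn
  · intro s hs hne
    have h1 : HasDerivAt (fun s => (c * Φ s).re) (c * Φ' s).re s := 
      (Complex.reCLM.hasFDerivAt.comp_hasDerivAt s ((hd s hs).const_mul c))
    exact (h1.sub ((hs4_deriv hne).const_mul κ)).sub ((hasDerivAt_id s).const_mul e)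
  · intro s hs hne
    have h1 := hb s hs hne
    have h2 : (c * Φ' s).re ≤ ‖Φ' s‖ := (Complex.re_le_norm _).trans (by rw [norm_mul, hc1, one_mul])
    linarith

theorem ftc_bound0 {Φ Φ' : ℝ → ℂ} {a b e : ℝ} (hab : a ≤ b)
    (hd : ∀ s ∈ Set.Icc a b, HasDerivAt Φ (Φ' s) s) (hb : ∀ s ∈ Set.Icc a b, ‖Φ' s‖ ≤ e) :
    ‖Φ b - Φ a‖ ≤ e * (b - a) := by
  have := ftc_bound (Φ := Φ) (Φ' := Φ') (θ := 0) (κ := 0) (e := e) hab le_rfl 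
    (fun s hs => (hd s hs).continuousAt.continuousWithinAt) (fun s hs => hd s (Set.Ioo_subset_Icc_self hs))
    (fun s hs _ => by rw [zero_mul, zero_add]; exact hb s (Set.Ioo_subset_Icc_self hs))
  simpa using this

/-! ### cutoffs -/
/-- base bump -/
def bump0 : ContDiffBump (0 : E3) := ⟨1, 2, one_pos, one_lt_two⟩
/-- cutoff at scale n+1 -/
def cut (n : ℕ) (x : E3) : ℝ := bump0 (((n:ℝ) + 1)⁻¹ • x)

theorem cut_nonneg (n : ℕ) (x : E3) : 0 ≤ cut n x := bump0.nonneg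
theorem cut_le_one (n : ℕ) (x : E3) : cut n x ≤ 1 := bump0.le_one
theorem cut_smooth (n : ℕ) : ContDiff ℝ ∞ (cut n) := bump0.contDiff.comp (contDiff_const_smul _)
theorem cut_supp (n : ℕ) : ∀ x ∉ Metric.closedBall (0:E3) (2 * (n + 1)), cut n x = 0 := by
  intro x hx
  refine bump0.zero_of_le_dist ?_
  rw [Metric.mem_closedBall, not_le] at hx
  rw [dist_zero_right] at hx ⊢
  rw [norm_smul, Real.norm_eq_abs, abs_of_pos (by positivity), inv_mul_eq_div, le_div_iff₀ (by positivity)]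
  exact hx.le
theorem cut_sch (n : ℕ) : Sch (cut n) :=
  ⟨(HasCompactSupport.intro (isCompact_closedBall _ _) (cut_supp n)).toSchwartzMap (cut_smooth n), fun _ => rfl⟩
theorem cut_eq_one {n : ℕ} {x : E3} (h : ‖x‖ ≤ n) : cut n x = 1 := by
  refine bump0.one_of_mem_closedBall ?_
  rw [Metric.mem_closedBall, dist_zero_right, norm_smul, Real.norm_eq_abs, abs_of_pos (by positivity), inv_mul_eq_div]
  show _ ≤ (1:ℝ)
  rw [div_le_iff₀ (by positivity)]; linarith
theorem cut_tendsto (x : E3) : Tendsto (fun n => cut n x) atTop (nhds 1) := by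
  refine tendsto_const_nhds.congr' ?_
  obtain ⟨N, hN⟩ := exists_nat_ge ‖x‖
  filter_upwards [eventually_ge_atTop N] with n hn
  exact (cut_eq_one (hN.trans (by exact_mod_cast hn))).symm

theorem dd_scale {f : E3 → ℝ} (hf : Differentiable ℝ f) (c : ℝ) (j : Fin 3) (x : E3) :
    dd j (fun x => f (c • x)) x = c * dd j f (c • x) := by
  have h2 : HasFDerivAt (fun y : E3 => c • y) (c • (ContinuousLinearMap.id ℝ E3)) x := (hasFDerivAt_id x).const_smul c
  have := ((hf (c • x)).hasFDerivAt.comp x h2).fderiv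
  unfold dd
  rw [show (fun y => f (c • y)) = f ∘ (fun y => c • y) from rfl, this]; simp

theorem cut_dd (n : ℕ) (j : Fin 3) (x : E3) : dd j (cut n) x = ((n:ℝ)+1)⁻¹ * dd j bump0 (((n:ℝ)+1)⁻¹ • x) :=
  dd_scale (bump0.contDiff (n := 1).differentiable (by simp)) _ j x
theorem bump_sch : Sch (bump0 : E3 → ℝ) := (cut_sch 0).congr fun x => by simp [cut]

theorem Sch.bdd {F : Type*} [NormedAddCommGroup F] [NormedSpace ℝ F] {f : E3 → F} (h : Sch f) : ∃ C, 0 ≤ C ∧ ∀ x, ‖f x‖ ≤ C := by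
  obtain ⟨s, hs⟩ := h
  refine ⟨SchwartzMap.seminorm ℝ 0 0 s, apply_nonneg _ _, fun x => ?_⟩
  rw [hs]; exact SchwartzMap.norm_le_seminorm ℝ s x

theorem cut_bounds : ∃ C, 0 ≤ C ∧ ∀ (n : ℕ) (j : Fin 3) (x : E3), |dd j (cut n) x| ≤ C / (n+1) ∧ |dd j (dd j (cut n)) x| ≤ C / (n+1) := by
  have h1 : ∀ j : Fin 3, ∃ C, 0 ≤ C ∧ ∀ x, ‖dd j bump0 x‖ ≤ C := fun j => (bump_sch.dd j).bdd
  have h2 : ∀ j : Fin 3, ∃ C, 0 ≤ C ∧ ∀ x, ‖dd j (dd j bump0) x‖ ≤ C := fun j => ((bump_sch.dd j).dd j).bdd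
  choose C1 p1 q1 using h1
  choose C2 p2 q2 using h2
  refine ⟨∑ j, (C1 j + C2 j), Finset.sum_nonneg fun j _ => add_nonneg (p1 j) (p2 j), fun n j x => ?_⟩
  have hle : C1 j + C2 j ≤ ∑ j, (C1 j + C2 j) := 
    Finset.single_le_sum (f := fun j => C1 j + C2 j) (fun j _ => add_nonneg (p1 j) (p2 j)) (Finset.mem_univ j)
  have hn : (0:ℝ) < n + 1 := by positivity
  have hi : ((n:ℝ)+1)⁻¹ ≤ 1 := inv_le_one_of_one_le₀ (by linarith [(Nat.cast_nonneg n : (0:ℝ) ≤ n)])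
  constructor
  · rw [cut_dd, abs_mul, abs_of_pos (inv_pos.2 hn), inv_mul_eq_div]
    gcongr
    exact (q1 j _).trans (by linarith [p2 j])
  · have e : dd j (cut n) = fun x => ((n:ℝ)+1)⁻¹ * dd j bump0 (((n:ℝ)+1)⁻¹ • x) := by ext x; exact cut_dd n j x
    have hdf : Differentiable ℝ (dd j bump0) := (bump_sch.dd j).differentiable
    have hd1 : DifferentiableAt ℝ (fun x => dd j bump0 (((n:ℝ)+1)⁻¹ • x)) x :=
      (hdf.comp (differentiable_id.const_smul (((n:ℝ)+1)⁻¹))) x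
    rw [e, dd_cmul _ _ hd1, dd_scale hdf, abs_mul, abs_mul, abs_of_pos (inv_pos.2 hn),
      inv_mul_eq_div]
    gcongr
    calc ((n:ℝ)+1)⁻¹ * |dd j (dd j bump0) (((n:ℝ)+1)⁻¹ • x)| ≤ 1 * C2 j := by
          gcongr; exact q2 j _
      _ ≤ _ := by linarith [p1 j]

/-! ### joint continuity of the free flow -/
theorem Sf_cont (h : SchwartzMap E3 ℂ) : Continuous fun p : ℝ × E3 => Sf p.1 h p.2 := by
  have e : (fun p : ℝ × E3 => Sf p.1 h p.2) = fun p => ∫ ξ, cexp ((2 * π * inner ℝ ξ p.2 : ℝ) * I) * (ph p.1 ξ * 𝓕 h ξ) := by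
    ext p; rw [inv_formula]; congr 1; ext ξ; rw [fourier_Sf]
  rw [e]
  have hF : Continuous (fun ξ => 𝓕 h ξ) := (Sch.coe (𝓕 h)).continuous
  refine continuous_of_dominated (bound := fun ξ => ‖𝓕 h ξ‖) (fun p => ?_) (fun p => ?_) (fourier_integrable h).norm ?_
  · refine Continuous.aestronglyMeasurable ?_
    unfold ph; fun_prop
  · filter_upwards with ξ
    rw [norm_mul, norm_mul, Complex.norm_exp_ofReal_mul_I, ph_norm, one_mul, one_mul]
  · filter_upwards with ξ
    unfold ph; fun_prop

theorem Sf_lapS (τ : ℝ) (h : SchwartzMap E3 ℂ) : lapS (Sf τ h) = Sf τ (lapS h) := by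
  refine fourier_inj fun ξ => ?_
  rw [fourier_lapS, fourier_Sf, fourier_Sf, fourier_lapS]; ring
theorem Sf_lap_cont (h : SchwartzMap E3 ℂ) : Continuous fun p : ℝ × E3 => lap (Sf p.1 h) p.2 := by
  simp only [← lapS_apply, Sf_lapS]; exact Sf_cont _
end

section

/-! ### L⁴ quantities -/
def n4 (f : E3 → ℂ) : ℝ := √(√(∫ x, ‖f x‖ ^ 4))
def Qh (h : E3 → ℂ) : ℝ := √(√((∫ x, ‖h x‖ ^ (4/3:ℝ)) ^ 3))
theorem n4_nonneg (f : E3 → ℂ) : 0 ≤ n4 f := Real.sqrt_nonneg _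
theorem Qh_nonneg (f : E3 → ℂ) : 0 ≤ Qh f := Real.sqrt_nonneg _
theorem n4_sq (f : E3 → ℂ) : n4 f ^ 2 = √(∫ x, ‖f x‖ ^ 4) := Real.sq_sqrt (Real.sqrt_nonneg _)
theorem n4_four (f : E3 → ℂ) : n4 f ^ 4 = ∫ x, ‖f x‖ ^ 4 := by
  rw [show n4 f ^ 4 = (n4 f ^ 2) ^ 2 by ring, n4_sq, Real.sq_sqrt (integral_nonneg fun x => by positivity)]

theorem sqrt_sqrt_eq {x : ℝ} (hx : 0 ≤ x) : √(√x) = x ^ (1/4:ℝ) := by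
  rw [Real.sqrt_eq_rpow, Real.sqrt_eq_rpow, ← Real.rpow_mul hx]; norm_num

theorem hol4 {u w v : E3 → ℂ} (hu : Sch u) (hw : Sch w) (hv : Sch v) :
    ∫ x, ‖u x‖ ^ 2 * (‖w x‖ * ‖v x‖) ≤ √(∫ x, ‖u x‖ ^ 4) * (n4 w * n4 v) := by
  have h1 := cs_int (μ := (volume : Measure E3)) (f := fun x => ‖u x‖ ^ 2) (g := fun x => ‖w x‖ * ‖v x‖)
    hu.norm_sq.continuous.aestronglyMeasurable ((hw.continuous.norm.mul hv.continuous.norm).aestronglyMeasurable)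
    (hu.norm_four.integrable.congr (ae_of_all _ fun x => by ring))
    ((hw.norm_sq.mul hv.norm_sq).integrable.congr (ae_of_all _ fun x => by ring))
  have h2 := cs_int (μ := (volume : Measure E3)) (f := fun x => ‖w x‖ ^ 2) (g := fun x => ‖v x‖ ^ 2)
    hw.norm_sq.continuous.aestronglyMeasurable hv.norm_sq.continuous.aestronglyMeasurable
    (hw.norm_four.integrable.congr (ae_of_all _ fun x => by ring))
    (hv.norm_four.integrable.congr (ae_of_all _ fun x => by ring))
  have e1 : ∀ f : E3 → ℂ, ∫ x, (‖f x‖ ^ 2) ^ 2 = ∫ x, ‖f x‖ ^ 4 := fun f => by congr 1; ext x; ring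
  have e2 : ∫ x, (‖w x‖ * ‖v x‖) ^ 2 = ∫ x, ‖w x‖ ^ 2 * ‖v x‖ ^ 2 := by congr 1; ext x; ring
  have e3' : ∀ x, |‖u x‖ ^ 2| * |‖w x‖ * ‖v x‖| = ‖u x‖ ^ 2 * (‖w x‖ * ‖v x‖) := fun x => by
    rw [abs_of_nonneg (by positivity), abs_of_nonneg (by positivity)]
  have e4 : ∀ x, |‖w x‖ ^ 2| * |‖v x‖ ^ 2| = ‖w x‖ ^ 2 * ‖v x‖ ^ 2 := fun x => by
    rw [abs_of_nonneg (by positivity), abs_of_nonneg (by positivity)]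
  simp only [e3', e1, e2] at h1
  simp only [e4, e1] at h2
  refine h1.trans (mul_le_mul_of_nonneg_left ?_ (Real.sqrt_nonneg _))
  refine (Real.sqrt_le_sqrt h2).trans (le_of_eq ?_)
  rw [Real.sqrt_mul (Real.sqrt_nonneg _)]; rfl

theorem holQ {h v : E3 → ℂ} (hh : Sch h) (hv : Sch v) :
    ∫ x, ‖h x‖ * ‖v x‖ ≤ Qh h * n4 v := by
  obtain ⟨h', hh'⟩ := hh
  obtain ⟨v', hv'⟩ := hv
  simp only [hh', hv', Qh, n4]
  have h := integral_mul_le_Lp_mul_Lq_of_nonneg (μ := (volume : Measure E3)) (p := 4/3) (q := 4)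
    (by constructor <;> norm_num) (f := fun x => ‖h' x‖) (g := fun x => ‖v' x‖)
    (by filter_upwards with x using norm_nonneg _) (by filter_upwards with x using norm_nonneg _)
    (h'.memLp _ volume).norm (v'.memLp _ volume).norm
  refine h.trans (le_of_eq ?_)
  have p1 : 0 ≤ ∫ x, ‖h' x‖ ^ (4/3:ℝ) := integral_nonneg fun x => by positivity
  rw [sqrt_sqrt_eq (by positivity), sqrt_sqrt_eq (integral_nonneg fun x => by positivity), ← Real.rpow_natCast _ 3,
    ← Real.rpow_mul p1]
  congr 2
  · norm_num
  · congr 1; ext x; rw [← Real.rpow_natCast]; norm_num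

theorem disp_n4 {τ : ℝ} (hτ : τ ≠ 0) (h : SchwartzMap E3 ℂ) : n4 (Sf τ h) ≤ Qh h * |τ| ^ (-3/4:ℝ) := by
  have h1 := dispersive hτ h
  have hp : 0 < |τ| := abs_pos.2 hτ
  have e : √(√((|τ| ^ 3)⁻¹)) = |τ| ^ (-3/4:ℝ) := by
    rw [sqrt_sqrt_eq (by positivity), ← Real.rpow_natCast, ← Real.rpow_neg hp.le, ← Real.rpow_mul hp.le]; norm_num
  unfold n4 Qh
  rw [← e, mul_comm, ← Real.sqrt_mul (Real.sqrt_nonneg _), ← Real.sqrt_mul (by positivity)]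
  exact Real.sqrt_le_sqrt (Real.sqrt_le_sqrt h1)

/-! ### the solution package -/
structure Sol (T : ℝ) (u : ℝ → E3 → ℂ) : Prop where
  sm : SmT u
  us : ∀ t, Sch (u t)
  ws : ∀ t, Sch (dt u t)
  eq : ∀ t ∈ Set.Icc (0:ℝ) T, ∀ x, dt u t x = I * (lap (u t) x - u t x * u t x * (starRingEnd ℂ) (u t x))

theorem Sol.of {T : ℝ} {φ : ℝ → E3 → ℂ} (h : IsSolution 1 1 (fun z => z) T φ) : Sol T φ where
  sm := h.smooth
  us t := by
    obtain ⟨g, hg⟩ := h.schwartz 0 t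
    exact ⟨g, fun x => by simpa using hg x⟩
  ws t := by
    obtain ⟨g, hg⟩ := h.schwartz 1 t
    exact ⟨g, fun x => by simpa [dt] using hg x⟩
  eq t ht x := by
    have := h.eqn t ht x
    have e : φ t x * (starRingEnd ℂ) (φ t x) = ((Complex.normSq (φ t x) : ℝ) : ℂ) := Complex.mul_conj _
    simp only [ofReal_one, one_mul] at this
    unfold dt
    linear_combination (-I) * this + (I * φ t x) * e + (deriv (fun s => φ s x) t) * I_sq

section sol
variable {T : ℝ} {u : ℝ → E3 → ℂ}

theorem Sol.weq (h : Sol T u) {t : ℝ} (ht : t ∈ Set.Ioo (0:ℝ) T) (x : E3) :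
    dt (dt u) t x = I * (lap (dt u t) x - (2 * u t x * (starRingEnd ℂ) (u t x) * dt u t x + u t x * u t x * (starRingEnd ℂ) (dt u t x))) := by
  have hu := h.sm.hasDerivAt t x
  have hc : HasDerivAt (fun s => (starRingEnd ℂ) (u s x)) ((starRingEnd ℂ) (dt u t x)) t := by
    exact (Complex.conjCLE : ℂ →L[ℝ] ℂ).hasFDerivAt.comp_hasDerivAt t hu
  have h1 := ((h.sm.hasDerivAt_lap t x).sub ((hu.mul hu).mul hc)).const_mul I
  have h2 := (h1.congr_of_eventuallyEq (f₁ := fun s => dt u s x) ?_).deriv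
  · unfold dt at h2 ⊢
    rw [h2]; simp; ring
  · filter_upwards [Ioo_mem_nhds ht.1 ht.2] with s hs
    rw [h.eq s (Set.Ioo_subset_Icc_self hs)]; simp
end sol
end

section

theorem cut_int_tendsto {F : Type*} [NormedAddCommGroup F] [NormedSpace ℝ F] {f : E3 → F} (hf : Integrable f) :
    Tendsto (fun n => ∫ x, cut n x • f x) atTop (nhds (∫ x, f x)) := by
  refine tendsto_integral_of_dominated_convergence (fun x => ‖f x‖) 
    (fun n => (cut_smooth n).continuous.aestronglyMeasurable.smul hf.aestronglyMeasurable) hf.norm 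
    (fun n => ae_of_all _ fun x => ?_) (ae_of_all _ fun x => ?_)
  · rw [norm_smul, Real.norm_eq_abs, abs_of_nonneg (cut_nonneg _ _)]
    exact mul_le_of_le_one_left (norm_nonneg _) (cut_le_one _ _)
  · simpa using (cut_tendsto x).smul_const (f x)

theorem tendsto_cdiv (D : ℝ) : Tendsto (fun n : ℕ => D / ((n:ℝ) + 1)) atTop (nhds 0) := by
  have := (tendsto_one_div_add_atTop_nhds_zero_nat (𝕜 := ℝ)).const_mul D
  simpa [div_eq_mul_inv] using this

theorem cons_limit {g g' : ℝ → E3 → ℝ} (hg : Continuous fun p : ℝ × E3 => g p.1 p.2)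
    (hg' : Continuous fun p : ℝ × E3 => g' p.1 p.2) (hd : ∀ t x, HasDerivAt (fun s => g s x) (g' t x) t)
    (hi : ∀ t, Integrable (g t)) {a b D : ℝ} 
    (hb : ∀ n : ℕ, ∀ s ∈ Set.uIcc a b, |∫ x, cut n x * g' s x| ≤ D / (n + 1)) : ∫ x, g b x = ∫ x, g a x := by
  have key : ∀ n : ℕ, |(∫ x, cut n x * g b x) - ∫ x, cut n x * g a x| ≤ D / (n+1) * |b - a| := by
    intro n
    have hdd : ∀ s, HasDerivAt (fun s => ∫ x, cut n x * g s x) (∫ x, cut n x * g' s x) s := fun s =>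
      hasDerivAt_cpt (F := fun s x => cut n x * g s x) (F' := fun s x => cut n x * g' s x) (μ := volume)
        (((cut_smooth n).continuous.comp continuous_snd).mul hg)
        (((cut_smooth n).continuous.comp continuous_snd).mul hg') (fun t x => (hd t x).const_mul _)
        (isCompact_closedBall (0:E3) _) (fun t x hx => by rw [cut_supp n x hx, zero_mul]) s
    exact (convex_uIcc a b).norm_image_sub_le_of_norm_hasDerivWithin_le
      (f := fun s => ∫ x, cut n x * g s x) (fun s _ => (hdd s).hasDerivWithinAt) (hb n) Set.left_mem_uIcc Set.right_mem_uIcc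
  have h1 := ((cut_int_tendsto (hi b)).sub (cut_int_tendsto (hi a))).abs
  have h2 := (tendsto_cdiv D).mul_const |b - a|
  have := le_of_tendsto_of_tendsto' h1 h2 key
  rw [zero_mul] at this
  have := abs_eq_zero.1 (le_antisymm this (abs_nonneg _))
  linarith

/-- current -/
def pc (j : Fin 3) (f : E3 → ℂ) (x : E3) : ℝ := ((starRingEnd ℂ) (f x) * dd j f x).im
theorem Sch.pc {f : E3 → ℂ} (h : Sch f) (j : Fin 3) : Sch (pc j f) := (h.conj.mul (h.dd j)).im

theorem div_pc {f : E3 → ℂ} (h : Sch f) (x : E3) : ∑ j, dd j (pc j f) x = ((starRingEnd ℂ) (f x) * lap f x).im := by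
  have e : ∀ j, dd j (pc j f) x = ((starRingEnd ℂ) (f x) * dd j (dd j f) x).im := by
    intro j
    have h1 := dd_im j ((h.conj.mul (h.dd j)).da x)
    refine (show dd j (pc j f) x = _ from h1).trans ?_
    rw [dd_mul j (h.conj.da x) ((h.dd j).da x), dd_conj j (h.da x)]
    rw [Complex.add_im]
    have : ((starRingEnd ℂ) (dd j f x) * dd j f x).im = 0 := by
      rw [mul_comm, Complex.mul_conj, Complex.ofReal_im]
    rw [this, zero_add]
  simp only [e, lap_eq, Finset.mul_sum, Complex.im_sum]

theorem norm_pc_le (j : Fin 3) (f : E3 → ℂ) (x : E3) : |pc j f x| ≤ ‖f x‖ * ‖dd j f x‖ := by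
  refine (Complex.abs_im_le_norm _).trans ?_
  rw [norm_mul, RCLike.norm_conj]

theorem l2_dd_le {f : E3 → ℂ} (h : Sch f) (j : Fin 3) : l2 (dd j f) ≤ √(gs f) := by
  refine Real.sqrt_le_sqrt (integral_mono (h.dd j).norm_sq.integrable h.gradsq.integrable fun x => ?_)
  exact Finset.single_le_sum (f := fun j => ‖dd j f x‖ ^ 2) (fun j _ => by positivity) (Finset.mem_univ j)

theorem cutdd_bd {C : ℝ}
    {f g : E3 → ℂ} (hf : Sch f) (hg : Sch g) (n : ℕ) {a : E3 → ℝ} {p : E3 → ℝ} (ha : ∀ x, |a x| ≤ C/(n+1)) 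
    (hp : ∀ x, |p x| ≤ ‖f x‖ * ‖g x‖) : |∫ x, a x * p x| ≤ C / (n+1) * (l2 f * l2 g) := by
  have h0 : 0 ≤ C / ((n:ℝ)+1) := (abs_nonneg _).trans (ha 0)
  calc |∫ x, a x * p x| ≤ ∫ x, C / (n+1) * (‖f x‖ * ‖g x‖) := by
        rw [← Real.norm_eq_abs]
        refine norm_integral_le_of_norm_le ((hf.mulNorm hg).const_mul _) (ae_of_all _ fun x => ?_)
        rw [norm_mul]; exact mul_le_mul (ha x) (hp x) (abs_nonneg _) h0
    _ ≤ _ := by rw [integral_const_mul]; exact mul_le_mul_of_nonneg_left (cs_sch hf hg) h0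

section sol
variable {T : ℝ} {u : ℝ → E3 → ℂ}

theorem Sol.rho_deriv (h : Sol T u) (t : ℝ) (x : E3) :
    HasDerivAt (fun s => ‖u s x‖ ^ 2) (2 * ((starRingEnd ℂ) (u t x) * dt u t x).re) t := by
  have := (h.sm.hasDerivAt t x).norm_sq
  refine this.congr_deriv ?_
  rw [Complex.inner]; ring_nf

theorem Sol.rho_t (h : Sol T u) {t : ℝ} (ht : t ∈ Set.Icc (0:ℝ) T) (x : E3) :
    2 * ((starRingEnd ℂ) (u t x) * dt u t x).re = - 2 * ∑ j, dd j (pc j (u t)) x := by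
  rw [div_pc (h.us t), h.eq t ht]
  simp only [Complex.mul_re, Complex.mul_im, Complex.conj_re, Complex.conj_im, Complex.I_re, Complex.I_im, Complex.sub_re, Complex.sub_im]
  ring

theorem Sol.mass (h : Sol T u) {a b L : ℝ} (hab : Set.uIcc a b ⊆ Set.Icc 0 T)
    (h1 : ∀ s ∈ Set.uIcc a b, ∫ x, ‖u s x‖ ^ 2 ≤ L) (h2 : ∀ s ∈ Set.uIcc a b, gs (u s) ≤ L) :
    ∫ x, ‖u b x‖ ^ 2 = ∫ x, ‖u a x‖ ^ 2 := by
  obtain ⟨C, hC0, hC⟩ := cut_bounds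
  have hL : 0 ≤ L := (integral_nonneg fun x => by positivity).trans (h1 a Set.left_mem_uIcc)
  refine cons_limit (g := fun s x => ‖u s x‖ ^ 2) (g' := fun t x => 2 * ((starRingEnd ℂ) (u t x) * dt u t x).re)
    (D := 6 * C * L) (h.sm.continuous.norm.pow 2) ?_ h.rho_deriv (fun t => (h.us t).norm_sq.integrable) ?_
  · exact continuous_const.mul (Complex.continuous_re.comp ((Complex.continuous_conj.comp h.sm.continuous).mul h.sm.dt.continuous))
  · intro n s hs
    have e : ∫ x, cut n x * (2 * ((starRingEnd ℂ) (u s x) * dt u s x).re) = 2 * ∑ j, ∫ x, dd j (cut n) x * pc j (u s) x := by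
      have : ∀ x, cut n x * (2 * ((starRingEnd ℂ) (u s x) * dt u s x).re) = (-2) * ∑ j, cut n x * dd j (pc j (u s)) x := by
        intro x; rw [h.rho_t (hab hs), ← Finset.mul_sum]; ring
      simp only [this]
      rw [integral_const_mul, integral_finsetSum _ fun j _ => ((cut_sch n).mul (((h.us s).pc j).dd j)).integrable]
      simp only [fun j => ibpT (cut_sch n).temp ((h.us s).pc j) j, Finset.sum_neg_distrib]
      ring
    rw [e, abs_mul, abs_two]
    have hj : ∀ j, |∫ x, dd j (cut n) x * pc j (u s) x| ≤ C / (n+1) * L := by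
      intro j
      refine (cutdd_bd (h.us s) ((h.us s).dd j) n (fun x => (hC n j x).1) (norm_pc_le j _)).trans ?_
      refine mul_le_mul_of_nonneg_left ?_ (by positivity)
      calc l2 (u s) * l2 (dd j (u s)) ≤ √L * √L := 
            mul_le_mul (Real.sqrt_le_sqrt (h1 s hs)) ((l2_dd_le (h.us s) j).trans (Real.sqrt_le_sqrt (h2 s hs))) (l2_nonneg _) (Real.sqrt_nonneg _)
        _ = L := Real.mul_self_sqrt hL
    calc 2 * |∑ j, ∫ x, dd j (cut n) x * pc j (u s) x| ≤ 2 * ∑ j : Fin 3, C / (n+1) * L := by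
          gcongr; exact (Finset.abs_sum_le_sum_abs _ _).trans (Finset.sum_le_sum fun j _ => hj j)
      _ = _ := by simp; ring

theorem Sol.energy (h : Sol T u) {a b L : ℝ} (hab : Set.uIcc a b ⊆ Set.Icc 0 T)
    (h1 : ∀ s ∈ Set.uIcc a b, ∫ x, ‖dt u s x‖ ^ 2 ≤ L) (h2 : ∀ s ∈ Set.uIcc a b, gs (u s) ≤ L) :
    ∫ x, (1/2 * (∑ j, ‖dd j (u b) x‖ ^ 2) + 1/4 * ‖u b x‖ ^ 4) = ∫ x, (1/2 * (∑ j, ‖dd j (u a) x‖ ^ 2) + 1/4 * ‖u a x‖ ^ 4) := by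
  obtain ⟨C, hC0, hC⟩ := cut_bounds
  have hL : 0 ≤ L := (integral_nonneg fun x => by positivity).trans (h1 a Set.left_mem_uIcc)
  refine cons_limit (g := fun s x => 1/2 * (∑ j, ‖dd j (u s) x‖ ^ 2) + 1/4 * ‖u s x‖ ^ 4)
    (g' := fun t x => (∑ j, ((starRingEnd ℂ) (dd j (u t) x) * dd j (dt u t) x).re) + ‖u t x‖ ^ 2 * ((starRingEnd ℂ) (u t x) * dt u t x).re)
    (D := 3 * C * L) ?_ ?_ ?_ (fun t => ((((h.us t).gradsq).cmul (1/2)).add ((h.us t).norm_four.cmul (1/4))).integrable) ?_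
  · exact (continuous_const.mul (continuous_finsetSum _ fun j _ => (h.sm.dd j).continuous.norm.pow 2)).add 
      (continuous_const.mul (h.sm.continuous.norm.pow 4))
  · refine (continuous_finsetSum _ fun j _ => Complex.continuous_re.comp ((Complex.continuous_conj.comp (h.sm.dd j).continuous).mul (h.sm.dt.dd j).continuous)).add ?_
    exact (h.sm.continuous.norm.pow 2).mul (Complex.continuous_re.comp ((Complex.continuous_conj.comp h.sm.continuous).mul h.sm.dt.continuous))
  · intro t x
    have hj : ∀ j, HasDerivAt (fun s => ‖dd j (u s) x‖ ^ 2) (2 * ((starRingEnd ℂ) (dd j (u t) x) * dd j (dt u t) x).re) t := by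
      intro j
      refine (h.sm.hasDerivAt_dd j t x).norm_sq.congr_deriv ?_
      rw [Complex.inner]; ring_nf
    have h4 := ((h.rho_deriv t x).pow 2)
    have := ((HasDerivAt.fun_sum fun j (_ : j ∈ Finset.univ) => hj j).const_mul (1/2)).add (h4.const_mul (1/4))
    refine (this.congr_deriv ?_).congr_of_eventuallyEq (Filter.Eventually.of_forall fun s => ?_)
    · rw [← Finset.mul_sum]; simp; ring
    · simp; ring
  · intro n s hs
    have hu := h.us s
    have hw := h.ws s
    have eqn : ∀ x, lap (u s) x = - I * dt u s x + u s x * u s x * (starRingEnd ℂ) (u s x) := fun x => by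
      rw [h.eq s (hab hs)]; linear_combination (lap (u s) x - u s x * u s x * (starRingEnd ℂ) (u s x)) * I_sq
    set X : E3 → ℂ := fun x => (cut n x : ℂ) with hX
    have hXs : Sch X := (cut_sch n).ofReal
    have e1 : ∀ j, ∫ x, (X x * (starRingEnd ℂ) (dd j (u s) x)) * dd j (dt u s) x = 
        - ∫ x, (dd j (cut n) x * (starRingEnd ℂ) (dd j (u s) x) + X x * (starRingEnd ℂ) (dd j (dd j (u s)) x)) * dt u s x := by
      intro j
      rw [ibpT (a := fun x => X x * (starRingEnd ℂ) (dd j (u s) x)) (hXs.mul (hu.dd j).conj).temp hw j]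
      congr 1; congr 1; ext x
      rw [dd_mul j (hXs.da x) ((hu.dd j).conj.da x), dd_conj j ((hu.dd j).da x), dd_ofReal j ((cut_sch n).da x)]
    have i1 : ∀ j, Integrable fun x => (X x * (starRingEnd ℂ) (dd j (u s) x)) * dd j (dt u s) x := fun j =>
      ((hXs.mul (hu.dd j).conj).mul (hw.dd j)).integrable
    have i2 : ∀ j, Integrable fun x => (dd j (cut n) x * (starRingEnd ℂ) (dd j (u s) x) + X x * (starRingEnd ℂ) (dd j (dd j (u s)) x)) * dt u s x := fun j =>
      (((((cut_sch n).dd j).ofReal.mul (hu.dd j).conj).add (hXs.mul ((hu.dd j).dd j).conj)).mul hw).integrable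
    have i1r : ∀ j, Integrable fun x => ((X x * (starRingEnd ℂ) (dd j (u s) x)) * dd j (dt u s) x).re := fun j => (i1 j).re
    have i2r : ∀ j, Integrable fun x => ((dd j (cut n) x * (starRingEnd ℂ) (dd j (u s) x) + X x * (starRingEnd ℂ) (dd j (dd j (u s)) x)) * dt u s x).re := fun j => (i2 j).re
    have i3 : Integrable fun x => cut n x * (‖u s x‖ ^ 2 * ((starRingEnd ℂ) (u s x) * dt u s x).re) :=
      ((cut_sch n).mul (hu.norm_sq.mul (hu.conj.mul hw).re)).integrable
    have i4 : ∀ j, Integrable fun x => dd j (cut n) x * ((starRingEnd ℂ) (dd j (u s) x) * dt u s x).re := fun j =>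
      (((cut_sch n).dd j).mul ((hu.dd j).conj.mul hw).re).integrable
    have e : ∫ x, cut n x * ((∑ j, ((starRingEnd ℂ) (dd j (u s) x) * dd j (dt u s) x).re) + ‖u s x‖ ^ 2 * ((starRingEnd ℂ) (u s x) * dt u s x).re)
        = - ∑ j, ∫ x, dd j (cut n) x * ((starRingEnd ℂ) (dd j (u s) x) * dt u s x).re := by
      have a1 : ∀ x, cut n x * ((∑ j, ((starRingEnd ℂ) (dd j (u s) x) * dd j (dt u s) x).re) + ‖u s x‖ ^ 2 * ((starRingEnd ℂ) (u s x) * dt u s x).re)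
          = (∑ j, ((X x * (starRingEnd ℂ) (dd j (u s) x)) * dd j (dt u s) x).re) + cut n x * (‖u s x‖ ^ 2 * ((starRingEnd ℂ) (u s x) * dt u s x).re) := by
        intro x
        rw [mul_add, Finset.mul_sum]
        congr 1
        refine Finset.sum_congr rfl fun j _ => ?_
        rw [hX, mul_assoc, Complex.re_ofReal_mul]
      simp only [a1]
      rw [integral_add (integrable_finsetSum _ fun j _ => i1r j) i3, integral_finsetSum _ fun j _ => i1r j]
      have a2 : ∀ j, ∫ x, ((X x * (starRingEnd ℂ) (dd j (u s) x)) * dd j (dt u s) x).re = 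
          - ∫ x, ((dd j (cut n) x * (starRingEnd ℂ) (dd j (u s) x) + X x * (starRingEnd ℂ) (dd j (dd j (u s)) x)) * dt u s x).re := by
        intro j
        have b1 := integral_re (i1 j)
        have b2 := integral_re (i2 j)
        simp only [RCLike.re_eq_complex_re] at b1 b2
        rw [b1, b2, e1 j, Complex.neg_re]
      simp only [a2]
      rw [Finset.sum_neg_distrib, ← integral_finsetSum _ fun j _ => i2r j, ← integral_finsetSum _ fun j _ => i4 j,
        neg_add_eq_sub, ← integral_sub i3 (integrable_finsetSum _ fun j _ => i2r j), ← integral_neg]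
      congr 1; ext x
      have b : ∀ j, ((dd j (cut n) x * (starRingEnd ℂ) (dd j (u s) x) + X x * (starRingEnd ℂ) (dd j (dd j (u s)) x)) * dt u s x).re
          = dd j (cut n) x * ((starRingEnd ℂ) (dd j (u s) x) * dt u s x).re + cut n x * ((starRingEnd ℂ) (dd j (dd j (u s)) x) * dt u s x).re := by
        intro j
        rw [add_mul, Complex.add_re, mul_assoc, Complex.re_ofReal_mul, mul_assoc, hX, Complex.re_ofReal_mul]
      simp only [RCLike.re_eq_complex_re, b, Finset.sum_add_distrib, ← Finset.mul_sum]
      rw [← Complex.re_sum, ← Finset.sum_mul, ← map_sum, ← lap_eq, eqn]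
      have hn : ‖u s x‖ ^ 2 = (u s x).re * (u s x).re + (u s x).im * (u s x).im := by
        rw [← Complex.normSq_eq_norm_sq, Complex.normSq_apply]
      rw [hn]
      simp only [map_add, map_mul, map_neg, Complex.conj_I, Complex.conj_conj, Complex.mul_re, Complex.mul_im, Complex.add_re, Complex.add_im, 
        Complex.neg_re, Complex.neg_im, Complex.conj_re, Complex.conj_im, Complex.I_re, Complex.I_im]
      ring
    rw [e, abs_neg]
    have hj : ∀ j, |∫ x, dd j (cut n) x * ((starRingEnd ℂ) (dd j (u s) x) * dt u s x).re| ≤ C / (n+1) * L := by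
      intro j
      refine (cutdd_bd ((h.us s).dd j) (h.ws s) n (fun x => (hC n j x).1) (fun x => ?_)).trans ?_
      · refine (Complex.abs_re_le_norm _).trans ?_
        rw [norm_mul, RCLike.norm_conj]
      refine mul_le_mul_of_nonneg_left ?_ (by positivity)
      calc l2 (dd j (u s)) * l2 (dt u s) ≤ √L * √L := 
            mul_le_mul ((l2_dd_le (h.us s) j).trans (Real.sqrt_le_sqrt (h2 s hs))) (Real.sqrt_le_sqrt (h1 s hs)) (l2_nonneg _) (Real.sqrt_nonneg _)
        _ = L := Real.mul_self_sqrt hL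
    calc |∑ j, ∫ x, dd j (cut n) x * ((starRingEnd ℂ) (dd j (u s) x) * dt u s x).re| ≤ ∑ j : Fin 3, C / (n+1) * L := by
          exact (Finset.abs_sum_le_sum_abs _ _).trans (Finset.sum_le_sum fun j _ => hj j)
      _ = _ := by simp; ring
end sol
end

section

theorem green {a w : E3 → ℂ} (ha : Sch a) (hw : Sch w) : ∫ x, a x * lap w x = ∫ x, lap a x * w x := by
  simp only [lap_eq, Finset.mul_sum, Finset.sum_mul]
  rw [integral_finsetSum _ fun j _ => (ha.mul ((hw.dd j).dd j)).integrable, integral_finsetSum _ fun j _ => (((ha.dd j).dd j).mul hw).integrable]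
  refine Finset.sum_congr rfl fun j _ => ?_
  rw [ibpT ha.temp (hw.dd j) j, ibpT (ha.dd j).temp hw j, neg_neg]

theorem lap_mul {a v : E3 → ℂ} (ha : Sch a) (hv : Sch v) (x : E3) : 
    lap (fun x => a x * v x) x = a x * lap v x + ((∑ j, 2 * dd j a x * dd j v x) + lap a x * v x) := by
  have e1 : ∀ j, dd j (fun x => a x * v x) = fun x => dd j a x * v x + a x * dd j v x := fun j => by
    ext y; exact dd_mul j (ha.da y) (hv.da y)
  have e2 : ∀ j, dd j (dd j (fun x => a x * v x)) x = dd j (dd j a) x * v x + 2 * dd j a x * dd j v x + a x * dd j (dd j v) x := by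
    intro j
    rw [e1, dd_add j (((ha.dd j).mul hv).da x) ((ha.mul (hv.dd j)).da x), dd_mul j ((ha.dd j).da x) (hv.da x), 
      dd_mul j (ha.da x) ((hv.dd j).da x)]
    ring
  simp only [lap_eq, e2, Finset.sum_add_distrib, Finset.mul_sum, Finset.sum_mul]
  ring

theorem lap_conj {v : E3 → ℂ} (hv : Sch v) (x : E3) : lap (fun x => (starRingEnd ℂ) (v x)) x = (starRingEnd ℂ) (lap v x) := by
  simp only [lap_eq, map_sum]
  refine Finset.sum_congr rfl fun j _ => ?_
  have : dd j (fun x => (starRingEnd ℂ) (v x)) = fun x => (starRingEnd ℂ) (dd j v x) := by ext y; exact dd_conj j (hv.da y)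
  rw [this, dd_conj j ((hv.dd j).da x)]

theorem duh_alg {χ v w N : E3 → ℂ} (hχ : Sch χ) (hv : Sch v) (hw : Sch w) (hN : Sch N) :
    ∫ x, χ x * ((starRingEnd ℂ) (I * lap v x) * w x + (starRingEnd ℂ) (v x) * (I * (lap w x - N x))) =
      I * (∫ x, ((∑ j, 2 * dd j χ x * (starRingEnd ℂ) (dd j v x)) + lap χ x * (starRingEnd ℂ) (v x)) * w x) 
        - I * ∫ x, χ x * ((starRingEnd ℂ) (v x) * N x) := by
  have h1 := green (hχ.mul hv.conj) hw
  have e1 : ∀ x, lap (fun x => χ x * (starRingEnd ℂ) (v x)) x * w x = χ x * (starRingEnd ℂ) (lap v x) * w x + 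
      ((∑ j, 2 * dd j χ x * (starRingEnd ℂ) (dd j v x)) + lap χ x * (starRingEnd ℂ) (v x)) * w x := by
    intro x
    rw [lap_mul hχ hv.conj, lap_conj hv, add_mul]
    congr 4; ext j; rw [dd_conj j (hv.da x)]
  simp only [e1] at h1
  have i1 : Integrable fun x => χ x * (starRingEnd ℂ) (lap v x) * w x := ((hχ.mul hv.lap.conj).mul hw).integrable
  have i2 : Integrable fun x => ((∑ j, 2 * dd j χ x * (starRingEnd ℂ) (dd j v x)) + lap χ x * (starRingEnd ℂ) (v x)) * w x :=
    (((Sch.sum _ fun j _ => (((hχ.dd j).cmul 2).mul (hv.dd j).conj)).add (hχ.lap.mul hv.conj)).mul hw).integrable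
  have i3 : Integrable fun x => χ x * (starRingEnd ℂ) (v x) * lap w x := ((hχ.mul hv.conj).mul hw.lap).integrable
  have i4 : Integrable fun x => χ x * ((starRingEnd ℂ) (v x) * N x) := (hχ.mul (hv.conj.mul hN)).integrable
  rw [integral_add i1 i2] at h1
  have e2 : ∀ x, χ x * ((starRingEnd ℂ) (I * lap v x) * w x + (starRingEnd ℂ) (v x) * (I * (lap w x - N x))) =
      I * (χ x * (starRingEnd ℂ) (v x) * lap w x - χ x * (starRingEnd ℂ) (lap v x) * w x) - I * (χ x * ((starRingEnd ℂ) (v x) * N x)) := by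
    intro x; rw [map_mul, Complex.conj_I]; ring
  simp only [e2]
  have i5 : Integrable fun x => I * (χ x * (starRingEnd ℂ) (v x) * lap w x - χ x * (starRingEnd ℂ) (lap v x) * w x) := (i3.sub i1).const_mul I
  rw [integral_sub i5 (i4.const_mul I), integral_const_mul, integral_const_mul, integral_sub i3 i1, h1]
  ring

theorem duh_flux {C : ℝ} (n : ℕ) (hC : ∀ (j : Fin 3) (x : E3), |dd j (cut n) x| ≤ C / (n+1) ∧ |dd j (dd j (cut n)) x| ≤ C / (n+1))
    {v w : E3 → ℂ} (hv : Sch v) (hw : Sch w) :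
    ‖∫ x, ((∑ j, 2 * dd j (fun x => (cut n x : ℂ)) x * (starRingEnd ℂ) (dd j v x)) + lap (fun x => (cut n x : ℂ)) x * (starRingEnd ℂ) (v x)) * w x‖ 
      ≤ C / (n+1) * ((6 * √(gs v) + 3 * l2 v) * l2 w) := by
  have h0 : 0 ≤ C / ((n:ℝ)+1) := (abs_nonneg _).trans (hC 0 0).1
  have e1 : ∀ j, dd j (fun x => (cut n x : ℂ)) = fun x => ((dd j (cut n) x : ℝ) : ℂ) := fun j => by
    ext x; exact dd_ofReal j ((cut_sch n).da x)
  have e2 : ∀ j x, dd j (dd j (fun x => (cut n x : ℂ))) x = ((dd j (dd j (cut n)) x : ℝ) : ℂ) := fun j x => by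
    rw [e1]; exact dd_ofReal j (((cut_sch n).dd j).da x)
  have hI : Integrable fun x => ∑ j, (2 * (‖dd j v x‖ * ‖w x‖) + ‖v x‖ * ‖w x‖) := 
    integrable_finsetSum _ fun j _ => (((hv.dd j).mulNorm hw).const_mul 2).add (hv.mulNorm hw)
  calc _ ≤ ∫ x, C / (n+1) * ∑ j, (2 * (‖dd j v x‖ * ‖w x‖) + ‖v x‖ * ‖w x‖) := by
        refine norm_integral_le_of_norm_le (hI.const_mul _) (ae_of_all _ fun x => ?_)
        rw [norm_mul, lap_eq, Finset.sum_mul, ← Finset.sum_add_distrib, Finset.mul_sum]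
        refine (mul_le_mul_of_nonneg_right (norm_sum_le _ _) (norm_nonneg _)).trans ?_
        rw [Finset.sum_mul]
        refine Finset.sum_le_sum fun j _ => ?_
        rw [e2, e1]
        refine (mul_le_mul_of_nonneg_right (norm_add_le _ _) (norm_nonneg _)).trans ?_
        simp only [norm_mul, RCLike.norm_conj, Complex.norm_real, Complex.norm_ofNat, Real.norm_eq_abs]
        have := mul_le_mul_of_nonneg_right (hC j x).1 (mul_nonneg (norm_nonneg (dd j v x)) (norm_nonneg (w x)))
        have := mul_le_mul_of_nonneg_right (hC j x).2 (mul_nonneg (norm_nonneg (v x)) (norm_nonneg (w x)))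
        linarith
    _ ≤ _ := by
        rw [integral_const_mul]
        refine mul_le_mul_of_nonneg_left ?_ h0
        have i6 : ∀ j, Integrable fun x => 2 * (‖dd j v x‖ * ‖w x‖) + ‖v x‖ * ‖w x‖ := fun j =>
          (((hv.dd j).mulNorm hw).const_mul 2).add (hv.mulNorm hw)
        rw [integral_finsetSum _ fun j _ => i6 j]
        calc _ ≤ ∑ j : Fin 3, (2 * (√(gs v) * l2 w) + l2 v * l2 w) := by
              refine Finset.sum_le_sum fun j _ => ?_
              have i1 : Integrable fun x => 2 * (‖dd j v x‖ * ‖w x‖) := ((hv.dd j).mulNorm hw).const_mul 2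
              rw [integral_add i1 (hv.mulNorm hw), integral_const_mul]
              have a1 := cs_sch (hv.dd j) hw
              have a2 := cs_sch hv hw
              have a3 := mul_le_mul_of_nonneg_right (l2_dd_le hv j) (l2_nonneg w)
              linarith
          _ = _ := by simp; ring

section sol
variable {T : ℝ} {u : ℝ → E3 → ℂ}


theorem Sol.duh_deriv (h : Sol T u) (g : SchwartzMap E3 ℂ) (θ : ℝ) (n : ℕ) (s : ℝ) :
    HasDerivAt (fun s => ∫ x, (cut n x : ℂ) * ((starRingEnd ℂ) (Sf (s - θ) g x) * dt u s x))
      (∫ x, (cut n x : ℂ) * ((starRingEnd ℂ) (I * lap (Sf (s - θ) g) x) * dt u s x + (starRingEnd ℂ) (Sf (s - θ) g x) * dt (dt u) s x)) s := by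
  have hsc : Continuous fun p : ℝ × E3 => (p.1 - θ, p.2) := (continuous_fst.sub continuous_const).prodMk continuous_snd
  have c0 : Continuous fun p : ℝ × E3 => Sf (p.1 - θ) g p.2 := by
    have := (Sf_cont g).comp hsc
    simpa only [Function.comp_def] using this
  have c1 : Continuous fun p : ℝ × E3 => lap (Sf (p.1 - θ) g) p.2 := by
    have := (Sf_lap_cont g).comp hsc
    simpa only [Function.comp_def] using this
  have cS : Continuous fun p : ℝ × E3 => (starRingEnd ℂ) (Sf (p.1 - θ) g p.2) :=
    Complex.continuous_conj.comp c0
  have cL : Continuous fun p : ℝ × E3 => (starRingEnd ℂ) (I * lap (Sf (p.1 - θ) g) p.2) :=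
    Complex.continuous_conj.comp (continuous_const.mul c1)
  have cC : Continuous fun p : ℝ × E3 => (cut n p.2 : ℂ) := 
    Complex.continuous_ofReal.comp ((cut_smooth n).continuous.comp continuous_snd)
  refine hasDerivAt_cpt (F := fun s x => (cut n x : ℂ) * ((starRingEnd ℂ) (Sf (s - θ) g x) * dt u s x))
      (F' := fun s x => (cut n x : ℂ) * ((starRingEnd ℂ) (I * lap (Sf (s - θ) g) x) * dt u s x + (starRingEnd ℂ) (Sf (s - θ) g x) * dt (dt u) s x)) (μ := volume)
      (cC.mul (cS.mul h.sm.dt.continuous)) (cC.mul ((cL.mul h.sm.dt.continuous).add (cS.mul h.sm.dt.dt.continuous)))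
      (fun t x => ?_) (isCompact_closedBall (0:E3) _) (fun t x hx => by rw [cut_supp n x hx, Complex.ofReal_zero, zero_mul]) s
  have h1 : HasDerivAt (fun s => Sf (s - θ) g x) (I * lap (Sf (t - θ) g) x) t := by
    have := (Sf_deriv (t - θ) g x).scomp t ((hasDerivAt_id t).sub_const θ)
    simpa [Function.comp_def] using this
  have h2 : HasDerivAt (fun s => (starRingEnd ℂ) (Sf (s - θ) g x)) ((starRingEnd ℂ) (I * lap (Sf (t - θ) g) x)) t :=
    (Complex.conjCLE : ℂ →L[ℝ] ℂ).hasFDerivAt.comp_hasDerivAt t h1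
  exact (h2.mul (h.sm.dt.hasDerivAt t x)).const_mul _

theorem nl_bound {u w v : E3 → ℂ} (hu : Sch u) (hw : Sch w) (hvs : Sch v) (n : ℕ) : 
    ‖∫ x, (cut n x : ℂ) * ((starRingEnd ℂ) (v x) * (2 * u x * (starRingEnd ℂ) (u x) * w x + u x * u x * (starRingEnd ℂ) (w x)))‖
        ≤ 3 * (√(∫ x, ‖u x‖ ^ 4) * (n4 w * n4 v)) := by
  have iI : Integrable fun x => ‖u x‖ ^ 2 * (‖w x‖ * ‖v x‖) := by
    obtain ⟨B, hB0, hB⟩ := hu.norm_sq.bdd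
    refine (((hw.mulNorm hvs).const_mul B)).mono' ((hu.continuous.norm.pow 2).mul (hw.continuous.norm.mul hvs.continuous.norm)).aestronglyMeasurable (ae_of_all _ fun x => ?_)
    rw [norm_mul, norm_mul, norm_norm, norm_norm]
    exact mul_le_mul_of_nonneg_right (hB x) (by positivity)
  calc _ ≤ ∫ x, 3 * (‖u x‖ ^ 2 * (‖w x‖ * ‖v x‖)) := by
        refine norm_integral_le_of_norm_le (iI.const_mul 3) (ae_of_all _ fun x => ?_)
        rw [norm_mul, norm_mul, Complex.norm_real, Real.norm_eq_abs, abs_of_nonneg (cut_nonneg _ _), RCLike.norm_conj]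
        have c1 : ‖2 * u x * (starRingEnd ℂ) (u x) * w x + u x * u x * (starRingEnd ℂ) (w x)‖ ≤ 3 * (‖u x‖ ^ 2 * ‖w x‖) := by
          refine (norm_add_le _ _).trans (le_of_eq ?_)
          simp only [norm_mul, RCLike.norm_conj, Complex.norm_ofNat]; ring
        calc _ ≤ 1 * (‖v x‖ * (3 * (‖u x‖ ^ 2 * ‖w x‖))) := by
              refine mul_le_mul (cut_le_one _ _) (mul_le_mul_of_nonneg_left c1 (norm_nonneg _)) (by positivity) (by norm_num)
          _ = _ := by ring
    _ ≤ _ := by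
        rw [integral_const_mul]
        exact mul_le_mul_of_nonneg_left (hol4 hu hw hvs) (by norm_num)

theorem Sol.duh_bd (h : Sol T u) {C : ℝ} (n : ℕ) (hC : ∀ (j : Fin 3) (x : E3), |dd j (cut n) x| ≤ C / (n+1) ∧ |dd j (dd j (cut n)) x| ≤ C / (n+1))
    (g : SchwartzMap E3 ℂ) (τ : ℝ) {s : ℝ} (hs : s ∈ Set.Ioo 0 T) :
    ‖∫ x, (cut n x : ℂ) * ((starRingEnd ℂ) (I * lap (Sf τ g) x) * dt u s x + (starRingEnd ℂ) (Sf τ g x) * dt (dt u) s x)‖ ≤ 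
     C / (n+1) * ((6 * √(gs g) + 3 * l2 g) * l2 (dt u s)) + 3 * (√(∫ x, ‖u s x‖ ^ 4) * (n4 (dt u s) * n4 (Sf τ g))) := by
  have hu := h.us s
  have hw := h.ws s
  have hvs : Sch (Sf τ g) := Sch.coe' _
  have hNs : Sch fun x => 2 * u s x * (starRingEnd ℂ) (u s x) * dt u s x + u s x * u s x * (starRingEnd ℂ) (dt u s x) :=
    (((hu.cmul 2).mul hu.conj).mul hw).add ((hu.mul hu).mul hw.conj)
  have e := duh_alg (cut_sch n).ofReal hvs hw hNs
  simp only [h.weq hs]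
  rw [e]
  refine (norm_sub_le _ _).trans ?_
  rw [norm_mul, norm_mul, Complex.norm_I, one_mul, one_mul]
  have b1 := duh_flux n hC hvs hw
  rw [Sf_gs] at b1
  have b1' : l2 (Sf τ g) = l2 g := by unfold l2; rw [Sf_l2]
  rw [b1'] at b1
  exact add_le_add b1 (nl_bound hu hw hvs n)

theorem Sol.duh_aux (h : Sol T u) {a b : ℝ} (hle : a ≤ b) (hab : Set.Icc a b ⊆ Set.Icc 0 T) {K A L q r : ℝ}
    (hK : ∀ s ∈ Set.Icc a b, ∫ x, ‖u s x‖ ^ 4 ≤ K) (hA : ∀ s ∈ Set.Icc a b, n4 (dt u s) ≤ A)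
    (hL : ∀ s ∈ Set.Icc a b, ∫ x, ‖dt u s x‖ ^ 2 ≤ L) (g : SchwartzMap E3 ℂ) (θ : ℝ) (hq : 0 ≤ q)
    (hv : ∀ s ∈ Set.Icc a b, s ≠ θ → n4 (Sf (s - θ) g) ≤ q * |s - θ| ^ (-3/4:ℝ) + r) :
    ‖(∫ x, (starRingEnd ℂ) (Sf (b - θ) g x) * dt u b x) - ∫ x, (starRingEnd ℂ) (Sf (a - θ) g x) * dt u a x‖ 
      ≤ 3 * √K * A * (q * (8 * |b - a| ^ (1/4:ℝ)) + r * |b - a|) := by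
  obtain ⟨C, hC0, hC⟩ := cut_bounds
  have hA0 : 0 ≤ A := (n4_nonneg _).trans (hA a (Set.left_mem_Icc.2 hle))
  obtain ⟨D, hD⟩ : ∃ D : ℝ, D = C * ((6 * √(gs g) + 3 * l2 g) * √L) := ⟨_, rfl⟩
  obtain ⟨F, hF⟩ : ∃ F : ℕ → ℝ → ℂ, F = fun n s => ∫ x, (cut n x : ℂ) * ((starRingEnd ℂ) (Sf (s - θ) g x) * dt u s x) := ⟨_, rfl⟩
  obtain ⟨F', hF'⟩ : ∃ F' : ℕ → ℝ → ℂ, F' = fun n s => ∫ x, (cut n x : ℂ) * ((starRingEnd ℂ) (I * lap (Sf (s - θ) g) x) * dt u s x + (starRingEnd ℂ) (Sf (s - θ) g x) * dt (dt u) s x) := ⟨_, rfl⟩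
  have hd : ∀ n s, HasDerivAt (F n) (F' n s) s := by rw [hF, hF']; exact h.duh_deriv g θ
  have key : ∀ n : ℕ, ‖F n b - F n a‖ ≤ (3 * √K * A * q) * (8 * (b - a) ^ (1/4:ℝ)) + (3 * √K * A * r + D / (n+1)) * (b - a) := by
    intro n
    refine ftc_bound (θ := θ) hle (by positivity) (fun s _ => (hd n s).continuousAt.continuousWithinAt) (fun s _ => hd n s) ?_
    intro s hs hne
    have hs' := Set.Ioo_subset_Icc_self hs
    have hs0 : s ∈ Set.Ioo (0:ℝ) T := ⟨(hab (Set.left_mem_Icc.2 hle)).1.trans_lt hs.1, hs.2.trans_le (hab (Set.right_mem_Icc.2 hle)).2⟩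
    have b0 := h.duh_bd n (hC n) g (s - θ) hs0
    have b1 : F' n s = ∫ x, (cut n x : ℂ) * ((starRingEnd ℂ) (I * lap (Sf (s - θ) g) x) * dt u s x + (starRingEnd ℂ) (Sf (s - θ) g x) * dt (dt u) s x) := by rw [hF']
    rw [← b1] at b0
    have b2 : C / (n+1) * ((6 * √(gs g) + 3 * l2 g) * l2 (dt u s)) ≤ D / (n+1) := by
      rw [hD, mul_div_right_comm]
      have l0 := l2_nonneg g
      have : l2 (dt u s) ≤ √L := Real.sqrt_le_sqrt (hL s hs')
      exact mul_le_mul_of_nonneg_left (mul_le_mul_of_nonneg_left this (by positivity)) (by positivity)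
    have b3 : √(∫ x, ‖u s x‖ ^ 4) * (n4 (dt u s) * n4 (Sf (s - θ) g)) ≤ √K * (A * (q * |s - θ| ^ (-3/4:ℝ) + r)) := 
      mul_le_mul (Real.sqrt_le_sqrt (hK s hs')) (mul_le_mul (hA s hs') (hv s hs' hne) (n4_nonneg _) hA0) 
              (mul_nonneg (n4_nonneg _) (n4_nonneg _)) (Real.sqrt_nonneg _)
    linarith
  have lim : ∀ s, Tendsto (fun n => F n s) atTop (nhds (∫ x, (starRingEnd ℂ) (Sf (s - θ) g x) * dt u s x)) := fun s => by
    have := cut_int_tendsto (((Sch.coe (Sf (s - θ) g)).conj.mul (h.ws s)).integrable)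
    simp only [Complex.real_smul] at this
    rw [hF]; exact this
  have l1 := ((lim b).sub (lim a)).norm
  have l2' := (((tendsto_cdiv D).const_add (3 * √K * A * r)).mul_const (b - a)).const_add ((3 * √K * A * q) * (8 * (b - a) ^ (1/4:ℝ)))
  refine (le_of_tendsto_of_tendsto' l1 l2' key).trans (le_of_eq ?_)
  rw [abs_of_nonneg (by linarith)]; ring

theorem Sol.duh (h : Sol T u) {a b : ℝ} (hab : Set.uIcc a b ⊆ Set.Icc 0 T) {K A L q r : ℝ}
    (hK : ∀ s ∈ Set.uIcc a b, ∫ x, ‖u s x‖ ^ 4 ≤ K) (hA : ∀ s ∈ Set.uIcc a b, n4 (dt u s) ≤ A)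
    (hL : ∀ s ∈ Set.uIcc a b, ∫ x, ‖dt u s x‖ ^ 2 ≤ L) (g : SchwartzMap E3 ℂ) (θ : ℝ) (hq : 0 ≤ q)
    (hv : ∀ s ∈ Set.uIcc a b, s ≠ θ → n4 (Sf (s - θ) g) ≤ q * |s - θ| ^ (-3/4:ℝ) + r) :
    ‖(∫ x, (starRingEnd ℂ) (Sf (b - θ) g x) * dt u b x) - ∫ x, (starRingEnd ℂ) (Sf (a - θ) g x) * dt u a x‖ 
      ≤ 3 * √K * A * (q * (8 * |b - a| ^ (1/4:ℝ)) + r * |b - a|) := by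
  rcases le_total a b with hle | hle
  · rw [Set.uIcc_of_le hle] at *
    exact h.duh_aux hle hab hK hA hL g θ hq hv
  · rw [Set.uIcc_of_ge hle] at *
    rw [norm_sub_rev, abs_sub_comm b a]
    exact h.duh_aux hle hab hK hA hL g θ hq hv
end sol
end

section

theorem baire_abs {T : ℝ} {G : ℝ → ℝ → Prop} (mono : ∀ N N' t, N ≤ N' → G N t → G N' t)
    (closed : ∀ N, IsClosed {t | t ∈ Set.Icc 0 T ∧ G N t}) (pt : ∀ t ∈ Set.Icc 0 T, ∃ N, G N t) (Φ : ℝ → ℝ)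
    (P : ∀ c ∈ Set.Icc 0 T, ∀ t ∈ Set.Icc 0 T, ∀ L N, (∀ s ∈ Set.uIcc c t, G L s) → G N c → G (Φ N) t) :
    ∃ L, ∀ t ∈ Set.Icc 0 T, G L t := by
  obtain ⟨X, hX⟩ : ∃ X : Set ℝ, X = {t | t ∈ Set.Icc 0 T ∧ ¬ ∃ δ > 0, ∃ L, ∀ s ∈ Set.Icc 0 T, |s - t| < δ → G L s} := ⟨_, rfl⟩
  have lemA : ∀ K : Set ℝ, IsCompact K → K ⊆ Set.Icc 0 T → (∀ s ∈ K, s ∉ X) → ∃ L, ∀ s ∈ K, G L s := by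
    intro K hK hKT hKX
    refine hK.induction_on (p := fun S => ∃ L, ∀ s ∈ S, G L s) ⟨0, by simp⟩ ?_ ?_ ?_
    · rintro S S' hS ⟨L, hL⟩
      exact ⟨L, fun s hs => hL s (hS hs)⟩
    · rintro S S' ⟨L, hL⟩ ⟨L', hL'⟩
      refine ⟨max L L', fun s hs => ?_⟩
      rcases hs with hs | hs
      · exact mono _ _ _ (le_max_left _ _) (hL s hs)
      · exact mono _ _ _ (le_max_right _ _) (hL' s hs)
    · intro x hx
      have := hKX x hx
      rw [hX] at this
      simp only [Set.mem_ofPred_eq, not_and, not_not] at this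
      obtain ⟨δ, hδ, L, hL⟩ := this (hKT hx)
      refine ⟨K ∩ Metric.ball x δ, ?_, L, fun s hs => hL s (hKT hs.1) (by simpa [Real.dist_eq] using hs.2)⟩
      exact inter_mem_nhdsWithin _ (Metric.ball_mem_nhds _ hδ)
  have lemB : ∀ a ∈ Set.Icc 0 T, ∀ t ∈ Set.Icc 0 T, (∀ s ∈ Set.uIcc a t, s ≠ a → s ∉ X) → ∀ N, G N a → G (Φ N) t := by
    intro a ha t ht hs N hN
    obtain ⟨M, hM⟩ := pt t ht
    have hsub : Set.uIcc a t ⊆ Set.Icc 0 T := Set.uIcc_subset_Icc ha ht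
    have key : ∀ s ∈ Set.uIcc a t, s ≠ a → G (Φ M) s := by
      intro s hs' hsa
      have h1 : ∀ r ∈ Set.uIcc s t, r ∈ Set.uIcc a t ∧ r ≠ a := by
        intro r hr
        refine ⟨Set.uIcc_subset_uIcc hs' Set.right_mem_uIcc hr, ?_⟩
        rintro rfl
        rw [Set.mem_uIcc] at hs' hr
        rcases hs' with h | h <;> rcases hr with h' | h' <;> exact hsa (by linarith)
      obtain ⟨L, hL⟩ := lemA (Set.uIcc s t) isCompact_uIcc (fun r hr => hsub (h1 r hr).1) 
        (fun r hr => hs r (h1 r hr).1 (h1 r hr).2)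
      exact P t ht s (hsub hs') L M (fun r hr => hL r (by rwa [Set.uIcc_comm])) hM
    refine P a ha t ht (max (Φ M) N) N (fun s hs' => ?_) hN
    by_cases hsa : s = a
    · subst hsa
      exact mono _ _ _ (le_max_right _ _) hN
    · exact mono _ _ _ (le_max_left _ _) (key s hs' hsa)
  rcases X.eq_empty_or_nonempty with h0 | h0
  · exact lemA _ isCompact_Icc subset_rfl (by simp [h0])
  exfalso
  have hXT : X ⊆ Set.Icc 0 T := by rw [hX]; exact fun t ht => ht.1
  have hXc : IsClosed X := by
    rw [← isOpen_compl_iff, Metric.isOpen_iff]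
    intro t ht
    by_cases htT : t ∈ Set.Icc 0 T
    · rw [hX] at ht
      simp only [Set.mem_compl_iff, Set.mem_ofPred_eq, not_and, not_not] at ht
      obtain ⟨δ, hδ, L, hL⟩ := ht htT
      refine ⟨δ/2, by positivity, fun s hs hsX => ?_⟩
      rw [hX] at hsX
      refine hsX.2 ⟨δ/2, by positivity, L, fun r hr hrs => hL r hr ?_⟩
      rw [Metric.mem_ball, Real.dist_eq] at hs
      rw [abs_lt] at *
      constructor <;> linarith [hs.1, hs.2]
    · obtain ⟨δ, hδ, h⟩ := Metric.isOpen_iff.1 (isClosed_Icc (a := (0:ℝ)) (b := T)).isOpen_compl t htT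
      exact ⟨δ, hδ, fun s hs hsX => h hs (hXT hsX)⟩
  have : CompleteSpace X := hXc.completeSpace_coe
  have : Nonempty X := h0.to_subtype
  obtain ⟨N, hN⟩ := nonempty_interior_of_iUnion_of_closed (X := X) (f := fun N : ℕ => {t : X | t.1 ∈ Set.Icc 0 T ∧ G N t.1})
    (fun N => (closed N).preimage continuous_subtype_val) (by
      ext t
      simp only [Set.mem_iUnion, Set.mem_ofPred_eq, Set.mem_univ, iff_true]
      obtain ⟨M, hM⟩ := pt t.1 (hXT t.2)
      obtain ⟨n, hn⟩ := exists_nat_ge M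
      exact ⟨n, hXT t.2, mono _ _ _ hn hM⟩)
  obtain ⟨t0, ht0⟩ := hN
  rw [mem_interior_iff_mem_nhds, Metric.mem_nhds_iff] at ht0
  obtain ⟨r, hr, hball⟩ := ht0
  have h1 : ∀ s ∈ X, |s - t0| < r → G N s := fun s hs hsr => (hball (show (⟨s, hs⟩ : X) ∈ Metric.ball t0 r from by
    rw [Metric.mem_ball, Subtype.dist_eq, Real.dist_eq]; exact hsr)).2
  have ht0X := t0.2
  have hX2 : ∀ t ∈ X, ¬ ∃ δ > 0, ∃ L, ∀ s ∈ Set.Icc 0 T, |s - t| < δ → G L s := by rw [hX]; exact fun t ht => ht.2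
  refine hX2 _ ht0X ⟨r, hr, Φ N, fun s hs hsr => ?_⟩
  obtain ⟨a, ha, hmin⟩ := (isCompact_uIcc (a := t0.1) (b := s)).inter_right hXc |>.exists_isMinOn (f := fun a => |a - s|)
    ⟨t0, Set.left_mem_uIcc, ht0X⟩ (by fun_prop)
  refine lemB a (hXT ha.2) s hs (fun s' hs' hne hX' => hne ?_) N (h1 a ha.2 ?_)
  · have h3 : s' ∈ Set.uIcc t0.1 s ∩ X := ⟨Set.uIcc_subset_uIcc ha.1 Set.right_mem_uIcc hs', hX'⟩
    have h4 := isMinOn_iff.1 hmin s' h3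
    rw [Set.mem_uIcc] at hs'
    rcases hs' with h | h
    · rw [abs_of_nonpos (by linarith), abs_of_nonpos (by linarith)] at h4; linarith
    · rw [abs_of_nonneg (by linarith), abs_of_nonneg (by linarith)] at h4; linarith
  · have := ha.1
    rw [Set.mem_uIcc] at this
    rw [abs_lt] at *
    constructor <;> rcases this with h | h <;> linarith [hsr.1, hsr.2]
end

section

def WB (w : E3 → ℂ) (A : ℝ) : Prop := ∀ (τ : ℝ) (h : SchwartzMap E3 ℂ), ‖∫ x, (starRingEnd ℂ) (Sf τ h x) * w x‖ ≤ A * Qh h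

theorem WB.mono {w : E3 → ℂ} {A A' : ℝ} (h : WB w A) (hA : A ≤ A') : WB w A' := fun τ g =>
  (h τ g).trans (mul_le_mul_of_nonneg_right hA (Qh_nonneg _))

theorem WB.n4_le {w : SchwartzMap E3 ℂ} {A : ℝ} (hA : 0 ≤ A) (h : WB w A) (τ : ℝ) : n4 (Sf τ w) ≤ A := by
  obtain ⟨g, hg⟩ : ∃ g, g = Sf τ w := ⟨_, rfl⟩
  have hgS : Sch (fun x => g x) := Sch.coe g
  obtain ⟨k, hk⟩ := (hgS.mul hgS).mul hgS.conj
  have h1 := h (-τ) k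
  rw [← Sf_adj, ← hg] at h1
  rw [← hg]
  have h2 : ∀ x, ‖k x‖ = ‖g x‖ ^ 3 := fun x => by rw [← hk, norm_mul, norm_mul, RCLike.norm_conj]; ring
  have h3 : ∫ x, (starRingEnd ℂ) (k x) * g x = ((∫ x, ‖g x‖ ^ 4 : ℝ) : ℂ) := by
    rw [← integral_complex_ofReal]
    refine integral_congr_ae (Eventually.of_forall fun x => ?_)
    simp only
    rw [← hk, map_mul, map_mul, Complex.conj_conj]
    have : (starRingEnd ℂ) (g x) * g x = ((‖g x‖^2 : ℝ) : ℂ) := by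
      rw [mul_comm, Complex.mul_conj, Complex.normSq_eq_norm_sq]
    calc _ = ((starRingEnd ℂ) (g x) * g x) * ((starRingEnd ℂ) (g x) * g x) := by ring
      _ = _ := by rw [this]; push_cast; ring
  have h4 : Qh k = n4 g ^ 3 := by
    have : ∀ x, ‖k x‖ ^ (4/3:ℝ) = ‖g x‖ ^ 4 := fun x => by
      rw [h2, ← Real.rpow_natCast, ← Real.rpow_mul (norm_nonneg _), ← Real.rpow_natCast]; norm_num
    unfold Qh
    simp_rw [this]
    rw [← n4_four]
    have e : (n4 g ^ 4) ^ 3 = ((n4 g ^ 3) ^ 2) ^ 2 := by ring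
    rw [e, Real.sqrt_sq (by positivity), Real.sqrt_sq (pow_nonneg (n4_nonneg _) _)]
  rw [h3, h4, ← n4_four, Complex.norm_real, Real.norm_eq_abs, abs_of_nonneg (pow_nonneg (n4_nonneg _) _)] at h1
  rcases (n4_nonneg g).eq_or_lt with h5 | h5
  · rw [← h5]; exact hA
  · have : n4 g ^ 3 * n4 g ≤ n4 g ^ 3 * A := by nlinarith
    exact le_of_mul_le_mul_left this (by positivity)

theorem WB.exists (w : SchwartzMap E3 ℂ) : ∃ A, WB w A := by
  obtain ⟨D, hD⟩ : ∃ D, D = ∫ ξ, ‖𝓕 w ξ‖ := ⟨_, rfl⟩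
  have hD0 : 0 ≤ D := hD ▸ integral_nonneg fun _ => norm_nonneg _
  refine ⟨√√(D ^ 2 * ∫ x, ‖w x‖ ^ 2), fun τ h => ?_⟩
  have e : ∫ x, (starRingEnd ℂ) (Sf τ h x) * w x = ∫ x, (starRingEnd ℂ) (h x) * Sf (-τ) w x := by
    rw [Sf_adj, neg_neg]
  rw [e]
  calc _ ≤ ∫ x, ‖h x‖ * ‖Sf (-τ) w x‖ := by
        refine (norm_integral_le_integral_norm _).trans_eq ?_
        simp
    _ ≤ Qh h * n4 (Sf (-τ) w) := holQ (Sch.coe' h) (Sch.coe' _)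
    _ ≤ Qh h * √√(D ^ 2 * ∫ x, ‖w x‖ ^ 2) := by
        refine mul_le_mul_of_nonneg_left ?_ (Qh_nonneg _)
        unfold n4
        refine Real.sqrt_le_sqrt (Real.sqrt_le_sqrt ?_)
        rw [← Sf_l2 (-τ) w, ← integral_const_mul]
        have hs : Sch (fun x => Sf (-τ) w x) := Sch.coe _
        refine integral_mono hs.norm_four.integrable (hs.norm_sq.integrable.const_mul _) fun x => ?_
        simp only
        have := Sf_sup (-τ) w x
        rw [← hD] at this
        have h2 : ‖Sf (-τ) w x‖ ^ 2 ≤ D ^ 2 := by gcongr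
        nlinarith [sq_nonneg ‖Sf (-τ) w x‖]
    _ = _ := mul_comm _ _

structure GB (u : ℝ → E3 → ℂ) (N t : ℝ) : Prop where
  a1 : ∫ x, ‖u t x‖ ^ 2 ≤ N
  a2 : gs (u t) ≤ N
  a3 : ∫ x, ‖u t x‖ ^ 4 ≤ N
  a4 : ∫ x, ‖dt u t x‖ ^ 2 ≤ N
  a5 : WB (dt u t) N

theorem GB.nonneg {u : ℝ → E3 → ℂ} {N t : ℝ} (h : GB u N t) : 0 ≤ N := 
  (integral_nonneg fun _ => by positivity).trans h.a1

theorem GB.mono {u : ℝ → E3 → ℂ} {N N' t : ℝ} (h : GB u N t) (hN : N ≤ N') : GB u N' t :=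
  ⟨h.a1.trans hN, h.a2.trans hN, h.a3.trans hN, h.a4.trans hN, h.a5.mono hN⟩

variable {T : ℝ} {u : ℝ → E3 → ℂ}

theorem Sol.wS (h : Sol T u) (t : ℝ) : ∃ w : SchwartzMap E3 ℂ, dt u t = w := by
  obtain ⟨w, hw⟩ := h.ws t
  exact ⟨w, funext hw⟩

theorem Sol.gb_pt (h : Sol T u) (t : ℝ) : ∃ N, GB u N t := by
  obtain ⟨w, hw⟩ := h.wS t
  obtain ⟨A, hA⟩ := WB.exists w
  rw [← hw] at hA
  refine ⟨max A (max (∫ x, ‖u t x‖ ^ 2) (max (gs (u t)) (max (∫ x, ‖u t x‖ ^ 4) (∫ x, ‖dt u t x‖ ^ 2)))), ?_, ?_, ?_, ?_, hA.mono (by simp)⟩ <;> simp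

theorem Sol.wb_n4 (h : Sol T u) {t A : ℝ} (hA : 0 ≤ A) (hw : WB (dt u t) A) : n4 (dt u t) ≤ A := by
  obtain ⟨w, e⟩ := h.wS t
  rw [e] at hw ⊢
  simpa [Sf_zero] using hw.n4_le hA 0

theorem fatou_closed {g : ℝ → E3 → ℝ} (hg : Continuous fun p : ℝ × E3 => g p.1 p.2) (h0 : ∀ t x, 0 ≤ g t x)
    (hi : ∀ t, Integrable (g t)) (N : ℝ) : IsClosed {t | ∫ x, g t x ≤ N} := by
  refine IsSeqClosed.isClosed fun s t hs ht => ?_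
  have hN : 0 ≤ N := (integral_nonneg (h0 (s 0))).trans (hs 0)
  have key : ∀ t, ENNReal.ofReal (∫ x, g t x) = ∫⁻ x, ENNReal.ofReal (g t x) := fun t =>
    ofReal_integral_eq_lintegral_ofReal (hi t) (Eventually.of_forall (h0 t))
  show ∫ x, g t x ≤ N
  rw [← ENNReal.ofReal_le_ofReal_iff hN, key]
  have hm : ∀ t, Continuous (g t) := fun t => hg.comp (by fun_prop : Continuous fun x : E3 => (t, x))
  have hx : ∀ x, Tendsto (fun n => ENNReal.ofReal (g (s n) x)) atTop (nhds (ENNReal.ofReal (g t x))) := fun x =>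
    ENNReal.tendsto_ofReal (((hg.comp (by fun_prop : Continuous fun t : ℝ => (t, x))).tendsto t).comp ht)
  calc ∫⁻ x, ENNReal.ofReal (g t x) = ∫⁻ x, liminf (fun n => ENNReal.ofReal (g (s n) x)) atTop :=
        lintegral_congr fun x => (hx x).liminf_eq.symm
    _ ≤ liminf (fun n => ∫⁻ x, ENNReal.ofReal (g (s n) x)) atTop := 
        lintegral_liminf_le fun n => ENNReal.measurable_ofReal.comp (hm _).measurable
    _ ≤ _ := by
        refine liminf_le_of_le (by isBoundedDefault) fun b hb => ?_
        obtain ⟨n, hn⟩ := hb.exists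
        refine hn.trans ?_
        rw [← key]
        exact ENNReal.ofReal_le_ofReal (hs n)
end

section
variable {T : ℝ} {u : ℝ → E3 → ℂ}

theorem continuous_cpt {X E : Type*} [TopologicalSpace X] [MeasurableSpace X] [OpensMeasurableSpace X] 
    [SecondCountableTopology X] [T2Space X]
    [NormedAddCommGroup E] [NormedSpace ℝ E] {μ : Measure X} [IsLocallyFiniteMeasure μ]
    {F : ℝ → X → E} (hF : Continuous fun p : ℝ × X => F p.1 p.2)
    {K : Set X} (hK : IsCompact K) (h0 : ∀ t, ∀ x ∉ K, F t x = 0) :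
    Continuous (fun s => ∫ x, F s x ∂μ) := by
  have : (fun s => ∫ x, F s x ∂μ) = fun s => ∫ x in K, F s x ∂μ := by
    ext s
    exact (setIntegral_eq_integral_of_forall_compl_eq_zero fun x hx => h0 s x hx).symm
  rw [this]
  exact continuous_parametric_integral_of_continuous hF hK

theorem cut_err {v : E3 → ℂ} (hv : Sch v) : Tendsto (fun n => l2 (fun x => v x - cut n x * v x)) atTop (nhds 0) := by
  have h1 := cut_int_tendsto hv.norm_sq.integrable
  have h2 : Tendsto (fun n => √((∫ x, ‖v x‖ ^ 2) - ∫ x, cut n x • ‖v x‖ ^ 2)) atTop (nhds 0) := by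
    have := (Real.continuous_sqrt.tendsto _).comp (tendsto_const_nhds.sub h1 : Tendsto (fun n => (∫ x, ‖v x‖ ^ 2) - ∫ x, cut n x • ‖v x‖ ^ 2) _ _)
    rw [sub_self, Real.sqrt_zero] at this
    exact this
  refine squeeze_zero (fun n => l2_nonneg _) (fun n => ?_) h2
  unfold l2
  refine Real.sqrt_le_sqrt ?_
  have hc : Sch (fun x => (cut n x : ℂ) * v x) := (cut_sch n).ofReal.mul hv
  have hi : Integrable (fun x => cut n x • ‖v x‖ ^ 2) := ((cut_sch n).mul hv.norm_sq).integrable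
  rw [← integral_sub hv.norm_sq.integrable hi]
  refine integral_mono (hv.sub hc).norm_sq.integrable (hv.norm_sq.integrable.sub hi) fun x => ?_
  simp only [smul_eq_mul]
  have e : v x - cut n x * v x = ((1 - cut n x : ℝ) : ℂ) * v x := by push_cast; ring
  rw [e, norm_mul, Complex.norm_real, Real.norm_eq_abs, abs_of_nonneg (by linarith [cut_le_one n x]), mul_pow]
  have h3 := cut_le_one n x
  have h4 := cut_nonneg n x
  have : (1 - cut n x) ^ 2 ≤ 1 - cut n x := by nlinarith
  nlinarith [sq_nonneg ‖v x‖]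

theorem Sol.wb_closed (h : Sol T u) (N : ℝ) : IsClosed {t | ∫ x, ‖dt u t x‖ ^ 2 ≤ N ∧ WB (dt u t) N} := by
  refine IsSeqClosed.isClosed fun s t hs ht => ?_
  have hN : 0 ≤ N := (integral_nonneg fun _ => by positivity).trans (hs 0).1
  have hc : IsClosed {t | ∫ x, ‖dt u t x‖ ^ 2 ≤ N} := 
    fatou_closed (g := fun t x => ‖dt u t x‖ ^ 2) (h.sm.dt.continuous.norm.pow 2) (fun _ _ => by positivity) (fun t => (h.ws t).norm_sq.integrable) N
  refine ⟨hc.isSeqClosed (fun n => (hs n).1) ht, fun τ g => ?_⟩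
  obtain ⟨v, hv⟩ : ∃ v : E3 → ℂ, v = fun x => Sf τ g x := ⟨_, rfl⟩
  have hvS : Sch v := hv ▸ Sch.coe _
  have e0 : ∀ t, ∫ x, (starRingEnd ℂ) (Sf τ g x) * dt u t x = ∫ x, (starRingEnd ℂ) (v x) * dt u t x := fun t => by rw [hv]
  rw [e0]
  have hi : ∀ t, Integrable (fun x => (starRingEnd ℂ) (v x) * dt u t x) := fun t => (hvS.conj.mul (h.ws t)).integrable
  have hci : ∀ m t, Integrable (fun x => cut m x • ((starRingEnd ℂ) (v x) * dt u t x)) := fun m t => 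
    (((cut_sch m).ofReal.mul (hvS.conj.mul (h.ws t))).congr fun x => by simp).integrable
  have hm : ∀ m, ‖∫ x, cut m x • ((starRingEnd ℂ) (v x) * dt u t x)‖ ≤ N * Qh g + l2 (fun x => v x - cut m x * v x) * √N := by
    intro m
    have hcont : Continuous fun t => ∫ x, cut m x • ((starRingEnd ℂ) (v x) * dt u t x) := by
      refine continuous_cpt (F := fun t x => cut m x • ((starRingEnd ℂ) (v x) * dt u t x)) ?_ (isCompact_closedBall _ _) (fun t x hx => by rw [cut_supp m x hx, zero_smul])
      have h1 := (cut_smooth m).continuous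
      have h2 := hvS.continuous
      have h3 := h.sm.dt.continuous
      exact (h1.comp continuous_snd).smul ((Complex.continuous_conj.comp (h2.comp continuous_snd)).mul h3)
    refine le_of_tendsto ((hcont.norm.tendsto t).comp ht) (Eventually.of_forall fun n => ?_)
    simp only [Function.comp_apply]
    have h1 := (hs n).2 τ g
    rw [e0] at h1
    have h2 : ‖(∫ x, (starRingEnd ℂ) (v x) * dt u (s n) x) - ∫ x, cut m x • ((starRingEnd ℂ) (v x) * dt u (s n) x)‖ ≤ 
        l2 (fun x => v x - cut m x * v x) * √N := by
      rw [← integral_sub (hi _) (hci _ _)]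
      have hcS : Sch (fun x => v x - cut m x * v x) := hvS.sub ((cut_sch m).ofReal.mul hvS)
      calc _ ≤ ∫ x, ‖v x - cut m x * v x‖ * ‖dt u (s n) x‖ := by
            refine (norm_integral_le_integral_norm _).trans_eq (integral_congr_ae (Eventually.of_forall fun x => ?_))
            simp only
            have e : (starRingEnd ℂ) (v x) * dt u (s n) x - cut m x • ((starRingEnd ℂ) (v x) * dt u (s n) x) = (starRingEnd ℂ) (v x - cut m x * v x) * dt u (s n) x := by
              simp only [map_sub, map_mul, Complex.conj_ofReal, Complex.real_smul]; ring
            rw [e, norm_mul, RCLike.norm_conj]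
        _ ≤ _ := cs_sch hcS (h.ws _)
        _ ≤ _ := mul_le_mul_of_nonneg_left (Real.sqrt_le_sqrt (hs n).1) (l2_nonneg _)
    calc _ = ‖(∫ x, (starRingEnd ℂ) (v x) * dt u (s n) x) - ((∫ x, (starRingEnd ℂ) (v x) * dt u (s n) x) - ∫ x, cut m x • ((starRingEnd ℂ) (v x) * dt u (s n) x))‖ := by congr 1; ring
      _ ≤ _ := norm_sub_le _ _
      _ ≤ _ := add_le_add h1 h2
  have l1 := (cut_int_tendsto (hi t)).norm
  have l2' : Tendsto (fun m => N * Qh g + l2 (fun x => v x - cut m x * v x) * √N) atTop (nhds (N * Qh g)) := by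
    simpa using ((cut_err hvS).mul_const (√N)).const_add (N * Qh g)
  exact le_of_tendsto_of_tendsto' l1 l2' hm

theorem Sol.gb_closed (h : Sol T u) (N : ℝ) : IsClosed {t | t ∈ Set.Icc 0 T ∧ GB u N t} := by
  have e : {t | t ∈ Set.Icc 0 T ∧ GB u N t} = Set.Icc 0 T ∩ ({t | ∫ x, ‖u t x‖ ^ 2 ≤ N} ∩ ({t | ∫ x, ∑ j, ‖dd j (u t) x‖ ^ 2 ≤ N} ∩ 
      ({t | ∫ x, ‖u t x‖ ^ 4 ≤ N} ∩ {t | ∫ x, ‖dt u t x‖ ^ 2 ≤ N ∧ WB (dt u t) N}))) := by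
    ext t
    constructor
    · rintro ⟨h0, h1, h2, h3, h4, h5⟩
      exact ⟨h0, h1, h2, h3, h4, h5⟩
    · rintro ⟨h0, h1, h2, h3, h4, h5⟩
      exact ⟨h0, h1, h2, h3, h4, h5⟩
  rw [e]
  refine isClosed_Icc.inter (IsClosed.inter ?_ (IsClosed.inter ?_ (IsClosed.inter ?_ (h.wb_closed N))))
  · exact fatou_closed (g := fun t x => ‖u t x‖ ^ 2) (h.sm.continuous.norm.pow 2) (fun _ _ => by positivity) (fun t => (h.us t).norm_sq.integrable) N
  · exact fatou_closed (g := fun t x => ∑ j, ‖dd j (u t) x‖ ^ 2) (continuous_finsetSum _ fun j _ => (h.sm.dd j).continuous.norm.pow 2) 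
      (fun _ _ => by positivity) (fun t => (h.us t).gradsq.integrable) N
  · exact fatou_closed (g := fun t x => ‖u t x‖ ^ 4) (h.sm.continuous.norm.pow 4) (fun _ _ => by positivity) (fun t => (h.us t).norm_four.integrable) N

/-- one short step -/
theorem Sol.wb_step (h : Sol T u) {a b K L N : ℝ} (hab : Set.uIcc a b ⊆ Set.Icc 0 T) (hL0 : 0 ≤ L) (hN : 0 ≤ N)
    (hK : ∀ s ∈ Set.uIcc a b, ∫ x, ‖u s x‖ ^ 4 ≤ K) (hL : ∀ s ∈ Set.uIcc a b, ∫ x, ‖dt u s x‖ ^ 2 ≤ L)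
    (hW : ∀ s ∈ Set.uIcc a b, WB (dt u s) L) (ha : WB (dt u a) N) (hd : 24 * √K * |b - a| ^ (1/4:ℝ) ≤ 1/2) :
    WB (dt u b) (2 * N) := by
  have key : ∀ k : ℕ, ∀ s ∈ Set.uIcc a b, WB (dt u s) (2 * N + L / 2 ^ k) := by
    intro k
    induction k with
    | zero => intro s hs; exact (hW s hs).mono (by simp; linarith)
    | succ k ih =>
      intro s hs τ g
      have hsub : Set.uIcc a s ⊆ Set.uIcc a b := Set.uIcc_subset_uIcc Set.left_mem_uIcc hs
      have hA0 : 0 ≤ 2 * N + L / 2 ^ k := by positivity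
      have h1 := h.duh (a := a) (b := s) (hsub.trans hab) (fun r hr => hK r (hsub hr)) 
        (fun r hr => h.wb_n4 hA0 (ih r (hsub hr))) (fun r hr => hL r (hsub hr)) g (s - τ) (q := Qh g) (r := 0) (Qh_nonneg _)
        (fun r hr hne => by rw [add_zero]; exact disp_n4 (sub_ne_zero.2 hne) g)
      rw [sub_sub_cancel] at h1
      have h2 := ha (a - (s - τ)) g
      have h3 : |s - a| ^ (1/4:ℝ) ≤ |b - a| ^ (1/4:ℝ) := by
        refine Real.rpow_le_rpow (abs_nonneg _) ?_ (by norm_num)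
        exact Set.abs_sub_left_of_mem_uIcc hs
      have h4 : 3 * √K * (2 * N + L / 2 ^ k) * (Qh g * (8 * |s - a| ^ (1/4:ℝ)) + 0 * |s - a|) ≤ (2 * N + L / 2 ^ k) * Qh g / 2 := by
        have hQ := Qh_nonneg g
        have : 24 * √K * |s - a| ^ (1/4:ℝ) ≤ 1/2 := (mul_le_mul_of_nonneg_left h3 (by positivity)).trans hd
        calc _ = ((2 * N + L / 2 ^ k) * Qh g) * (24 * √K * |s - a| ^ (1/4:ℝ)) := by ring
          _ ≤ ((2 * N + L / 2 ^ k) * Qh g) * (1/2) := mul_le_mul_of_nonneg_left this (by positivity)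
          _ = _ := by ring
      have h5 := norm_sub_norm_le (∫ x, (starRingEnd ℂ) (Sf τ g x) * dt u s x) (∫ x, (starRingEnd ℂ) (Sf (a - (s - τ)) g x) * dt u a x)
      calc _ ≤ N * Qh g + (2 * N + L / 2 ^ k) * Qh g / 2 := by linarith
        _ = _ := by rw [pow_succ]; field_simp; ring
  intro τ g
  have l : Tendsto (fun k : ℕ => (2 * N + L / 2 ^ k) * Qh g) atTop (nhds (2 * N * Qh g)) := by
    have h1 : Tendsto (fun k : ℕ => L * (1/2:ℝ) ^ k) atTop (nhds (L * 0)) := 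
      (tendsto_pow_atTop_nhds_zero_of_lt_one (by norm_num) (by norm_num)).const_mul L
    have h2 := (h1.const_add (2 * N)).mul_const (Qh g)
    rw [mul_zero, add_zero] at h2
    refine h2.congr fun k => ?_
    rw [one_div, inv_pow]; ring
  exact ge_of_tendsto l (Eventually.of_forall fun k => key k b Set.right_mem_uIcc τ g)
end

section
variable {T : ℝ} {u : ℝ → E3 → ℂ}

theorem Sol.wb_chain (h : Sol T u) {c t K L N : ℝ} (hab : Set.uIcc c t ⊆ Set.Icc 0 T) (hL0 : 0 ≤ L) (hN : 0 ≤ N)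
    (hK : ∀ s ∈ Set.uIcc c t, ∫ x, ‖u s x‖ ^ 4 ≤ K) (hL : ∀ s ∈ Set.uIcc c t, ∫ x, ‖dt u s x‖ ^ 2 ≤ L)
    (hW : ∀ s ∈ Set.uIcc c t, WB (dt u s) L) (hc : WB (dt u c) N) (m : ℕ) (hm : 0 < m) 
    (hd : 24 * √K * (T / m) ^ (1/4:ℝ) ≤ 1/2) :
    WB (dt u t) (2 ^ m * N) := by
  have hm' : (0:ℝ) < m := by exact_mod_cast hm
  have hmem : ∀ r : ℝ, 0 ≤ r → r ≤ 1 → c + (t - c) * r ∈ Set.uIcc c t := by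
    intro r h0 h1
    rw [Set.mem_uIcc]
    rcases le_total c t with h2 | h2
    · left; constructor <;> nlinarith
    · right; constructor <;> nlinarith
  have key : ∀ i : ℕ, i ≤ m → WB (dt u (c + (t - c) * (i / m))) (2 ^ i * N) := by
    intro i
    induction i with
    | zero => intro _; simpa using hc
    | succ i ih =>
      intro hi
      have h1 := ih (by omega)
      have hi' : ((i:ℝ) + 1) ≤ m := by exact_mod_cast hi
      have m1 := hmem (i / m) (by positivity) ((div_le_one hm').2 (by linarith))
      have m2 := hmem ((i + 1 : ℕ) / m) (by positivity) ((div_le_one hm').2 (by push_cast; linarith))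
      have hsub := Set.uIcc_subset_uIcc m1 m2
      have := h.wb_step (a := c + (t - c) * (i / m)) (b := c + (t - c) * ((i + 1 : ℕ) / m)) (hsub.trans hab) hL0 (by positivity)
        (fun s hs => hK s (hsub hs)) (fun s hs => hL s (hsub hs)) (fun s hs => hW s (hsub hs)) h1 ?_
      · refine this.mono ?_
        rw [pow_succ]; linarith
      · refine le_trans ?_ hd
        gcongr
        have e : c + (t - c) * ((i + 1 : ℕ) / m) - (c + (t - c) * (i / m)) = (t - c) / m := by push_cast; field_simp; ring
        rw [e, abs_div, abs_of_pos hm']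
        gcongr
        have hc' := hab Set.left_mem_uIcc
        have ht' := hab Set.right_mem_uIcc
        rw [abs_le]
        constructor <;> linarith [hc'.1, hc'.2, ht'.1, ht'.2]
  have := key m le_rfl
  rwa [div_self hm'.ne', mul_one, add_sub_cancel] at this

theorem exists_steps (T K : ℝ) : ∃ m : ℕ, 0 < m ∧ 24 * √K * (T / m) ^ (1/4:ℝ) ≤ 1/2 := by
  have h1 : Tendsto (fun m : ℕ => T / (m:ℝ)) atTop (nhds 0) := tendsto_const_div_atTop_nhds_zero_nat T
  have h2 : Tendsto (fun m : ℕ => 24 * √K * (T / (m:ℝ)) ^ (1/4:ℝ)) atTop (nhds (24 * √K * (0:ℝ) ^ (1/4:ℝ))) := 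
    (((Real.continuousAt_rpow_const 0 (1/4) (Or.inr (by norm_num))).tendsto.comp h1)).const_mul _
  rw [Real.zero_rpow (by norm_num), mul_zero] at h2
  have h3 := (h2.eventually (Iio_mem_nhds (by norm_num : (0:ℝ) < 1/2))).and (eventually_gt_atTop 0)
  obtain ⟨m, hm, hm'⟩ := h3.exists
  exact ⟨m, hm', le_of_lt hm⟩

theorem Sol.gb_prop (h : Sol T u) (N : ℝ) : ∃ N', ∀ c ∈ Set.Icc 0 T, ∀ t ∈ Set.Icc 0 T, ∀ L, 
    (∀ s ∈ Set.uIcc c t, GB u L s) → GB u N c → GB u N' t := by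
  obtain ⟨m, hm, hd⟩ := exists_steps T (3 * N)
  obtain ⟨A, hA⟩ : ∃ A, A = 2 ^ m * N := ⟨_, rfl⟩
  refine ⟨max (max (3 * N) A) (N + 6 * √(3 * N) * A ^ 2 * T), fun c hc t ht L hL hN => ?_⟩
  have hN0 := hN.nonneg
  have hL0 : 0 ≤ L := (hL c Set.left_mem_uIcc).nonneg
  have hT : 0 ≤ T := hc.1.trans hc.2
  have hA0 : 0 ≤ A := by rw [hA]; positivity
  have hab : Set.uIcc c t ⊆ Set.Icc 0 T := Set.uIcc_subset_Icc hc ht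
  have hsub : ∀ s ∈ Set.uIcc c t, Set.uIcc c s ⊆ Set.uIcc c t := fun s hs => Set.uIcc_subset_uIcc Set.left_mem_uIcc hs
  have hen : ∀ s ∈ Set.uIcc c t, gs (u s) ≤ 3 * N ∧ ∫ x, ‖u s x‖ ^ 4 ≤ 3 * N := by
    intro s hs
    have h1 := h.energy (a := c) (b := s) ((hsub s hs).trans hab) (fun r hr => (hL r (hsub s hs hr)).a4) (fun r hr => (hL r (hsub s hs hr)).a2)
    have h2 : ∀ r, ∫ x, (1/2 * (∑ j, ‖dd j (u r) x‖ ^ 2) + 1/4 * ‖u r x‖ ^ 4) = 1/2 * gs (u r) + 1/4 * ∫ x, ‖u r x‖ ^ 4 := by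
      intro r
      rw [integral_add ((h.us r).gradsq.integrable.const_mul _) ((h.us r).norm_four.integrable.const_mul _), integral_const_mul, integral_const_mul, gs]
    rw [h2, h2] at h1
    have h3 := gs_nonneg (u s)
    have h4 : 0 ≤ ∫ x, ‖u s x‖ ^ 4 := integral_nonneg fun _ => by positivity
    have h5 := hN.a2
    have h6 := hN.a3
    constructor <;> linarith
  have hW : ∀ s ∈ Set.uIcc c t, WB (dt u s) A := by
    intro s hs
    rw [hA]
    exact h.wb_chain ((hsub s hs).trans hab) hL0 hN0 (fun r hr => (hen r (hsub s hs hr)).2) (fun r hr => (hL r (hsub s hs hr)).a4)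
      (fun r hr => (hL r (hsub s hs hr)).a5) hN.a5 m hm hd
  have h3N : 3 * N ≤ max (max (3 * N) A) (N + 6 * √(3 * N) * A ^ 2 * T) := (le_max_left _ _).trans (le_max_left _ _)
  refine ⟨?_, ?_, ?_, ?_, ?_⟩
  · rw [h.mass hab (fun s hs => (hL s hs).a1) (fun s hs => (hL s hs).a2)]
    refine hN.a1.trans (le_trans (by linarith) h3N)
  · exact (hen t Set.right_mem_uIcc).1.trans h3N
  · exact (hen t Set.right_mem_uIcc).2.trans h3N
  · refine le_trans ?_ (le_max_right _ _)
    obtain ⟨w, hw⟩ := h.wS t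
    have hWt := hW t Set.right_mem_uIcc
    rw [hw] at hWt
    have h1 := h.duh hab (fun s hs => (hen s hs).2) (fun s hs => h.wb_n4 hA0 (hW s hs)) (fun s hs => (hL s hs).a4) w t (q := 0) (r := A) le_rfl
      (fun s hs _ => by rw [zero_mul, zero_add]; exact hWt.n4_le hA0 _)
    rw [sub_self, Sf_zero, zero_mul, zero_add] at h1
    have e : ∫ x, (starRingEnd ℂ) (w x) * dt u t x = ((∫ x, ‖dt u t x‖ ^ 2 : ℝ) : ℂ) := by
      rw [← integral_complex_ofReal, hw]
      refine integral_congr_ae (Eventually.of_forall fun x => ?_)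
      simp only
      rw [mul_comm, Complex.mul_conj, Complex.normSq_eq_norm_sq]
    obtain ⟨y, hy⟩ : ∃ y, y = l2 (dt u t) := ⟨_, rfl⟩
    have hy0 : 0 ≤ y := hy ▸ l2_nonneg _
    have h2 : ‖∫ x, (starRingEnd ℂ) (Sf (c - t) w x) * dt u c x‖ ≤ y * √N := by
      calc _ ≤ ∫ x, ‖Sf (c - t) w x‖ * ‖dt u c x‖ := by
            refine (norm_integral_le_integral_norm _).trans_eq ?_
            simp
        _ ≤ l2 (Sf (c - t) w) * l2 (dt u c) := cs_sch (Sch.coe' _) (h.ws _)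
        _ ≤ _ := by
            have : l2 (Sf (c - t) w) = y := by rw [l2, Sf_l2, hy, hw, l2]
            rw [this]
            exact mul_le_mul_of_nonneg_left (Real.sqrt_le_sqrt hN.a4) hy0
    have h3 := norm_sub_norm_le (∫ x, (starRingEnd ℂ) (w x) * dt u t x) (∫ x, (starRingEnd ℂ) (Sf (c - t) w x) * dt u c x)
    rw [e, Complex.norm_real, Real.norm_eq_abs, ← l2_sq, ← hy, abs_of_nonneg (sq_nonneg _)] at h3
    rw [e, ← l2_sq, ← hy] at h1
    rw [← l2_sq, ← hy]
    have h4 : |t - c| ≤ T := by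
      rw [abs_le]; constructor <;> linarith [hc.1, hc.2, ht.1, ht.2]
    have h5 : 3 * √(3 * N) * A * (A * |t - c|) ≤ 3 * √(3 * N) * A * (A * T) := by gcongr
    have h6 := Real.sq_sqrt hN0
    nlinarith [sq_nonneg (y - √N)]
  · exact (hW t Set.right_mem_uIcc).mono ((le_max_right _ _).trans (le_max_left _ _))

theorem Sol.unif (h : Sol T u) : ∃ L, ∀ t ∈ Set.Icc 0 T, GB u L t := by
  choose Φ hΦ using h.gb_prop
  exact baire_abs (G := GB u) (fun N N' t hN hG => hG.mono hN) h.gb_closed (fun t _ => h.gb_pt t) Φ 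
    (fun c hc t ht L N hL hN => hΦ N c hc t ht L hL hN)
end

section

theorem int_dd_zero {f : E3 → ℝ} (hf : Sch f) (k : Fin 3) : ∫ x, dd k f x = 0 := by
  have := ibpT (a := fun _ => (1:ℝ)) (Function.HasTemperateGrowth.const 1) hf k
  simpa [dd_const] using this

/-- real inner product of two complex functions -/
def rin (f g : E3 → ℂ) (x : E3) : ℝ := ((starRingEnd ℂ) (f x) * g x).re
theorem Sch.rin {f g : E3 → ℂ} (hf : Sch f) (hg : Sch g) : Sch (rin f g) := (hf.conj.mul hg).re
theorem dd_rin {f g : E3 → ℂ} (hf : Sch f) (hg : Sch g) (k : Fin 3) (x : E3) : 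
    dd k (rin f g) x = rin (dd k f) g x + rin f (dd k g) x := by
  have h1 := dd_re k ((hf.conj.mul hg).da x)
  refine (show dd k (rin f g) x = _ from h1).trans ?_
  rw [dd_mul k (hf.conj.da x) (hg.da x), dd_conj k (hf.da x), Complex.add_re, rin, rin]

theorem dd_brin {b : E3 → ℝ} (hb : b.HasTemperateGrowth) {f g : E3 → ℂ} (hf : Sch f) (hg : Sch g) (k : Fin 3) (x : E3) : 
    dd k (fun x => b x * rin f g x) x = dd k b x * rin f g x + b x * (rin (dd k f) g x + rin f (dd k g) x) := by
  rw [dd_mul k (hb.1.differentiable (by simp) x) ((hf.rin hg).da x), dd_rin hf hg]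

theorem slice {b : Fin 3 → E3 → ℝ} (hb : ∀ j, (b j).HasTemperateGrowth) {d : E3 → ℝ} (hd : d.HasTemperateGrowth)
    (hbd : ∀ x, d x = ∑ j, dd j (b j) x) {u w : E3 → ℂ} (hu : Sch u) (hw : Sch w)
    (he : ∀ x, w x = I * (lap u x - u x * u x * (starRingEnd ℂ) (u x))) :
    ∫ x, (2 * ∑ j, b j x * ((starRingEnd ℂ) (w x) * dd j u x).im - d x * ((starRingEnd ℂ) (u x) * w x).im)
     = ∫ x, (2 * (∑ j, ∑ k, dd k (b j) x * rin (dd k u) (dd j u) x) + 1/2 * (d x * ‖u x‖ ^ 4)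
        - 1/2 * ((∑ k, dd k (dd k d) x) * ‖u x‖ ^ 2)) := by
  obtain ⟨f1, hf1⟩ : ∃ f1 : Fin 3 → Fin 3 → E3 → ℝ, f1 = fun j k x => b j x * rin (dd k u) (dd j u) x := ⟨_, rfl⟩
  obtain ⟨f2, hf2⟩ : ∃ f1 : Fin 3 → Fin 3 → E3 → ℝ, f1 = fun j k x => b k x * rin (dd j u) (dd j u) x := ⟨_, rfl⟩
  obtain ⟨f3, hf3⟩ : ∃ f1 : Fin 3 → E3 → ℝ, f1 = fun k x => d x * rin u (dd k u) x := ⟨_, rfl⟩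
  obtain ⟨f4, hf4⟩ : ∃ f1 : Fin 3 → E3 → ℝ, f1 = fun k x => dd k d x * rin u u x := ⟨_, rfl⟩
  obtain ⟨f5, hf5⟩ : ∃ f1 : Fin 3 → E3 → ℝ, f1 = fun k x => b k x * rin (fun x => u x * u x) (fun x => u x * u x) x := ⟨_, rfl⟩
  have s1 : ∀ j k, Sch (f1 j k) := fun j k => by rw [hf1]; exact Sch.mulT (hb j) ((hu.dd k).rin (hu.dd j))
  have s2 : ∀ j k, Sch (f2 j k) := fun j k => by rw [hf2]; exact Sch.mulT (hb k) ((hu.dd j).rin (hu.dd j))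
  have s3 : ∀ k, Sch (f3 k) := fun k => by rw [hf3]; exact Sch.mulT hd (hu.rin (hu.dd k))
  have s4 : ∀ k, Sch (f4 k) := fun k => by rw [hf4]; exact Sch.mulT (temp_dd hd k) (hu.rin hu)
  have s5 : ∀ k, Sch (f5 k) := fun k => by rw [hf5]; exact Sch.mulT (hb k) ((hu.mul hu).rin (hu.mul hu))
  have z1 : ∀ j k, Sch (fun x => (-2) * dd k (f1 j k) x + dd k (f2 j k) x) := fun j k => (Sch.cmul _ ((s1 j k).dd k)).add ((s2 j k).dd k)
  have z2 : ∀ k, Sch (fun x => (1/2) * dd k (f4 k) x + (1/2) * dd k (f5 k) x - dd k (f3 k) x) := fun k => 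
    ((Sch.cmul _ ((s4 k).dd k)).add (Sch.cmul _ ((s5 k).dd k))).sub ((s3 k).dd k)
  have z1S : Sch (fun x => ∑ j, ∑ k, ((-2) * dd k (f1 j k) x + dd k (f2 j k) x)) := Sch.sum _ fun j _ => Sch.sum _ fun k _ => z1 j k
  have z2S : Sch (fun x => ∑ k, ((1/2) * dd k (f4 k) x + (1/2) * dd k (f5 k) x - dd k (f3 k) x)) := Sch.sum _ fun k _ => z2 k
  have i1 : ∫ x, ∑ j, ∑ k, ((-2) * dd k (f1 j k) x + dd k (f2 j k) x) = 0 := by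
    rw [integral_finsetSum _ fun j _ => (Sch.sum _ fun k _ => z1 j k).integrable]
    refine Finset.sum_eq_zero fun j _ => ?_
    rw [integral_finsetSum _ fun k _ => (z1 j k).integrable]
    refine Finset.sum_eq_zero fun k _ => ?_
    rw [integral_add (((s1 j k).dd k).integrable.const_mul _) ((s2 j k).dd k).integrable, integral_const_mul, int_dd_zero (s1 j k), int_dd_zero (s2 j k)]
    simp
  have i2 : ∫ x, ∑ k, ((1/2) * dd k (f4 k) x + (1/2) * dd k (f5 k) x - dd k (f3 k) x) = 0 := by
    rw [integral_finsetSum _ fun k _ => (z2 k).integrable]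
    refine Finset.sum_eq_zero fun k _ => ?_
    rw [integral_sub ((Sch.cmul _ ((s4 k).dd k)).add (Sch.cmul _ ((s5 k).dd k))).integrable ((s3 k).dd k).integrable,
      integral_add (((s4 k).dd k).integrable.const_mul _) (((s5 k).dd k).integrable.const_mul _), integral_const_mul, integral_const_mul, int_dd_zero (s3 k), int_dd_zero (s4 k), int_dd_zero (s5 k)]
    simp
  have hR : Sch (fun x => 2 * (∑ j, ∑ k, dd k (b j) x * rin (dd k u) (dd j u) x) + 1/2 * (d x * ‖u x‖ ^ 4)
        - 1/2 * ((∑ k, dd k (dd k d) x) * ‖u x‖ ^ 2)) := by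
    refine ((Sch.cmul _ (Sch.sum _ fun j _ => Sch.sum _ fun k _ => Sch.mulT (temp_dd (hb j) k) ((hu.dd k).rin (hu.dd j)))).add 
      (Sch.cmul _ (Sch.mulT hd hu.norm_four))).sub (Sch.cmul _ ?_)
    refine (Sch.sum Finset.univ fun k _ => Sch.mulT (temp_dd (temp_dd hd k) k) hu.norm_sq).congr fun x => ?_
    rw [Finset.sum_mul]
  rw [← add_zero (∫ x, (2 * (∑ j, ∑ k, dd k (b j) x * rin (dd k u) (dd j u) x) + 1/2 * (d x * ‖u x‖ ^ 4)
        - 1/2 * ((∑ k, dd k (dd k d) x) * ‖u x‖ ^ 2))), ← i1, ← integral_add hR.integrable z1S.integrable]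
  rw [← add_zero (∫ x, (_ + _)), ← i2, ← integral_add (hR.add z1S).integrable z2S.integrable]
  refine integral_congr_ae (Eventually.of_forall fun x => ?_)
  simp only
  have hc : ∀ j k, dd j (dd k u) x = dd k (dd j u) x := fun j k => dd_comm (contDiff_infty.1 hu.contDiff 2) j k x
  have d1 : ∀ j k, dd k (f1 j k) x = dd k (b j) x * rin (dd k u) (dd j u) x + b j x * (rin (dd k (dd k u)) (dd j u) x + rin (dd k u) (dd k (dd j u)) x) :=
    fun j k => by rw [hf1]; exact dd_brin (hb j) (hu.dd k) (hu.dd j) k x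
  have d2 : ∀ j k, dd k (f2 j k) x = dd k (b k) x * rin (dd j u) (dd j u) x + b k x * (rin (dd k (dd j u)) (dd j u) x + rin (dd j u) (dd k (dd j u)) x) :=
    fun j k => by rw [hf2]; exact dd_brin (hb k) (hu.dd j) (hu.dd j) k x
  have d3 : ∀ k, dd k (f3 k) x = dd k d x * rin u (dd k u) x + d x * (rin (dd k u) (dd k u) x + rin u (dd k (dd k u)) x) :=
    fun k => by rw [hf3]; exact dd_brin hd hu (hu.dd k) k x
  have d4 : ∀ k, dd k (f4 k) x = dd k (dd k d) x * rin u u x + dd k d x * (rin (dd k u) u x + rin u (dd k u) x) :=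
    fun k => by rw [hf4]; exact dd_brin (temp_dd hd k) hu hu k x
  have du2 : ∀ k, dd k (fun x => u x * u x) x = dd k u x * u x + u x * dd k u x := fun k => dd_mul k (hu.da x) (hu.da x)
  have d5 : ∀ k, dd k (f5 k) x = dd k (b k) x * rin (fun x => u x * u x) (fun x => u x * u x) x + b k x * (rin (dd k (fun x => u x * u x)) (fun x => u x * u x) x + rin (fun x => u x * u x) (dd k (fun x => u x * u x)) x) :=
    fun k => by rw [hf5]; exact dd_brin (hb k) (hu.mul hu) (hu.mul hu) k x
  have n2 : ‖u x‖ ^ 2 = (u x).re ^ 2 + (u x).im ^ 2 := by rw [← Complex.normSq_eq_norm_sq, Complex.normSq_apply]; ring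
  have n4' : ‖u x‖ ^ 4 = ((u x).re ^ 2 + (u x).im ^ 2) ^ 2 := by rw [← n2]; ring
  simp only [d1, d2, d3, d4, d5, he, n2, n4', hbd, lap_eq, rin, du2]
  simp only [Fin.sum_univ_three]
  rw [hc 1 0, hc 2 0, hc 2 1]
  simp only [Complex.mul_re, Complex.mul_im, Complex.conj_re, Complex.conj_im, Complex.I_re, Complex.I_im, Complex.sub_re, Complex.sub_im, Complex.add_re, Complex.add_im]
  ring
end

section

theorem pw {H : Fin 3 → Fin 3 → ℝ} (hq : ∀ A : Fin 3 → ℝ, 0 ≤ ∑ j, ∑ k, H j k * (A j * A k)) (α β : ℂ) (V W : Fin 3 → ℂ) :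
    0 ≤ ∑ j, ∑ k, H j k * (‖β‖ ^ 2 * ((starRingEnd ℂ) (V k) * V j).re + ‖α‖ ^ 2 * ((starRingEnd ℂ) (W k) * W j).re
      - ((starRingEnd ℂ) α * V j).im * ((starRingEnd ℂ) β * W k).im - ((starRingEnd ℂ) β * W j).im * ((starRingEnd ℂ) α * V k).im) := by
  have h1 := hq fun j => (β * V j - α * W j).re
  have h2 := hq fun j => (β * V j - α * W j).im
  have h3 := hq fun j => ((starRingEnd ℂ) β * V j + α * (starRingEnd ℂ) (W j)).re
  have h4 := hq fun j => ((starRingEnd ℂ) β * V j + α * (starRingEnd ℂ) (W j)).im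
  have n2 : ∀ z : ℂ, ‖z‖ ^ 2 = z.re ^ 2 + z.im ^ 2 := fun z => by rw [← Complex.normSq_eq_norm_sq, Complex.normSq_apply]; ring
  have h5 := add_nonneg (add_nonneg h1 h2) (add_nonneg h3 h4)
  simp only [← Finset.sum_add_distrib] at h5
  have h6 := div_nonneg h5 (zero_le_two (α := ℝ))
  rw [Finset.sum_div] at h6
  simp only [Finset.sum_div] at h6
  refine h6.trans_eq (Finset.sum_congr rfl fun j _ => Finset.sum_congr rfl fun k _ => ?_)
  rw [n2, n2]
  simp only [Complex.mul_re, Complex.mul_im, Complex.conj_re, Complex.conj_im, Complex.sub_re, Complex.sub_im, Complex.add_re, Complex.add_im]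
  ring

/-- Hessian kernel -/
def Hk (ε : ℝ) (j k : Fin 3) (z : E3) : ℝ := dd k (bv ε j) z
theorem Hk_neg {ε : ℝ} (hε : 0 < ε) (j k : Fin 3) (z : E3) : Hk ε j k (-z) = Hk ε j k z := by
  have : kap ε (-z) = kap ε z := by simp [kap]
  rw [Hk, Hk, dd_bv hε, dd_bv hε, this]
  simp
theorem Hk_psd {ε : ℝ} (hε : 0 < ε) (z : E3) (A : Fin 3 → ℝ) : 0 ≤ ∑ j, ∑ k, Hk ε j k z * (A j * A k) := by
  have h1 := kap_sq hε z
  have h2 := kap_pos hε z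
  rw [nsq3] at h1
  simp only [Hk, dd_bv hε, Fin.sum_univ_three]
  simp
  have h3 : 0 ≤ 1 - kap ε z ^ 2 * (z 0 ^ 2 + z 1 ^ 2 + z 2 ^ 2) := by nlinarith [mul_nonneg (sq_nonneg ε) (sq_nonneg (kap ε z))]
  have h4 : 0 ≤ (z 0 ^ 2 + z 1 ^ 2 + z 2 ^ 2) * (A 0 ^ 2 + A 1 ^ 2 + A 2 ^ 2) - (z 0 * A 0 + z 1 * A 1 + z 2 * A 2) ^ 2 := by
    nlinarith [sq_nonneg (z 0 * A 1 - z 1 * A 0), sq_nonneg (z 0 * A 2 - z 2 * A 0), sq_nonneg (z 1 * A 2 - z 2 * A 1)]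
  have h5 := mul_nonneg h2.le (mul_nonneg h3 (by positivity : 0 ≤ A 0 ^ 2 + A 1 ^ 2 + A 2 ^ 2))
  have h6 := mul_nonneg (pow_nonneg h2.le 3) h4
  refine (add_nonneg h5 h6).trans_eq ?_
  ring

theorem coord_bd {ε : ℝ} (hε : 0 < ε) (j : Fin 3) (z : E3) : |z j * kap ε z| ≤ 1 := by
  have h := bv_sq_le hε z
  rw [← sq_le_one_iff_abs_le_one]
  refine le_trans ?_ h
  exact Finset.single_le_sum (f := fun j => bv ε j z ^ 2) (fun _ _ => sq_nonneg _) (Finset.mem_univ j)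
theorem bv_bd {ε : ℝ} (hε : 0 < ε) (j : Fin 3) (z : E3) : |bv ε j z| ≤ 1 := coord_bd hε j z
theorem Hk_bd {ε : ℝ} (hε : 0 < ε) (j k : Fin 3) (z : E3) : |Hk ε j k z| ≤ 2 * ε⁻¹ := by
  have h1 := kap_le hε z
  have h2 := kap_pos hε z
  rw [Hk, dd_bv hε]
  have h3 : |z j * z k * kap ε z ^ 3| ≤ ε⁻¹ := by
    have e : z j * z k * kap ε z ^ 3 = (z j * kap ε z) * (z k * kap ε z) * kap ε z := by ring
    rw [e, abs_mul, abs_mul, abs_of_pos h2]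
    have := mul_le_mul (coord_bd hε j z) (coord_bd hε k z) (abs_nonneg _) zero_le_one
    nlinarith
  refine (abs_sub _ _).trans ?_
  have h4 : |if k = j then kap ε z else 0| ≤ ε⁻¹ := by
    split_ifs
    · rwa [abs_of_pos h2]
    · simp; exact hε.le
  linarith
theorem dvb_bd {ε : ℝ} (hε : 0 < ε) (z : E3) : |dvb ε z| ≤ 3 * ε⁻¹ := by
  rw [abs_of_nonneg (dvb_nonneg hε z)]
  linarith [dvb_le hε z, kap_le hε z]
/-- the delta-like kernel -/
def dk (ε : ℝ) (z : E3) : ℝ := 15 * ε ^ 4 * kap ε z ^ 7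
theorem dk_nonneg {ε : ℝ} (hε : 0 < ε) (z : E3) : 0 ≤ dk ε z := by
  have := kap_pos hε z
  unfold dk; positivity
theorem dk_bd {ε : ℝ} (hε : 0 < ε) (z : E3) : |dk ε z| ≤ 15 * ε ^ 4 * ε⁻¹ ^ 7 := by
  rw [abs_of_nonneg (dk_nonneg hε z)]
  have h2 := kap_pos hε z
  have h1 := kap_le hε z
  unfold dk
  gcongr
theorem bv_cont {ε : ℝ} (hε : 0 < ε) (j : Fin 3) : Continuous (bv ε j) := (bv_temp hε j).1.continuous
theorem dvb_cont {ε : ℝ} (hε : 0 < ε) : Continuous (dvb ε) := (dvb_temp hε).1.continuous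
theorem Hk_temp {ε : ℝ} (hε : 0 < ε) (j k : Fin 3) : (Hk ε j k).HasTemperateGrowth := temp_dd (bv_temp hε j) k
theorem Hk_cont {ε : ℝ} (hε : 0 < ε) (j k : Fin 3) : Continuous (Hk ε j k) := (Hk_temp hε j k).1.continuous
theorem dk_cont {ε : ℝ} (hε : 0 < ε) : Continuous (dk ε) := continuous_const.mul ((kap_temp hε).1.continuous.pow 7)

/-- integrability on the product space -/
theorem kI {k : E3 × E3 → ℝ} (hk : Continuous k) {C : ℝ} (hC : ∀ z, |k z| ≤ C) {f g : E3 → ℝ} (hf : Integrable f) (hg : Integrable g) :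
    Integrable (fun z : E3 × E3 => k z * (f z.1 * g z.2)) := by
  have h := hf.mul_prod hg
  exact h.bdd_mul (c := C) hk.aestronglyMeasurable (Eventually.of_forall fun z => by rw [Real.norm_eq_abs]; exact hC z)
theorem kIs {k : E3 → ℝ} (hk : Continuous k) {C : ℝ} (hC : ∀ z, |k z| ≤ C) {f g : E3 → ℝ} (hf : Sch f) (hg : Sch g) :
    Integrable (fun z : E3 × E3 => k (z.1 - z.2) * (f z.1 * g z.2)) :=
  kI (k := fun z => k (z.1 - z.2)) (hk.comp (continuous_fst.sub continuous_snd)) (fun z => hC _) hf.integrable hg.integrable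
end

section

def rtf (u w : E3 → ℂ) (y : E3) : ℝ := 2 * ((starRingEnd ℂ) (u y) * w y).re
def mjf (u w : E3 → ℂ) (j : Fin 3) (x : E3) : ℝ := ((starRingEnd ℂ) (w x) * dd j u x).im
def cff (u w : E3 → ℂ) (x : E3) : ℝ := ((starRingEnd ℂ) (u x) * w x).im
theorem rtf_sch {u w : E3 → ℂ} (hu : Sch u) (hw : Sch w) : Sch (rtf u w) := Sch.cmul _ (hu.conj.mul hw).re
theorem mjf_sch {u w : E3 → ℂ} (hu : Sch u) (hw : Sch w) (j : Fin 3) : Sch (mjf u w j) := (hw.conj.mul (hu.dd j)).im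
theorem cff_sch {u w : E3 → ℂ} (hu : Sch u) (hw : Sch w) : Sch (cff u w) := (hu.conj.mul hw).im

def DI1 (ε : ℝ) (u w : E3 → ℂ) (z : E3 × E3) : ℝ := ∑ j, bv ε j (z.1 - z.2) * (pc j u z.1 * rtf u w z.2)
def DI2 (ε : ℝ) (u w : E3 → ℂ) (z : E3 × E3) : ℝ := 
  2 * (∑ j, bv ε j (z.1 - z.2) * (mjf u w j z.1 * ‖u z.2‖ ^ 2)) - dvb ε (z.1 - z.2) * (cff u w z.1 * ‖u z.2‖ ^ 2)
def DJ1 (ε : ℝ) (u : E3 → ℂ) (z : E3 × E3) : ℝ := ∑ j, ∑ k, Hk ε j k (z.1 - z.2) * (pc j u z.1 * pc k u z.2)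
def DJ2 (ε : ℝ) (u : E3 → ℂ) (z : E3 × E3) : ℝ := ∑ j, ∑ k, Hk ε j k (z.1 - z.2) * (rin (dd k u) (dd j u) z.1 * ‖u z.2‖ ^ 2)
def DJ3 (ε : ℝ) (u : E3 → ℂ) (z : E3 × E3) : ℝ := dvb ε (z.1 - z.2) * (‖u z.1‖ ^ 4 * ‖u z.2‖ ^ 2)
def DJ4 (ε : ℝ) (u : E3 → ℂ) (z : E3 × E3) : ℝ := dk ε (z.1 - z.2) * (‖u z.1‖ ^ 2 * ‖u z.2‖ ^ 2)

section
variable {ε : ℝ} (hε : 0 < ε) {u w : E3 → ℂ} (hu : Sch u) (hw : Sch w) 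

theorem DI1_int (hε : 0 < ε) (hu : Sch u) (hw : Sch w) : Integrable (DI1 ε u w) := 
  integrable_finsetSum _ fun j _ => kIs (bv_cont hε j) (bv_bd hε j) (hu.pc j) (rtf_sch hu hw)
theorem DI2_int (hε : 0 < ε) (hu : Sch u) (hw : Sch w) : Integrable (DI2 ε u w) := 
  ((integrable_finsetSum _ fun j _ => kIs (bv_cont hε j) (bv_bd hε j) (mjf_sch hu hw j) hu.norm_sq).const_mul 2).sub
    (kIs (dvb_cont hε) (dvb_bd hε) (cff_sch hu hw) hu.norm_sq)
theorem DJ1_int (hε : 0 < ε) (hu : Sch u) : Integrable (DJ1 ε u) := 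
  integrable_finsetSum _ fun j _ => integrable_finsetSum _ fun k _ => kIs (Hk_cont hε j k) (Hk_bd hε j k) (hu.pc j) (hu.pc k)
theorem DJ2_int (hε : 0 < ε) (hu : Sch u) : Integrable (DJ2 ε u) := 
  integrable_finsetSum _ fun j _ => integrable_finsetSum _ fun k _ => kIs (Hk_cont hε j k) (Hk_bd hε j k) ((hu.dd k).rin (hu.dd j)) hu.norm_sq
theorem DJ3_int (hε : 0 < ε) (hu : Sch u) : Integrable (DJ3 ε u) := kIs (dvb_cont hε) (dvb_bd hε) hu.norm_four hu.norm_sq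
theorem DJ4_int (hε : 0 < ε) (hu : Sch u) : Integrable (DJ4 ε u) := kIs (dk_cont hε) (dk_bd hε) hu.norm_sq hu.norm_sq

theorem DI1_eq (hε : 0 < ε) (hu : Sch u) (hw : Sch w) (hr : ∀ y, rtf u w y = -2 * ∑ k, dd k (pc k u) y) :
    ∫ z, DI1 ε u w z = ∫ z, (-2) * DJ1 ε u z := by
  have e1 : ∫ z, DI1 ε u w z = ∫ x, ∫ y, DI1 ε u w (x, y) := integral_prod _ (DI1_int hε hu hw)
  have e2 : ∫ z, (-2) * DJ1 ε u z = ∫ x, ∫ y, (-2) * DJ1 ε u (x, y) := integral_prod _ ((DJ1_int hε hu).const_mul (-2))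
  rw [e1, e2]
  refine integral_congr_ae (Eventually.of_forall fun x => ?_)
  simp only [DI1, DJ1]
  have hbt : ∀ j, (fun y => bv ε j (x - y)).HasTemperateGrowth := fun j => temp_sub' (bv_temp hε j) x
  have hHt : ∀ j k, (fun y => Hk ε j k (x - y)).HasTemperateGrowth := fun j k => temp_sub' (Hk_temp hε j k) x
  have key : ∀ j k, ∫ y, bv ε j (x - y) * dd k (pc k u) y = ∫ y, Hk ε j k (x - y) * pc k u y := by
    intro j k
    rw [ibpT (hbt j) (hu.pc k) k, ← integral_neg]
    refine integral_congr_ae (Eventually.of_forall fun y => ?_)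
    simp only
    rw [dd_comp_sub_left _ _ _ _ (bv_diff hε j _), Hk]; ring
  rw [integral_const_mul, integral_finsetSum _ fun j _ => (Sch.mulT (hbt j) (Sch.cmul _ (rtf_sch hu hw))).integrable,
    integral_finsetSum _ fun j _ => (Sch.sum _ fun k _ => Sch.mulT (hHt j k) (Sch.cmul _ (hu.pc k))).integrable, Finset.mul_sum]
  refine Finset.sum_congr rfl fun j _ => ?_
  rw [integral_finsetSum _ fun k _ => (Sch.mulT (hHt j k) (Sch.cmul _ (hu.pc k))).integrable]
  have a1 : ∀ y, bv ε j (x - y) * (pc j u x * rtf u w y) = (-2 * pc j u x) * ∑ k, bv ε j (x - y) * dd k (pc k u) y := by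
    intro y; rw [hr, ← Finset.mul_sum]; ring
  simp only [a1]
  rw [integral_const_mul, integral_finsetSum _ fun k _ => (Sch.mulT (hbt j) ((hu.pc k).dd k)).integrable, Finset.mul_sum, Finset.mul_sum]
  refine Finset.sum_congr rfl fun k _ => ?_
  have a2 : ∀ y, Hk ε j k (x - y) * (pc j u x * pc k u y) = pc j u x * (Hk ε j k (x - y) * pc k u y) := fun y => by ring
  simp only [a2]
  rw [integral_const_mul, key]; ring

theorem DI2_eq (hε : 0 < ε) (hu : Sch u) (hw : Sch w) (he : ∀ x, w x = I * (lap u x - u x * u x * (starRingEnd ℂ) (u x))) :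
    ∫ z, DI2 ε u w z = ∫ z, (2 * DJ2 ε u z + 1/2 * DJ3 ε u z + 1/2 * DJ4 ε u z) := by
  have hi : Integrable (fun z => 2 * DJ2 ε u z + 1/2 * DJ3 ε u z + 1/2 * DJ4 ε u z) := 
    (((DJ2_int hε hu).const_mul 2).add ((DJ3_int hε hu).const_mul _)).add ((DJ4_int hε hu).const_mul _)
  have e1 : ∫ z, DI2 ε u w z = ∫ y, ∫ x, DI2 ε u w (x, y) := integral_prod_symm _ (DI2_int hε hu hw)
  have e2 : ∫ z, (2 * DJ2 ε u z + 1/2 * DJ3 ε u z + 1/2 * DJ4 ε u z) = ∫ y, ∫ x, (2 * DJ2 ε u (x, y) + 1/2 * DJ3 ε u (x, y) + 1/2 * DJ4 ε u (x, y)) := 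
    integral_prod_symm _ hi
  rw [e1, e2]
  refine integral_congr_ae (Eventually.of_forall fun y => ?_)
  simp only
  have hs := slice (b := fun j x => bv ε j (x - y)) (d := fun x => dvb ε (x - y)) (fun j => temp_sub (bv_temp hε j) y) (temp_sub (dvb_temp hε) y)
    (fun x => by simp only [dd_sub_const]; exact (div_bv hε _).symm) hu hw he
  have a1 : ∀ x, DI2 ε u w (x, y) = ‖u y‖ ^ 2 * (2 * ∑ j, bv ε j (x - y) * ((starRingEnd ℂ) (w x) * dd j u x).im - dvb ε (x - y) * ((starRingEnd ℂ) (u x) * w x).im) := by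
    intro x
    simp only [DI2, mjf, cff, Fin.sum_univ_three]; ring
  have a2 : ∀ x, 2 * DJ2 ε u (x, y) + 1/2 * DJ3 ε u (x, y) + 1/2 * DJ4 ε u (x, y) = ‖u y‖ ^ 2 * (2 * (∑ j, ∑ k, dd k (fun x => bv ε j (x - y)) x * rin (dd k u) (dd j u) x) + 1/2 * (dvb ε (x - y) * ‖u x‖ ^ 4)
        - 1/2 * ((∑ k, dd k (dd k (fun x => dvb ε (x - y))) x) * ‖u x‖ ^ 2)) := by
    intro x
    have b1 : ∀ k, dd k (dd k (fun x => dvb ε (x - y))) x = dd k (dd k (dvb ε)) (x - y) := by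
      intro k
      rw [show dd k (fun x => dvb ε (x - y)) = fun x => dd k (dvb ε) (x - y) from funext fun x => dd_sub_const _ _ _ _, dd_sub_const]
    simp only [b1, lap_dvb hε, dd_sub_const]
    simp only [DJ2, DJ3, DJ4, Hk, dk, Fin.sum_univ_three]; ring
  simp only [a1, a2]
  rw [integral_const_mul, integral_const_mul, hs]

theorem DJ_nonneg (hε : 0 < ε) (hu : Sch u) : 0 ≤ ∫ z, (DJ2 ε u z - DJ1 ε u z) := by
  have hi : Integrable (fun z => DJ2 ε u z - DJ1 ε u z) := (DJ2_int hε hu).sub (DJ1_int hε hu)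
  have e : ∫ z : E3 × E3, (DJ2 ε u z.swap - DJ1 ε u z.swap) = ∫ z, (DJ2 ε u z - DJ1 ε u z) := 
    integral_prod_swap (μ := (volume : Measure E3)) (ν := (volume : Measure E3)) (fun z => DJ2 ε u z - DJ1 ε u z)
  have hi' : Integrable (fun z : E3 × E3 => DJ2 ε u z.swap - DJ1 ε u z.swap) := hi.swap
  have h2 : 0 ≤ ∫ z : E3 × E3, ((DJ2 ε u z - DJ1 ε u z) + (DJ2 ε u z.swap - DJ1 ε u z.swap)) := by
    refine integral_nonneg fun z => ?_
    have h3 := pw (H := fun j k => Hk ε j k (z.1 - z.2)) (Hk_psd hε _) (u z.1) (u z.2) (fun j => dd j u z.1) (fun j => dd j u z.2)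
    refine h3.trans_eq ?_
    simp only [DJ1, DJ2, Prod.fst_swap, Prod.snd_swap, pc, rin]
    have : ∀ j k, Hk ε j k (z.2 - z.1) = Hk ε j k (z.1 - z.2) := fun j k => by rw [← neg_sub, Hk_neg hε]
    simp only [this, ← Finset.sum_sub_distrib, ← Finset.sum_add_distrib]
    refine Finset.sum_congr rfl fun j _ => Finset.sum_congr rfl fun k _ => ?_
    ring
  rw [integral_add hi hi', e] at h2
  linarith

theorem D_static (hε : 0 < ε) (hu : Sch u) (hw : Sch w) (hr : ∀ y, rtf u w y = -2 * ∑ k, dd k (pc k u) y)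
    (he : ∀ x, w x = I * (lap u x - u x * u x * (starRingEnd ℂ) (u x))) :
    1/2 * ∫ z, DJ4 ε u z ≤ ∫ z, (DI1 ε u w z + DI2 ε u w z) := by
  rw [integral_add (DI1_int hε hu hw) (DI2_int hε hu hw), DI1_eq hε hu hw hr, DI2_eq hε hu hw he, integral_const_mul]
  have i23 : Integrable (fun z => 2 * DJ2 ε u z + 1/2 * DJ3 ε u z) := ((DJ2_int hε hu).const_mul 2).add ((DJ3_int hε hu).const_mul _)
  rw [integral_add i23 ((DJ4_int hε hu).const_mul _),
    integral_add ((DJ2_int hε hu).const_mul 2) ((DJ3_int hε hu).const_mul _), integral_const_mul, integral_const_mul, integral_const_mul]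
  have h1 := DJ_nonneg hε hu
  rw [integral_sub (DJ2_int hε hu) (DJ1_int hε hu)] at h1
  have h2 : 0 ≤ ∫ z, DJ3 ε u z := integral_nonneg fun z => by
    have := dvb_nonneg hε (z.1 - z.2)
    unfold DJ3; positivity
  linarith
end
end

section

def njf (u w : E3 → ℂ) (j : Fin 3) (x : E3) : ℝ := ((starRingEnd ℂ) (u x) * dd j w x).im
theorem njf_sch {u w : E3 → ℂ} (hu : Sch u) (hw : Sch w) (j : Fin 3) : Sch (njf u w j) := (hu.conj.mul (hw.dd j)).im
def Gp (n : ℕ) (ε : ℝ) (u w : E3 → ℂ) (z : E3 × E3) : ℝ := 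
  cut n z.1 * cut n z.2 * (rtf u w z.2 * ∑ j, bv ε j (z.1 - z.2) * pc j u z.1 
    + ‖u z.2‖ ^ 2 * ∑ j, bv ε j (z.1 - z.2) * (mjf u w j z.1 + njf u w j z.1))
def Ent (n : ℕ) (ε : ℝ) (u w : E3 → ℂ) (z : E3 × E3) : ℝ := 
  cut n z.1 * cut n z.2 * (DI1 ε u w z + DI2 ε u w z) 
    - cut n z.2 * (‖u z.2‖ ^ 2 * ∑ j, dd j (cut n) z.1 * (bv ε j (z.1 - z.2) * cff u w z.1))
def Ebd (K : ℝ) (u w : E3 → ℂ) (z : E3 × E3) : ℝ := 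
  (∑ j, (‖u z.1‖ * ‖dd j u z.1‖) * (2 * (‖u z.2‖ * ‖w z.2‖))) + (2 * ∑ j, (‖w z.1‖ * ‖dd j u z.1‖) * ‖u z.2‖ ^ 2)
    + K * ((‖u z.1‖ * ‖w z.1‖) * ‖u z.2‖ ^ 2)

section
variable {ε : ℝ} {u w : E3 → ℂ} 

theorem mem_K (n : ℕ) {z : E3 × E3} (h : z ∉ Metric.closedBall (0:E3) (2 * (n + 1)) ×ˢ Metric.closedBall (0:E3) (2 * (n + 1))) : 
    cut n z.1 * cut n z.2 = 0 := by
  rw [Set.mem_prod, not_and_or] at h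
  rcases h with h | h
  · rw [cut_supp n _ h, zero_mul]
  · rw [cut_supp n _ h, mul_zero]

theorem cpt_K (n : ℕ) : IsCompact (Metric.closedBall (0:E3) (2 * (n + 1)) ×ˢ Metric.closedBall (0:E3) (2 * (n + 1))) :=
  (isCompact_closedBall _ _).prod (isCompact_closedBall _ _)

theorem Gp_int (hε : 0 < ε) (hu : Sch u) (hw : Sch w) (n : ℕ) : Integrable (Gp n ε u w) := by
  refine Continuous.integrable_of_hasCompactSupport ?_ (HasCompactSupport.intro (cpt_K n) fun z hz => by rw [Gp, mem_K n hz, zero_mul])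
  have h1 := (cut_smooth n).continuous
  have h2 := (rtf_sch hu hw).continuous
  have h3 := hu.continuous
  have h4 := fun j => bv_cont hε j
  have h5 := fun j => (hu.pc j).continuous
  have h6 := fun j => (mjf_sch hu hw j).continuous
  have h7 := fun j => (njf_sch hu hw j).continuous
  unfold Gp
  fun_prop

theorem Ent_cont (hε : 0 < ε) (hu : Sch u) (hw : Sch w) (n : ℕ) : Continuous (Ent n ε u w) := by
  have h1 := (cut_smooth n).continuous
  have h1' := fun j => ((cut_sch n).dd j).continuous
  have h2 := (rtf_sch hu hw).continuous
  have h3 := hu.continuous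
  have h4 := fun j => bv_cont hε j
  have h4' := dvb_cont hε
  have h5 := fun j => (hu.pc j).continuous
  have h6 := fun j => (mjf_sch hu hw j).continuous
  have h7 := (cff_sch hu hw).continuous
  unfold Ent DI1 DI2
  fun_prop

theorem Ebd_int (hu : Sch u) (hw : Sch w) (K : ℝ) : Integrable (Ebd K u w) := by
  refine Integrable.add (Integrable.add ?_ ?_) ?_
  · exact integrable_finsetSum _ fun j _ => (hu.mulNorm (hu.dd j)).mul_prod ((hu.mulNorm hw).const_mul 2)
  · exact (integrable_finsetSum _ fun j _ => (hw.mulNorm (hu.dd j)).mul_prod hu.norm_sq.integrable).const_mul 2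
  · exact ((hu.mulNorm hw).mul_prod hu.norm_sq.integrable).const_mul K

theorem Ebd_le (hu : Sch u) (hw : Sch w) {K L : ℝ} (hK : 0 ≤ K) (h1 : ∫ x, ‖u x‖ ^ 2 ≤ L) (h2 : gs u ≤ L) (h3 : ∫ x, ‖w x‖ ^ 2 ≤ L) :
    ∫ z, Ebd K u w z ≤ (12 + K) * L ^ 2 := by
  have hL : 0 ≤ L := (integral_nonneg fun x => by positivity).trans h1
  have l1 : l2 u ≤ √L := Real.sqrt_le_sqrt h1
  have l3 : l2 w ≤ √L := Real.sqrt_le_sqrt h3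
  have l4 : ∀ j, l2 (dd j u) ≤ √L := fun j => (l2_dd_le hu j).trans (Real.sqrt_le_sqrt h2)
  have mm : ∀ {f g : E3 → ℂ}, Sch f → Sch g → l2 f ≤ √L → l2 g ≤ √L → ∫ x, ‖f x‖ * ‖g x‖ ≤ L := by
    intro f g hf hg a b
    refine (cs_sch hf hg).trans ?_
    calc l2 f * l2 g ≤ √L * √L := mul_le_mul a b (l2_nonneg _) (Real.sqrt_nonneg _)
      _ = L := Real.mul_self_sqrt hL
  have A : ∀ j, Integrable (fun z : E3 × E3 => (‖u z.1‖ * ‖dd j u z.1‖) * (2 * (‖u z.2‖ * ‖w z.2‖))) := 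
    fun j => (hu.mulNorm (hu.dd j)).mul_prod ((hu.mulNorm hw).const_mul 2)
  have B : ∀ j, Integrable (fun z : E3 × E3 => (‖w z.1‖ * ‖dd j u z.1‖) * ‖u z.2‖ ^ 2) := 
    fun j => (hw.mulNorm (hu.dd j)).mul_prod hu.norm_sq.integrable
  have C : Integrable (fun z : E3 × E3 => (‖u z.1‖ * ‖w z.1‖) * ‖u z.2‖ ^ 2) := (hu.mulNorm hw).mul_prod hu.norm_sq.integrable
  have A' : Integrable (fun z : E3 × E3 => ∑ j, (‖u z.1‖ * ‖dd j u z.1‖) * (2 * (‖u z.2‖ * ‖w z.2‖))) := integrable_finsetSum _ fun j _ => A j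
  have B' : Integrable (fun z : E3 × E3 => 2 * ∑ j, (‖w z.1‖ * ‖dd j u z.1‖) * ‖u z.2‖ ^ 2) := (integrable_finsetSum _ fun j _ => B j).const_mul 2
  have AB : Integrable (fun z : E3 × E3 => (∑ j, (‖u z.1‖ * ‖dd j u z.1‖) * (2 * (‖u z.2‖ * ‖w z.2‖))) + 2 * ∑ j, (‖w z.1‖ * ‖dd j u z.1‖) * ‖u z.2‖ ^ 2) := A'.add B'
  have pI : ∀ {f g : E3 → ℝ}, (∀ x, 0 ≤ f x) → (∀ x, 0 ≤ g x) → ∀ {a b}, ∫ x, f x ≤ a → ∫ x, g x ≤ b → ∫ z : E3 × E3, f z.1 * g z.2 ≤ a * b := by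
    intro f g hf hg a b ha hb
    rw [Measure.volume_eq_prod, integral_prod_mul (μ := (volume : Measure E3)) (ν := (volume : Measure E3)) f g]
    exact mul_le_mul ha hb (integral_nonneg hg) ((integral_nonneg hf).trans ha)
  have p1 : ∀ j, ∫ z : E3 × E3, (‖u z.1‖ * ‖dd j u z.1‖) * (2 * (‖u z.2‖ * ‖w z.2‖)) ≤ L * (2 * L) := fun j => 
    pI (f := fun x => ‖u x‖ * ‖dd j u x‖) (g := fun x => 2 * (‖u x‖ * ‖w x‖)) (fun x => by positivity) (fun x => by positivity) (mm hu (hu.dd j) l1 (l4 j)) 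
      (by rw [integral_const_mul]; linarith [mm hu hw l1 l3])
  have p2 : ∀ j, ∫ z : E3 × E3, (‖w z.1‖ * ‖dd j u z.1‖) * ‖u z.2‖ ^ 2 ≤ L * L := fun j => 
    pI (f := fun x => ‖w x‖ * ‖dd j u x‖) (g := fun x => ‖u x‖ ^ 2) (fun x => by positivity) (fun x => by positivity) (mm hw (hu.dd j) l3 (l4 j)) h1
  have p3 : ∫ z : E3 × E3, (‖u z.1‖ * ‖w z.1‖) * ‖u z.2‖ ^ 2 ≤ L * L :=
    pI (f := fun x => ‖u x‖ * ‖w x‖) (g := fun x => ‖u x‖ ^ 2) (fun x => by positivity) (fun x => by positivity) (mm hu hw l1 l3) h1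
  unfold Ebd
  rw [integral_add AB (C.const_mul K), integral_add A' B', integral_const_mul, integral_const_mul, integral_finsetSum _ fun j _ => A j, integral_finsetSum _ fun j _ => B j]
  simp only [Fin.sum_univ_three]
  nlinarith [p1 0, p1 1, p1 2, p2 0, p2 1, p2 2, mul_le_mul_of_nonneg_left p3 hK]

theorem Ent_bd (hε : 0 < ε) {C : ℝ} (hC : 0 ≤ C) {n : ℕ} (hc : ∀ (j : Fin 3) (x : E3), |dd j (cut n) x| ≤ C) (z : E3 × E3) :
    |Ent n ε u w z| ≤ Ebd (3 * ε⁻¹ + 3 * C) u w z := by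
  have a0 : |cut n z.1 * cut n z.2| ≤ 1 := by
    rw [abs_mul, abs_of_nonneg (cut_nonneg _ _), abs_of_nonneg (cut_nonneg _ _)]
    exact mul_le_one₀ (cut_le_one _ _) (cut_nonneg _ _) (cut_le_one _ _)
  have a1 : |cut n z.2| ≤ 1 := by rw [abs_of_nonneg (cut_nonneg _ _)]; exact cut_le_one _ _
  have r1 : |rtf u w z.2| ≤ 2 * (‖u z.2‖ * ‖w z.2‖) := by
    rw [rtf, abs_mul, abs_of_pos (by norm_num : (0:ℝ) < 2)]
    refine mul_le_mul_of_nonneg_left ((Complex.abs_re_le_norm _).trans ?_) (by norm_num)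
    rw [norm_mul, RCLike.norm_conj]
  have r2 : ∀ j, |mjf u w j z.1| ≤ ‖w z.1‖ * ‖dd j u z.1‖ := fun j => by
    refine (Complex.abs_im_le_norm _).trans ?_
    rw [norm_mul, RCLike.norm_conj]
  have r3 : |cff u w z.1| ≤ ‖u z.1‖ * ‖w z.1‖ := by
    refine (Complex.abs_im_le_norm _).trans ?_
    rw [norm_mul, RCLike.norm_conj]
  have i1 : |DI1 ε u w z| ≤ ∑ j, (‖u z.1‖ * ‖dd j u z.1‖) * (2 * (‖u z.2‖ * ‖w z.2‖)) := by
    refine (Finset.abs_sum_le_sum_abs _ _).trans (Finset.sum_le_sum fun j _ => ?_)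
    rw [abs_mul, abs_mul]
    calc _ ≤ 1 * (|pc j u z.1| * |rtf u w z.2|) := mul_le_mul_of_nonneg_right (bv_bd hε j _) (by positivity)
      _ ≤ _ := by rw [one_mul]; exact mul_le_mul (norm_pc_le j u _) r1 (abs_nonneg _) (by positivity)
  have i2 : |DI2 ε u w z| ≤ (2 * ∑ j, (‖w z.1‖ * ‖dd j u z.1‖) * ‖u z.2‖ ^ 2) + 3 * ε⁻¹ * ((‖u z.1‖ * ‖w z.1‖) * ‖u z.2‖ ^ 2) := by
    refine (abs_sub _ _).trans (add_le_add ?_ ?_)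
    · rw [abs_mul, abs_of_pos (by norm_num : (0:ℝ) < 2)]
      refine mul_le_mul_of_nonneg_left ((Finset.abs_sum_le_sum_abs _ _).trans (Finset.sum_le_sum fun j _ => ?_)) (by norm_num)
      rw [abs_mul, abs_mul, abs_of_nonneg (by positivity : 0 ≤ ‖u z.2‖ ^ 2)]
      calc _ ≤ 1 * (|mjf u w j z.1| * ‖u z.2‖ ^ 2) := mul_le_mul_of_nonneg_right (bv_bd hε j _) (by positivity)
        _ ≤ _ := by rw [one_mul]; exact mul_le_mul_of_nonneg_right (r2 j) (by positivity)
    · rw [abs_mul, abs_mul, abs_of_nonneg (by positivity : 0 ≤ ‖u z.2‖ ^ 2)]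
      exact mul_le_mul (dvb_bd hε _) (mul_le_mul_of_nonneg_right r3 (by positivity)) (by positivity) (by positivity)
  have i3 : |∑ j, dd j (cut n) z.1 * (bv ε j (z.1 - z.2) * cff u w z.1)| ≤ 3 * C * (‖u z.1‖ * ‖w z.1‖) := by
    have : ∀ j ∈ Finset.univ, |dd j (cut n) z.1 * (bv ε j (z.1 - z.2) * cff u w z.1)| ≤ C * (‖u z.1‖ * ‖w z.1‖) := by
      intro j _
      rw [abs_mul, abs_mul]
      refine mul_le_mul (hc j _) ?_ (by positivity) hC
      calc _ ≤ 1 * |cff u w z.1| := mul_le_mul_of_nonneg_right (bv_bd hε j _) (by positivity)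
        _ ≤ _ := by rw [one_mul]; exact r3
    refine (Finset.abs_sum_le_sum_abs _ _).trans ((Finset.sum_le_sum this).trans ?_)
    simp; linarith
  unfold Ent Ebd
  have j1 : |cut n z.1 * cut n z.2 * (DI1 ε u w z + DI2 ε u w z)| ≤ |DI1 ε u w z| + |DI2 ε u w z| := by
    rw [abs_mul]
    calc _ ≤ 1 * |DI1 ε u w z + DI2 ε u w z| := mul_le_mul_of_nonneg_right a0 (abs_nonneg _)
      _ ≤ _ := by rw [one_mul]; exact abs_add_le _ _
  have j2 : |cut n z.2 * (‖u z.2‖ ^ 2 * ∑ j, dd j (cut n) z.1 * (bv ε j (z.1 - z.2) * cff u w z.1))| ≤ ‖u z.2‖ ^ 2 * (3 * C * (‖u z.1‖ * ‖w z.1‖)) := by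
    rw [abs_mul, abs_mul, abs_of_nonneg (by positivity : 0 ≤ ‖u z.2‖ ^ 2)]
    calc _ ≤ 1 * (‖u z.2‖ ^ 2 * |∑ j, dd j (cut n) z.1 * (bv ε j (z.1 - z.2) * cff u w z.1)|) := mul_le_mul_of_nonneg_right a1 (by positivity)
      _ ≤ _ := by rw [one_mul]; exact mul_le_mul_of_nonneg_left i3 (by positivity)
  refine (abs_sub _ _).trans ?_
  linarith

theorem Ent_int (hε : 0 < ε) (hu : Sch u) (hw : Sch w) (n : ℕ) : Integrable (Ent n ε u w) := by
  obtain ⟨C, hC, hc⟩ := cut_bounds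
  refine (Ebd_int hu hw _).mono' (Ent_cont hε hu hw n).aestronglyMeasurable (Eventually.of_forall fun z => Ent_bd hε (C := C / (n+1)) (by positivity) (fun j x => (hc n j x).1) z)

theorem Gp_eq (hε : 0 < ε) (hu : Sch u) (hw : Sch w) (n : ℕ) : ∫ z, Gp n ε u w z = ∫ z, Ent n ε u w z := by
  have e1 : ∫ z, Gp n ε u w z = ∫ y, ∫ x, Gp n ε u w (x, y) := integral_prod_symm _ (Gp_int hε hu hw n)
  have e2 : ∫ z, Ent n ε u w z = ∫ y, ∫ x, Ent n ε u w (x, y) := integral_prod_symm _ (Ent_int hε hu hw n)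
  rw [e1, e2]
  refine integral_congr_ae (Eventually.of_forall fun y => ?_)
  simp only
  have hbt : ∀ j, (fun x => bv ε j (x - y)).HasTemperateGrowth := fun j => temp_sub (bv_temp hε j) y
  have hat : ∀ j, (fun x => cut n x * bv ε j (x - y)).HasTemperateGrowth := fun j => (cut_sch n).temp.mul (hbt j)
  have hF := cff_sch hu hw
  -- pointwise: dd j cff = njf - mjf
  have dF : ∀ j x, dd j (cff u w) x = njf u w j x - mjf u w j x := by
    intro j x
    unfold cff njf mjf
    rw [dd_im j ((hu.conj.mul hw).da x), dd_mul j (hu.conj.da x) (hw.da x), dd_conj j (hu.da x)]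
    simp [Complex.mul_im]; ring
  have dA : ∀ j x, dd j (fun x => cut n x * bv ε j (x - y)) x = dd j (cut n) x * bv ε j (x - y) + cut n x * dd j (bv ε j) (x - y) := by
    intro j x
    rw [dd_mul j ((cut_sch n).da x) ((hbt j).1.differentiable (by simp) x), dd_sub_const]
  have key : ∀ j, ∫ x, (cut n x * bv ε j (x - y)) * dd j (cff u w) x = - ∫ x, dd j (fun x => cut n x * bv ε j (x - y)) x * cff u w x := fun j => ibpT (hat j) hF j
  have kS : ∫ x, ∑ j, ((cut n x * bv ε j (x - y)) * dd j (cff u w) x + dd j (fun x => cut n x * bv ε j (x - y)) x * cff u w x) = 0 := by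
    have s1 : ∀ j, Integrable fun x => (cut n x * bv ε j (x - y)) * dd j (cff u w) x := fun j => (Sch.mulT (hat j) (hF.dd j)).integrable
    have s2 : ∀ j, Integrable fun x => dd j (fun x => cut n x * bv ε j (x - y)) x * cff u w x := fun j => (Sch.mulT (temp_dd (hat j) j) hF).integrable
    have s3 : ∀ j, Integrable fun x => (cut n x * bv ε j (x - y)) * dd j (cff u w) x + dd j (fun x => cut n x * bv ε j (x - y)) x * cff u w x := fun j => (s1 j).add (s2 j)
    rw [integral_finsetSum _ fun j _ => s3 j]
    refine Finset.sum_eq_zero fun j _ => ?_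
    rw [integral_add (s1 j) (s2 j), key]; ring
  have si : Integrable fun x => ∑ j, ((cut n x * bv ε j (x - y)) * dd j (cff u w) x + dd j (fun x => cut n x * bv ε j (x - y)) x * cff u w x) :=
    integrable_finsetSum _ fun j _ => (Sch.mulT (hat j) (hF.dd j)).integrable.add (Sch.mulT (temp_dd (hat j) j) hF).integrable
  have pt : ∀ x, Gp n ε u w (x, y) = Ent n ε u w (x, y) + (cut n y * ‖u y‖ ^ 2) * ∑ j, ((cut n x * bv ε j (x - y)) * dd j (cff u w) x + dd j (fun x => cut n x * bv ε j (x - y)) x * cff u w x) := by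
    intro x
    have hd := div_bv hε (x - y)
    simp only [dF, dA]
    simp only [Gp, Ent, DI1, DI2]
    rw [← hd]
    simp only [Fin.sum_univ_three]
    ring
  have ei : Integrable fun x => Ent n ε u w (x, y) := by
    have t1 : Sch (fun x => Ent n ε u w (x, y)) := by
      simp only [Ent, DI1, DI2]
      have q1 : Sch fun x => cut n x * (cut n y * (((∑ j, bv ε j (x - y) * (pc j u x * rtf u w y))) + (2 * (∑ j, bv ε j (x - y) * (mjf u w j x * ‖u y‖ ^ 2)) - dvb ε (x - y) * (cff u w x * ‖u y‖ ^ 2)))) := by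
        refine (cut_sch n).mul (Sch.cmul _ (Sch.add (Sch.sum _ fun j _ => Sch.mulT (hbt j) ((Sch.cmul (rtf u w y) (hu.pc j)).congr fun x => by ring)) (Sch.sub (Sch.cmul _ (Sch.sum _ fun j _ => Sch.mulT (hbt j) ((Sch.cmul (‖u y‖^2) (mjf_sch hu hw j)).congr fun x => by ring))) (Sch.mulT (temp_sub (dvb_temp hε) y) ((Sch.cmul (‖u y‖^2) hF).congr fun x => by ring)))))
      have q2 : Sch fun x => cut n y * (‖u y‖ ^ 2 * ∑ j, dd j (cut n) x * (bv ε j (x - y) * cff u w x)) := 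
        Sch.cmul _ (Sch.cmul _ (Sch.sum _ fun j _ => ((cut_sch n).dd j).mul (Sch.mulT (hbt j) hF)))
      exact (q1.sub q2).congr fun x => by ring
    exact t1.integrable
  simp only [pt]
  rw [integral_add ei (si.const_mul _), integral_const_mul, kS, mul_zero, add_zero]

theorem Ent_tendsto (hε : 0 < ε) (hu : Sch u) (hw : Sch w) : 
    Tendsto (fun n => ∫ z, Ent n ε u w z) atTop (nhds (∫ z, (DI1 ε u w z + DI2 ε u w z))) := by
  obtain ⟨C, hC, hc⟩ := cut_bounds
  have hc' : ∀ n j x, |dd j (cut n) x| ≤ C := fun n j x => (hc n j x).1.trans (div_le_self hC (by linarith [(Nat.cast_nonneg n : (0:ℝ) ≤ n)]))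
  refine tendsto_integral_of_dominated_convergence (Ebd (3 * ε⁻¹ + 3 * C) u w) (fun n => (Ent_cont hε hu hw n).aestronglyMeasurable) (Ebd_int hu hw _)
    (fun n => Eventually.of_forall fun z => Ent_bd hε hC (hc' n) z) (Eventually.of_forall fun z => ?_)
  have t1 := cut_tendsto z.1
  have t2 := cut_tendsto z.2
  have t3 : ∀ j, Tendsto (fun n => dd j (cut n) z.1) atTop (nhds 0) := fun j => 
    squeeze_zero_norm (fun n => (hc n j z.1).1) (tendsto_cdiv C)
  have := (((t1.mul t2).mul_const (DI1 ε u w z + DI2 ε u w z)).sub 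
    (t2.mul ((tendsto_finsetSum Finset.univ fun j _ => (t3 j).mul_const (bv ε j (z.1 - z.2) * cff u w z.1)).const_mul (‖u z.2‖ ^ 2))))
  simpa [Ent] using this
end
end

section

def Mi (ε : ℝ) (u : E3 → ℂ) (z : E3 × E3) : ℝ := ‖u z.2‖ ^ 2 * ∑ j, bv ε j (z.1 - z.2) * pc j u z.1
theorem Mi_int {ε : ℝ} (hε : 0 < ε) {u : E3 → ℂ} (hu : Sch u) : Integrable (Mi ε u) := by
  have h : Integrable (fun z : E3 × E3 => ∑ j, bv ε j (z.1 - z.2) * (pc j u z.1 * ‖u z.2‖ ^ 2)) := 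
    integrable_finsetSum _ fun j _ => kIs (bv_cont hε j) (bv_bd hε j) (hu.pc j) hu.norm_sq
  refine h.congr (Eventually.of_forall fun z => ?_)
  simp only [Mi, Fin.sum_univ_three]; ring

theorem Mi_bd {ε : ℝ} (hε : 0 < ε) (s : SchwartzMap E3 ℂ) : |∫ z, Mi ε s z| ≤ 1300 * sobSq (1/2) s * ∫ x, ‖s x‖ ^ 2 := by
  have hs : Sch (s : E3 → ℂ) := Sch.coe' s
  have e1 : ∫ z, Mi ε s z = ∫ y, ∫ x, Mi ε s (x, y) := integral_prod_symm _ (Mi_int hε hs)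
  rw [e1, ← integral_const_mul, ← Real.norm_eq_abs]
  refine norm_integral_le_of_norm_le (hs.norm_sq.integrable.const_mul _) (Eventually.of_forall fun y => ?_)
  have : ∫ x, Mi ε s (x, y) = ‖s y‖ ^ 2 * Bf ε y s s := by
    simp only [Mi]; rw [integral_const_mul]; rfl
  rw [this, Real.norm_eq_abs, abs_mul, abs_of_nonneg (by positivity : 0 ≤ ‖s y‖ ^ 2), mul_comm]
  exact mul_le_mul_of_nonneg_right (Bf_half hε y s) (by positivity)

theorem Mi_cut {ε : ℝ} (hε : 0 < ε) {u : E3 → ℂ} (hu : Sch u) : 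
    Tendsto (fun n => ∫ z, cut n z.1 * cut n z.2 * Mi ε u z) atTop (nhds (∫ z, Mi ε u z)) := by
  have hi := Mi_int hε hu
  refine tendsto_integral_of_dominated_convergence (fun z => ‖Mi ε u z‖) (fun n => ?_) hi.norm (fun n => Eventually.of_forall fun z => ?_) (Eventually.of_forall fun z => ?_)
  · have h1 := (cut_smooth n).continuous
    have : Continuous fun z : E3 × E3 => cut n z.1 * cut n z.2 := by fun_prop
    exact this.aestronglyMeasurable.mul hi.aestronglyMeasurable
  · rw [norm_mul]
    refine mul_le_of_le_one_left (norm_nonneg _) ?_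
    rw [Real.norm_eq_abs, abs_mul, abs_of_nonneg (cut_nonneg _ _), abs_of_nonneg (cut_nonneg _ _)]
    exact mul_le_one₀ (cut_le_one _ _) (cut_nonneg _ _) (cut_le_one _ _)
  · simpa using ((cut_tendsto z.1).mul (cut_tendsto z.2)).mul_const (Mi ε u z)

section
variable {T : ℝ} {u : ℝ → E3 → ℂ}

theorem Gp_cont (h : Sol T u) {ε : ℝ} (hε : 0 < ε) (n : ℕ) : Continuous (fun p : ℝ × (E3 × E3) => Gp n ε (u p.1) (dt u p.1) p.2) := by
  have h1 := (cut_smooth n).continuous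
  have h2 := h.sm.continuous
  have h3 := h.sm.dt.continuous
  have h4 := fun j => (h.sm.dd j).continuous
  have h5 := fun j => (h.sm.dt.dd j).continuous
  have h6 := fun j => bv_cont hε j
  have x1 : Continuous (fun p : ℝ × (E3 × E3) => u p.1 p.2.1) := h2.comp (by fun_prop : Continuous fun p : ℝ × (E3 × E3) => (p.1, p.2.1))
  have x2 : Continuous (fun p : ℝ × (E3 × E3) => u p.1 p.2.2) := h2.comp (by fun_prop : Continuous fun p : ℝ × (E3 × E3) => (p.1, p.2.2))
  have x3 : Continuous (fun p : ℝ × (E3 × E3) => dt u p.1 p.2.1) := h3.comp (by fun_prop : Continuous fun p : ℝ × (E3 × E3) => (p.1, p.2.1))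
  have x4 : Continuous (fun p : ℝ × (E3 × E3) => dt u p.1 p.2.2) := h3.comp (by fun_prop : Continuous fun p : ℝ × (E3 × E3) => (p.1, p.2.2))
  have x5 : ∀ j, Continuous (fun p : ℝ × (E3 × E3) => dd j (u p.1) p.2.1) := fun j => (h4 j).comp (by fun_prop : Continuous fun p : ℝ × (E3 × E3) => (p.1, p.2.1))
  have x6 : ∀ j, Continuous (fun p : ℝ × (E3 × E3) => dd j (dt u p.1) p.2.1) := fun j => (h5 j).comp (by fun_prop : Continuous fun p : ℝ × (E3 × E3) => (p.1, p.2.1))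
  unfold Gp rtf pc mjf njf
  fun_prop

theorem Mi_cont (h : Sol T u) {ε : ℝ} (hε : 0 < ε) (n : ℕ) : Continuous (fun p : ℝ × (E3 × E3) => cut n p.2.1 * cut n p.2.2 * Mi ε (u p.1) p.2) := by
  have h1 := (cut_smooth n).continuous
  have h2 := h.sm.continuous
  have h4 := fun j => (h.sm.dd j).continuous
  have h6 := fun j => bv_cont hε j
  have x1 : Continuous (fun p : ℝ × (E3 × E3) => u p.1 p.2.1) := h2.comp (by fun_prop : Continuous fun p : ℝ × (E3 × E3) => (p.1, p.2.1))
  have x2 : Continuous (fun p : ℝ × (E3 × E3) => u p.1 p.2.2) := h2.comp (by fun_prop : Continuous fun p : ℝ × (E3 × E3) => (p.1, p.2.2))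
  have x5 : ∀ j, Continuous (fun p : ℝ × (E3 × E3) => dd j (u p.1) p.2.1) := fun j => (h4 j).comp (by fun_prop : Continuous fun p : ℝ × (E3 × E3) => (p.1, p.2.1))
  unfold Mi pc
  fun_prop

theorem pc_deriv (h : Sol T u) (j : Fin 3) (t : ℝ) (x : E3) :
    HasDerivAt (fun s => pc j (u s) x) (mjf (u t) (dt u t) j x + njf (u t) (dt u t) j x) t := by
  have h1 := h.sm.hasDerivAt t x
  have h2 := h.sm.hasDerivAt_dd j t x
  have h1c : HasDerivAt (fun s => (starRingEnd ℂ) (u s x)) ((starRingEnd ℂ) (dt u t x)) t := 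
    (Complex.conjCLE : ℂ →L[ℝ] ℂ).hasFDerivAt.comp_hasDerivAt t h1
  have h3 := h1c.mul h2
  have h4 := Complex.imCLM.hasFDerivAt.comp_hasDerivAt t h3
  refine h4.congr_deriv ?_
  simp [mjf, njf]

theorem Mi_deriv (h : Sol T u) {ε : ℝ} (n : ℕ) (t : ℝ) (z : E3 × E3) :
    HasDerivAt (fun s => cut n z.1 * cut n z.2 * Mi ε (u s) z) (Gp n ε (u t) (dt u t) z) t := by
  refine HasDerivAt.const_mul _ ?_
  unfold Mi
  refine (h.rho_deriv t z.2).mul ?_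
  exact HasDerivAt.fun_sum fun j _ => (pc_deriv h j t z.1).const_mul _

theorem Mn_deriv (h : Sol T u) {ε : ℝ} (hε : 0 < ε) (n : ℕ) (t : ℝ) :
    HasDerivAt (fun s => ∫ z, cut n z.1 * cut n z.2 * Mi ε (u s) z) (∫ z, Ent n ε (u t) (dt u t) z) t := by
  rw [← Gp_eq hε (h.us t) (h.ws t) n]
  exact hasDerivAt_cpt (F := fun s z => cut n z.1 * cut n z.2 * Mi ε (u s) z) (F' := fun s z => Gp n ε (u s) (dt u s) z)
    (Mi_cont h hε n) (Gp_cont h hε n) (Mi_deriv h n) (cpt_K n) (fun t z hz => by rw [mem_K n hz, zero_mul]) t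

theorem Dn_cont (h : Sol T u) {ε : ℝ} (hε : 0 < ε) (n : ℕ) : Continuous (fun t => ∫ z, Ent n ε (u t) (dt u t) z) := by
  simp only [← Gp_eq hε (h.us _) (h.ws _) n]
  exact continuous_cpt (F := fun s z => Gp n ε (u s) (dt u s) z) (Gp_cont h hε n) (cpt_K n) (fun t z hz => by rw [Gp, mem_K n hz, zero_mul])

def Dt (ε : ℝ) (u : ℝ → E3 → ℂ) (t : ℝ) : ℝ := ∫ z, (DI1 ε (u t) (dt u t) z + DI2 ε (u t) (dt u t) z)

theorem morawetz (h : Sol T u) (hT : 0 < T) {ε : ℝ} (hε : 0 < ε) : 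
    IntervalIntegrable (Dt ε u) volume 0 T ∧ ∫ t in (0)..T, Dt ε u t = (∫ z, Mi ε (u T) z) - ∫ z, Mi ε (u 0) z := by
  obtain ⟨L, hL⟩ := h.unif
  obtain ⟨C, hC, hc⟩ := cut_bounds
  have hc' : ∀ n j x, |dd j (cut n) x| ≤ C := fun n j x => (hc n j x).1.trans (div_le_self hC (by linarith [(Nat.cast_nonneg n : (0:ℝ) ≤ n)]))
  have bd : ∀ n, ∀ t ∈ Set.Icc 0 T, ‖∫ z, Ent n ε (u t) (dt u t) z‖ ≤ (12 + (3 * ε⁻¹ + 3 * C)) * L ^ 2 := by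
    intro n t ht
    have g := hL t ht
    refine (norm_integral_le_of_norm_le (Ebd_int (h.us t) (h.ws t) (3 * ε⁻¹ + 3 * C)) (Eventually.of_forall fun z => Ent_bd hε hC (hc' n) z)).trans ?_
    exact Ebd_le (h.us t) (h.ws t) (by positivity) g.a1 g.a2 g.a4
  have lim : ∀ t, Tendsto (fun n => ∫ z, Ent n ε (u t) (dt u t) z) atTop (nhds (Dt ε u t)) := fun t => Ent_tendsto hε (h.us t) (h.ws t)
  have hu : Set.uIoc 0 T ⊆ Set.Icc 0 T := by rw [Set.uIoc_of_le hT.le]; exact Set.Ioc_subset_Icc_self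
  have t1 : Tendsto (fun n => ∫ t in (0)..T, ∫ z, Ent n ε (u t) (dt u t) z) atTop (nhds (∫ t in (0)..T, Dt ε u t)) := by
    refine intervalIntegral.tendsto_integral_filter_of_dominated_convergence (fun _ => (12 + (3 * ε⁻¹ + 3 * C)) * L ^ 2) ?_ ?_ ?_ ?_
    · exact Eventually.of_forall fun n => (Dn_cont h hε n).aestronglyMeasurable
    · exact Eventually.of_forall fun n => Eventually.of_forall fun t ht => bd n t (hu ht)
    · exact intervalIntegrable_const
    · exact Eventually.of_forall fun t _ => lim t
  have t2 : ∀ n, ∫ t in (0)..T, ∫ z, Ent n ε (u t) (dt u t) z = (∫ z, cut n z.1 * cut n z.2 * Mi ε (u T) z) - ∫ z, cut n z.1 * cut n z.2 * Mi ε (u 0) z := fun n =>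
    intervalIntegral.integral_eq_sub_of_hasDerivAt (fun t _ => Mn_deriv h hε n t) ((Dn_cont h hε n).intervalIntegrable _ _)
  simp only [t2] at t1
  refine ⟨?_, tendsto_nhds_unique t1 ((Mi_cut hε (h.us T)).sub (Mi_cut hε (h.us 0)))⟩
  refine (intervalIntegrable_const (c := (12 + (3 * ε⁻¹ + 3 * C)) * L ^ 2)).mono_fun ?_ ?_
  · have : StronglyMeasurable (Dt ε u) := stronglyMeasurable_of_tendsto atTop (fun n => (Dn_cont h hε n).stronglyMeasurable) (tendsto_pi_nhds.2 lim)
    exact this.aestronglyMeasurable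
  · filter_upwards [ae_restrict_mem measurableSet_uIoc] with t ht
    refine (le_of_tendsto (lim t).norm (Eventually.of_forall fun n => bd n t (hu ht))).trans (le_abs_self _)

theorem Dt_ge (h : Sol T u) {ε : ℝ} (hε : 0 < ε) {t : ℝ} (ht : t ∈ Set.Icc 0 T) : 1/2 * ∫ z, DJ4 ε (u t) z ≤ Dt ε u t :=
  D_static hε (h.us t) (h.ws t) (fun y => h.rho_t ht y) (fun x => h.eq t ht x)

theorem mass0 (h : Sol T u) {t : ℝ} (ht : t ∈ Set.Icc 0 T) : ∫ x, ‖u t x‖ ^ 2 = ∫ x, ‖u 0 x‖ ^ 2 := by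
  obtain ⟨L, hL⟩ := h.unif
  have hs : Set.uIcc 0 t ⊆ Set.Icc 0 T := by rw [Set.uIcc_of_le ht.1]; exact Set.Icc_subset_Icc le_rfl ht.2
  exact h.mass hs (fun s hs' => (hL s (hs hs')).a1) (fun s hs' => (hL s (hs hs')).a2)

theorem mor_bd (h : Sol T u) (hT : 0 < T) {ε : ℝ} (hε : 0 < ε) {B : ℝ} (hB : ∀ t ∈ Set.Icc 0 T, sobSq (1/2) (u t) ≤ B) :
    ∫ t in (0)..T, Dt ε u t ≤ 2600 * (∫ x, ‖u 0 x‖ ^ 2) * B := by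
  rw [(morawetz h hT hε).2]
  have key : ∀ t ∈ Set.Icc 0 T, |∫ z, Mi ε (u t) z| ≤ 1300 * B * ∫ x, ‖u 0 x‖ ^ 2 := by
    intro t ht
    obtain ⟨s, hs⟩ := h.us t
    have e : u t = s := funext hs
    have h1 := hB t ht
    have h2 := Mi_bd hε s
    rw [← mass0 h ht]
    rw [← e] at h2
    refine h2.trans (mul_le_mul_of_nonneg_right (by linarith) (integral_nonneg fun x => by positivity))
  have h1 := (abs_le.1 (key T ⟨hT.le, le_rfl⟩)).2
  have h2 := (abs_le.1 (key 0 ⟨le_rfl, hT.le⟩)).1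
  linarith
end
end

section

theorem dk_scale {ε : ℝ} (hε : 0 < ε) (v : E3) : dk ε (ε • v) = (ε ^ 3)⁻¹ * dk 1 v := by
  have : kap ε (ε • v) = ε⁻¹ * kap 1 v := by
    unfold kap
    rw [norm_smul, Real.norm_eq_abs, abs_of_pos hε, ← mul_inv]
    congr 1
    rw [show (ε * ‖v‖) ^ 2 + ε ^ 2 = ε ^ 2 * (‖v‖ ^ 2 + 1 ^ 2) by ring, Real.sqrt_mul (by positivity), Real.sqrt_sq hε.le]
  unfold dk
  rw [this]
  field_simp

theorem lint_scale {ε : ℝ} (hε : 0 < ε) {F : E3 → ℝ≥0∞} (hF : Measurable F) : 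
    ∫⁻ x, F x = ENNReal.ofReal (ε ^ 3) * ∫⁻ v, F (ε • v) := by
  have h1 : ∫⁻ v, F (ε • v) = ∫⁻ x, F x ∂(Measure.map (fun v : E3 => ε • v) volume) := 
    (lintegral_map hF (measurable_const_smul ε)).symm
  have h2 := Measure.map_addHaar_smul (volume : Measure E3) hε.ne'
  rw [h1, h2, lintegral_smul_measure, smul_eq_mul, ← mul_assoc, ← ENNReal.ofReal_mul (by positivity), finrank_euclideanSpace_fin,
    abs_of_pos (by positivity), mul_inv_cancel₀ (by positivity), ENNReal.ofReal_one, one_mul]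

theorem slice_scale {ε : ℝ} (hε : 0 < ε) {u : E3 → ℂ} (hu : Continuous u) (y : E3) :
    ∫⁻ x, ENNReal.ofReal (DJ4 ε u (x, y)) = ∫⁻ v, ENNReal.ofReal (dk 1 v * (‖u (y + ε • v)‖ ^ 2 * ‖u y‖ ^ 2)) := by
  have e1 : ∫⁻ x, ENNReal.ofReal (DJ4 ε u (x, y)) = ∫⁻ x, ENNReal.ofReal (DJ4 ε u (y + x, y)) := 
    (lintegral_add_left_eq_self (fun x => ENNReal.ofReal (DJ4 ε u (x, y))) y).symm
  have hk := dk_cont hε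
  rw [e1, lint_scale hε, ← lintegral_const_mul']
  · refine lintegral_congr fun v => ?_
    rw [← ENNReal.ofReal_mul (by positivity)]
    congr 1
    simp only [DJ4, add_sub_cancel_left]
    rw [dk_scale hε]
    field_simp
  · simp
  · refine Continuous.measurable ?_
    unfold DJ4
    refine ENNReal.continuous_ofReal.comp ?_
    fun_prop

theorem DJ4_lint {ε : ℝ} (hε : 0 < ε) {u : E3 → ℂ} (hu : Sch u) :
    ENNReal.ofReal (∫ z, DJ4 ε u z) = ∫⁻ z : E3 × E3, ENNReal.ofReal (dk 1 z.2 * (‖u (z.1 + ε • z.2)‖ ^ 2 * ‖u z.1‖ ^ 2)) := by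
  have hk := dk_cont hε
  have hk1 := dk_cont one_pos
  have hc := hu.continuous
  rw [ofReal_integral_eq_lintegral_ofReal (DJ4_int hε hu) (Eventually.of_forall fun z => by
    have := dk_nonneg hε (z.1 - z.2)
    unfold DJ4; positivity)]
  have m1 : Measurable (fun z => ENNReal.ofReal (DJ4 ε u z)) := by
    refine (ENNReal.continuous_ofReal.comp ?_).measurable
    unfold DJ4; fun_prop
  have m2 : Measurable (fun z : E3 × E3 => ENNReal.ofReal (dk 1 z.2 * (‖u (z.1 + ε • z.2)‖ ^ 2 * ‖u z.1‖ ^ 2))) := by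
    refine (ENNReal.continuous_ofReal.comp ?_).measurable
    fun_prop
  have e1 := lintegral_prod_symm' (μ := (volume : Measure E3)) (ν := (volume : Measure E3)) _ m1
  have e2 := lintegral_prod (μ := (volume : Measure E3)) (ν := (volume : Measure E3)) _ m2.aemeasurable
  rw [Measure.volume_eq_prod, e1, e2]
  exact lintegral_congr fun y => slice_scale hε hc y

def c1 : ℝ≥0∞ := ∫⁻ v : E3, ENNReal.ofReal (dk 1 v)
theorem c1_ne : c1 ≠ 0 := by
  have hk1 := dk_cont one_pos
  intro h
  have h2 := (lintegral_eq_zero_iff (ENNReal.continuous_ofReal.comp hk1).measurable).1 h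
  obtain ⟨v, hv⟩ := h2.exists
  have hp : 0 < dk 1 v := by 
    have := kap_pos one_pos v
    unfold dk; positivity
  simp only [Function.comp, Pi.zero_apply, ENNReal.ofReal_eq_zero] at hv
  linarith

section
variable {T : ℝ} {u : ℝ → E3 → ℂ}

theorem lint_bd (h : Sol T u) (hT : 0 < T) {ε : ℝ} (hε : 0 < ε) {B : ℝ} (hB : ∀ t ∈ Set.Icc 0 T, sobSq (1/2) (u t) ≤ B) :
    ∫⁻ t in Set.Ioc 0 T, ENNReal.ofReal (∫ z, DJ4 ε (u t) z) ≤ ENNReal.ofReal (5200 * (∫ x, ‖u 0 x‖ ^ 2) * B) := by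
  have hi := (morawetz h hT hε).1
  rw [intervalIntegrable_iff_integrableOn_Ioc_of_le hT.le] at hi
  have nn : ∀ t, 0 ≤ ∫ z, DJ4 ε (u t) z := fun t => integral_nonneg fun z => by
    have := dk_nonneg hε (z.1 - z.2)
    unfold DJ4; positivity
  have hge : ∀ᵐ t ∂(volume.restrict (Set.Ioc 0 T)), ∫ z, DJ4 ε (u t) z ≤ 2 * Dt ε u t := by
    filter_upwards [ae_restrict_mem measurableSet_Ioc] with t ht
    linarith [Dt_ge h hε (Set.Ioc_subset_Icc_self ht)]
  calc _ ≤ ∫⁻ t in Set.Ioc 0 T, ENNReal.ofReal (2 * Dt ε u t) := 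
        lintegral_mono_ae (hge.mono fun t ht => ENNReal.ofReal_le_ofReal ht)
    _ = ENNReal.ofReal (∫ t in Set.Ioc 0 T, 2 * Dt ε u t) := 
        (ofReal_integral_eq_lintegral_ofReal (hi.const_mul 2) (hge.mono fun t ht => (nn t).trans ht)).symm
    _ ≤ _ := by
      refine ENNReal.ofReal_le_ofReal ?_
      rw [integral_const_mul, ← intervalIntegral.integral_of_le hT.le]
      linarith [mor_bd h hT hε hB]

def Ph (u : ℝ → E3 → ℂ) (ε : ℝ) (p : ℝ × (E3 × E3)) : ℝ≥0∞ := 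
  ENNReal.ofReal (dk 1 p.2.2 * (‖u p.1 (p.2.1 + ε • p.2.2)‖ ^ 2 * ‖u p.1 p.2.1‖ ^ 2))

theorem Ph_c1 (h : Sol T u) (ε : ℝ) : Continuous (Ph u ε) := by
  have h2 := h.sm.continuous
  have hk1 := dk_cont one_pos
  have x1 : Continuous (fun q : ℝ × (E3 × E3) => u q.1 (q.2.1 + ε • q.2.2)) := 
    h2.comp (by fun_prop : Continuous fun q : ℝ × (E3 × E3) => (q.1, q.2.1 + ε • q.2.2))
  have x2 : Continuous (fun q : ℝ × (E3 × E3) => u q.1 q.2.1) := 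
    h2.comp (by fun_prop : Continuous fun q : ℝ × (E3 × E3) => (q.1, q.2.1))
  unfold Ph
  refine ENNReal.continuous_ofReal.comp ?_
  fun_prop
theorem Ph_c2 (h : Sol T u) (p : ℝ × (E3 × E3)) : Continuous (fun ε => Ph u ε p) := by
  have h2 := (h.us p.1).continuous
  unfold Ph
  refine ENNReal.continuous_ofReal.comp ?_
  fun_prop
theorem Ph_lim (h : Sol T u) (p : ℝ × (E3 × E3)) : liminf (fun n : ℕ => Ph u (1 / ((n:ℝ) + 1)) p) atTop = Ph u 0 p := 
  (((Ph_c2 h p).tendsto 0).comp tendsto_one_div_add_atTop_nhds_zero_nat).liminf_eq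

theorem fatou_bd (h : Sol T u) (hT : 0 < T) {B : ℝ} (hB : ∀ t ∈ Set.Icc 0 T, sobSq (1/2) (u t) ≤ B) :
    (∫⁻ t in Set.Ioc 0 T, ENNReal.ofReal (∫ x, ‖u t x‖ ^ 4)) * c1 ≤ ENNReal.ofReal (5200 * (∫ x, ‖u 0 x‖ ^ 2) * B) := by
  have hm : ∀ ε, Measurable (Ph u ε) := fun ε => (Ph_c1 h ε).measurable
  obtain ⟨μ, hμ⟩ : ∃ μ : Measure (ℝ × (E3 × E3)), μ = (volume.restrict (Set.Ioc 0 T)).prod volume := ⟨_, rfl⟩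
  have e : ∀ ε, ∫⁻ p, Ph u ε p ∂μ = ∫⁻ t in Set.Ioc 0 T, ∫⁻ z, Ph u ε (t, z) := fun ε => by
    rw [hμ]; exact lintegral_prod _ (hm ε).aemeasurable
  have b : ∀ n : ℕ, ∫⁻ p, Ph u (1 / ((n:ℝ) + 1)) p ∂μ ≤ ENNReal.ofReal (5200 * (∫ x, ‖u 0 x‖ ^ 2) * B) := by
    intro n
    have hn : 0 < 1 / ((n:ℝ) + 1) := by positivity
    rw [e]
    refine le_trans (le_of_eq ?_) (lint_bd h hT hn hB)
    refine lintegral_congr fun t => ?_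
    rw [DJ4_lint hn (h.us t)]
    simp only [Ph]
  have lim := Ph_lim h
  have F := lintegral_liminf_le (μ := μ) (u := (atTop : Filter ℕ)) (f := fun n : ℕ => Ph u (1 / ((n:ℝ) + 1))) (fun n => hm _)
  simp only [lim] at F
  have F2 : ∫⁻ p, Ph u 0 p ∂μ ≤ ENNReal.ofReal (5200 * (∫ x, ‖u 0 x‖ ^ 2) * B) := 
    F.trans (liminf_le_of_frequently_le' (Frequently.of_forall b))
  rw [e] at F2
  refine le_trans (le_of_eq ?_) F2
  have sl : ∀ t, ∫⁻ z, Ph u 0 (t, z) = ENNReal.ofReal (∫ x, ‖u t x‖ ^ 4) * c1 := by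
    intro t
    have hc := (h.us t).continuous
    have hk1 := dk_cont one_pos
    rw [ofReal_integral_eq_lintegral_ofReal (h.us t).norm_four.integrable (Eventually.of_forall fun z => by positivity), c1]
    have := lintegral_prod_mul (μ := (volume : Measure E3)) (ν := (volume : Measure E3)) (f := fun x => ENNReal.ofReal (‖u t x‖ ^ 4)) (g := fun v => ENNReal.ofReal (dk 1 v))
      (ENNReal.continuous_ofReal.comp (by fun_prop)).measurable.aemeasurable (ENNReal.continuous_ofReal.comp (by fun_prop)).measurable.aemeasurable
    rw [← this, ← Measure.volume_eq_prod]
    refine lintegral_congr fun z => ?_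
    rw [← ENNReal.ofReal_mul (by positivity), Ph]
    congr 1
    simp only [zero_smul, add_zero]; ring
  simp only [sl]
  have mt : Measurable fun t => ENNReal.ofReal (∫ x, ‖u t x‖ ^ 4) := by
    have : StronglyMeasurable fun t => ∫ x, ‖u t x‖ ^ 4 := 
      StronglyMeasurable.integral_prod_right' (f := fun p : ℝ × E3 => ‖u p.1 p.2‖ ^ 4) (h.sm.continuous.norm.pow 4).stronglyMeasurable
    exact this.measurable.ennreal_ofReal
  rw [lintegral_mul_const _ mt]

theorem final_bd (h : Sol T u) (hT : 0 < T) {B : ℝ} (hB : ∀ t ∈ Set.Icc 0 T, sobSq (1/2) (u t) ≤ B) :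
    (∫ t in (0)..T, ∫ x, ‖u t x‖ ^ 4) * (min c1 1).toReal ≤ 5200 * (∫ x, ‖u 0 x‖ ^ 2) * B := by
  have h1 := fatou_bd h hT hB
  have hB0 : 0 ≤ 5200 * (∫ x, ‖u 0 x‖ ^ 2) * B := by
    have a1 := mor_bd h hT one_pos hB
    have a2 : 0 ≤ ∫ t in (0)..T, Dt 1 u t := intervalIntegral.integral_nonneg hT.le fun t ht => by
      have := Dt_ge h one_pos ht
      have nn : 0 ≤ ∫ z, DJ4 1 (u t) z := integral_nonneg fun z => by
        have := dk_nonneg one_pos (z.1 - z.2)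
        unfold DJ4; positivity
      linarith
    linarith
  have h2 : (∫⁻ t in Set.Ioc 0 T, ENNReal.ofReal (∫ x, ‖u t x‖ ^ 4)) * min c1 1 ≤ ENNReal.ofReal (5200 * (∫ x, ‖u 0 x‖ ^ 2) * B) :=
    (mul_le_mul_right (min_le_left _ _) _).trans h1
  have h3 := ENNReal.toReal_mono ENNReal.ofReal_ne_top h2
  rw [ENNReal.toReal_mul, ENNReal.toReal_ofReal hB0] at h3
  have sm : StronglyMeasurable fun t => ∫ x, ‖u t x‖ ^ 4 := 
      StronglyMeasurable.integral_prod_right' (f := fun p : ℝ × E3 => ‖u p.1 p.2‖ ^ 4) (h.sm.continuous.norm.pow 4).stronglyMeasurable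
  rw [intervalIntegral.integral_of_le hT.le, integral_eq_lintegral_of_nonneg_ae (Eventually.of_forall fun t => integral_nonneg fun x => by positivity) sm.aestronglyMeasurable]
  exact h3

theorem main_bd : ∃ C > 0, ∀ T > 0, ∀ φ, IsSolution 1 1 (fun z => z) T φ → ∀ B, (∀ t ∈ Set.Icc 0 T, sobSq (1/2) (φ t) ≤ B) → 
    (∫ t in (0)..T, ∫ x, ‖φ t x‖^4) ≤ C * (∫ x, Complex.normSq (φ 0 x)) * B := by
  have hc : 0 < (min c1 1).toReal := ENNReal.toReal_pos (by simp [c1_ne]) (ne_top_of_le_ne_top ENNReal.one_ne_top (min_le_right _ _))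
  refine ⟨5200 / (min c1 1).toReal, by positivity, fun T hT φ hφ B hB => ?_⟩
  have h := final_bd (Sol.of hφ) hT hB
  simp only [Complex.normSq_eq_norm_sq]
  rw [← le_div_iff₀ hc] at h
  refine h.trans_eq ?_
  ring
end
end

/-- There is a universal `C > 0` such that every smooth decaying
solution `φ` of the cubic defocusing NLS `i ∂ₜ φ + Δφ = |φ|²φ` on `[0,T] × ℝ³`
(the gNLS with `α = μ = 1`, `f(z) = z`) satisfies the spacetime `L⁴` bound
`∫₀ᵀ∫ |φ|⁴ dx dt ≤ C ‖φ(0)‖²_{L²} sup_{t∈[0,T]} ‖φ(t)‖²_{Ḣ^{1/2}}`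
(the supremum expressed via an arbitrary upper bound `B`). -/
theorem cubic_spacetime_L4_bound :
    ∃ C > (0:ℝ), ∀ T > (0:ℝ), ∀ φ : ℝ → E3 → ℂ, IsSolution 1 1 (fun z => z) T φ →
      ∀ B : ℝ, (∀ t ∈ Set.Icc (0:ℝ) T, sobSq (1/2) (φ t) ≤ B) →
      (∫ t in (0:ℝ)..T, ∫ x : E3, ‖φ t x‖ ^ 4)
        ≤ C * (∫ x : E3, Complex.normSq (φ 0 x)) * B := by
  exact main_bd
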